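/- arXiv:2303.14808 — 2 statements merged into one kernel-verified Lean document; each statement's English description precedes it below -/
import Mathlib

section
/- Let μ be a compactly supported symmetric Borel probability measure on ℝ whose absolutely continuous part (with respect to Lebesgue measure) is nonzero, let A = sup{|λ| : λ ∈ supp μ}, and let F be a continuous centered stationary Gaussian process with spectral measure μ. Then there exist constants c, d₁, d₂ > 0 such that for every T ≥ e^8 and every ε with d₁·(log T)/√T ≤ ε ≤ d₂, one has P( N_F(T) ≥ (A/π)·T + ε·T ) ≤ exp( −c·(ε/log ε)⁴·T² ). -/
open MeasureTheory ProbabilityTheory Set ENNReal NNReal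

/-- The covariance kernel of a spectral measure: `k(t) = ∫ cos (λ t) dμ(λ)`. -/
noncomputable def covKernel (μ : Measure ℝ) (t : ℝ) : ℝ := ∫ l, Real.cos (l * t) ∂μ

/-- `F` is a continuous centered stationary Gaussian process on `(Ω, P)` with spectral
measure `μ`: sample paths are continuous and every finite linear combination
`∑ cᵢ F_{tᵢ}` is a centered real Gaussian with variance `∑ᵢⱼ cᵢ cⱼ k(tᵢ - tⱼ)`. -/
def IsSGP {Ω : Type*} [MeasurableSpace Ω] (P : Measure Ω) (μ : Measure ℝ)
    (F : ℝ → Ω → ℝ) : Prop :=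
  (∀ ω, Continuous fun t => F t ω) ∧
  ∀ (n : ℕ) (t : Fin n → ℝ) (c : Fin n → ℝ),
    P.map (fun ω => ∑ i, c i * F (t i) ω) =
      gaussianReal 0 (∑ i, ∑ j, c i * c j * covKernel μ (t i - t j)).toNNReal

/-- The zero count `N_F(T)` as an extended natural number. -/
noncomputable def zeroCount {Ω : Type*} (F : ℝ → Ω → ℝ) (T : ℝ) (ω : Ω) : ℕ∞ :=
  {t ∈ Set.Icc (0:ℝ) T | F t ω = 0}.encard

/-- The topological support of a Borel measure on ℝ. -/
def msupport (μ : Measure ℝ) : Set ℝ := {x : ℝ | ∀ U ∈ nhds x, 0 < μ U}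

lemma measure_compl_msupport (μ : Measure ℝ) : μ (msupport μ)ᶜ = 0 := by
  refine measure_null_of_locally_null _ fun x hx => ?_
  simp only [msupport, mem_compl_iff, mem_setOf_eq, not_forall, not_lt, nonpos_iff_eq_zero] at hx
  obtain ⟨U, hU, h0⟩ := hx
  exact ⟨U, mem_nhdsWithin_of_mem_nhds hU, h0⟩

lemma ae_abs_le_sSup_msupport {μ : Measure ℝ} (hcpt : Bornology.IsBounded (msupport μ)) :
    ∀ᵐ l ∂μ, |l| ≤ sSup ((fun x : ℝ => abs x) '' msupport μ) := by
  have h : ∀ᵐ l ∂μ, l ∈ msupport μ := measure_compl_msupport μ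
  filter_upwards [h] with l hl
  refine le_csSup ?_ ⟨l, hl, rfl⟩
  obtain ⟨R, hR⟩ := hcpt.exists_norm_le
  exact ⟨R, by rintro _ ⟨x, hx, rfl⟩; exact hR x hx⟩

/-- A measure with nonzero absolutely continuous part dominates a multiple of Lebesgue measure on
a set of positive measure, inside any interval carrying the measure. -/
lemma exists_smul_volume_restrict_le {μ : Measure ℝ} {A : ℝ} (hA : ∀ᵐ l ∂μ, |l| ≤ A)
    (hac : volume.withDensity (μ.rnDeriv volume) ≠ 0) :
    ∃ E : Set ℝ, MeasurableSet E ∧ E ⊆ Icc (-A) A ∧ volume E ≠ 0 ∧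
      ∃ δ : ℝ, 0 < δ ∧ ENNReal.ofReal δ • volume.restrict E ≤ μ := by
  set ρ := μ.rnDeriv volume with hρ
  have hρm : Measurable ρ := Measure.measurable_rnDeriv _ _
  have hle : volume.withDensity ρ ≤ μ := Measure.withDensity_rnDeriv_le _ _
  have hout : volume.withDensity ρ (Icc (-A) A)ᶜ = 0 := by
    refine le_antisymm ((hle _).trans ?_) (zero_le)
    have : ∀ᵐ l ∂μ, l ∈ Icc (-A) A := by
      filter_upwards [hA] with l hl using abs_le.1 hl
    exact this.le
  by_contra! hcon
  apply hac
  have hnull : ∀ n : ℕ, volume ({x | ENNReal.ofReal (1 / (n + 1)) ≤ ρ x} ∩ Icc (-A) A) = 0 := by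
    intro n
    by_contra hne
    refine hcon _ ((measurableSet_le measurable_const hρm).inter measurableSet_Icc)
      inter_subset_right hne (1 / (n + 1)) (by positivity) ?_
    refine le_trans ?_ hle
    rw [← withDensity_const, ← withDensity_indicator
      ((measurableSet_le measurable_const hρm).inter measurableSet_Icc)]
    refine withDensity_mono (Filter.Eventually.of_forall fun x => ?_)
    refine indicator_le (fun x hx => hx.1) x
  have hin : volume.withDensity ρ (Icc (-A) A) = 0 := by
    rw [withDensity_apply _ measurableSet_Icc, lintegral_eq_zero_iff hρm]
    rw [Filter.EventuallyEq, ae_restrict_iff' measurableSet_Icc]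
    have : ∀ᵐ x, ∀ n : ℕ, x ∉ ({x | ENNReal.ofReal (1 / (n + 1)) ≤ ρ x} ∩ Icc (-A) A) :=
      ae_all_iff.2 fun n => measure_eq_zero_iff_ae_notMem.1 (hnull n)
    filter_upwards [this] with x hx hxA
    by_contra hne
    have hpos : 0 < ρ x := pos_iff_ne_zero.2 hne
    obtain ⟨n, hn⟩ := ENNReal.exists_inv_nat_lt hne
    apply hx n
    refine ⟨?_, hxA⟩
    simp only [mem_setOf_eq]
    refine le_trans ?_ hn.le
    rw [one_div, ENNReal.ofReal_inv_of_pos (by positivity)]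
    apply ENNReal.inv_le_inv.2
    rw [show ((n:ℝ) + 1) = ((n + 1 : ℕ) : ℝ) by push_cast; ring, ENNReal.ofReal_natCast]
    exact_mod_cast Nat.le_succ n
  rw [← Measure.measure_univ_eq_zero, ← union_compl_self (Icc (-A) A)]
  exact measure_union_null hin hout

lemma intervalIntegrable_log_abs_sin (a b : ℝ) :
    IntervalIntegrable (fun x => Real.log |Real.sin x|) volume a b := by
  have : MeromorphicOn Real.sin (uIcc a b) :=
    (Real.analyticOnNhd_sin (s := univ)).meromorphicOn.mono_set (subset_univ _)
  exact intervalIntegrable_log_norm_meromorphicOn this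

lemma integral_log_abs_sin_period (a : ℝ) (n : ℕ) :
    ∫ x in a..(a + n * Real.pi), Real.log |Real.sin x| = -(n * (Real.log 2 * Real.pi)) := by
  have hper : Function.Periodic (fun x => Real.log |Real.sin x|) Real.pi := by
    intro x; simp [Real.sin_add_pi]
  have h1 := hper.intervalIntegral_add_zsmul_eq n a
  simp only [natCast_zsmul, nsmul_eq_mul, zsmul_eq_mul, Int.cast_natCast] at h1
  rw [h1 intervalIntegrable_log_abs_sin, hper.intervalIntegral_add_eq a 0, zero_add,
   intervalIntegral.integral_congr (g := fun x => Real.log (Real.sin x)) (fun x _ => by simp [Real.log_abs]),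
     integral_log_sin_zero_pi]
  ring

lemma abs_sin_sub_arg_le (u : ℝ) (w : ℂ) :
    |Real.sin (u - w.arg)| ≤ ‖Complex.exp (u * Complex.I) - w‖ := by
  have h1 : ‖Complex.exp (u * Complex.I) - w‖
      = ‖(Complex.exp (u * Complex.I) - w) * Complex.exp ((-w.arg : ℝ) * Complex.I)‖ := by
    rw [norm_mul, Complex.norm_exp_ofReal_mul_I, mul_one]
  have h2 : (Complex.exp (u * Complex.I) - w) * Complex.exp ((-w.arg : ℝ) * Complex.I)
      = Complex.exp ((u - w.arg : ℝ) * Complex.I) - (‖w‖ : ℂ) := by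
    conv_lhs => rw [← Complex.norm_mul_exp_arg_mul_I w]
    rw [sub_mul, ← Complex.exp_add, mul_assoc, ← Complex.exp_add]
    simp only [Complex.norm_mul_exp_arg_mul_I]
    congr 1
    · congr 1; push_cast; ring
    · push_cast; ring_nf; simp
  rw [h1, h2]
  refine le_trans (le_of_eq ?_) (Complex.abs_im_le_norm _)
  rw [Complex.sub_im, Complex.exp_ofReal_mul_I_im]; simp

lemma integrableOn_log_norm_exp_sub {A : ℝ} (L : ℝ) (w : ℂ) {E : Set ℝ} (hE : E ⊆ Icc (-A) A) :
    IntegrableOn (fun x : ℝ => Real.log ‖Complex.exp ((L * x : ℝ) * Complex.I) - w‖) E := by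
  have h : MeromorphicOn (fun x : ℝ => Complex.exp ((L * x : ℝ) * Complex.I) - w)
      (uIcc (-A) A) := by
    intro x _
    apply AnalyticAt.meromorphicAt
    have h2 : AnalyticAt ℝ (fun z : ℂ => Complex.exp (L * z * Complex.I) - w) (Complex.ofRealCLM x) := by
      apply AnalyticAt.restrictScalars (𝕜' := ℂ)
      fun_prop
    simpa [Function.comp_def] using h2.comp (Complex.ofRealCLM.analyticAt x)
  have h3 := intervalIntegrable_log_norm_meromorphicOn h
  by_cases hA : -A ≤ A
  · rw [intervalIntegrable_iff_integrableOn_Icc_of_le hA] at h3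
    exact h3.mono_set hE
  · rw [Icc_eq_empty hA, subset_empty_iff] at hE
    simp [hE]

lemma le_setIntegral_log_norm_exp_sub {A L : ℝ} (hA : 0 < A) (hL : 1 ≤ L) (w : ℂ) {E : Set ℝ}
    (hEm : MeasurableSet E) (hE : E ⊆ Icc (-A) A) :
    -((2 * A + Real.pi) * Real.log 2) ≤
      ∫ x in E, Real.log ‖Complex.exp ((L * x : ℝ) * Complex.I) - w‖ := by
  set s : ℝ → ℝ := fun x => Real.log |Real.sin (L * x - w.arg)| with hs
  have hL0 : 0 < L := by linarith
  have hπ := Real.pi_pos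
  have hs0 : ∀ x, s x ≤ 0 := fun x =>
    Real.log_nonpos (abs_nonneg _) (Real.abs_sin_le_one _)
  have hsint : IntegrableOn s (Icc (-A) A) := by
    rw [← intervalIntegrable_iff_integrableOn_Icc_of_le (by linarith)]
    have := (intervalIntegrable_log_abs_sin (L * (-A) - w.arg) (L * A - w.arg))
    have h2 := (this.comp_sub_right (w.arg))
    have h3 := h2.comp_mul_left (c := L)
    simp only [sub_add_cancel] at h3
    rwa [mul_div_cancel_left₀ _ hL0.ne', mul_div_cancel_left₀ _ hL0.ne'] at h3
  have hsin0 : ∀ᵐ x : ℝ, Real.sin (L * x - w.arg) ≠ 0 := by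
    have hcount : {x : ℝ | Real.sin (L * x - w.arg) = 0}.Countable := by
      have : {x : ℝ | Real.sin (L * x - w.arg) = 0} ⊆
          range (fun n : ℤ => (n * Real.pi + w.arg) / L) := by
        intro x hx
        obtain ⟨n, hn⟩ := Real.sin_eq_zero_iff.1 hx
        exact ⟨n, by simp only; rw [hn]; field_simp; ring⟩
      exact (countable_range _).mono this
    exact measure_eq_zero_iff_ae_notMem.1 (hcount.measure_zero volume)
  have key : ∫ x in E, s x ≤ ∫ x in E, Real.log ‖Complex.exp ((L * x : ℝ) * Complex.I) - w‖ := by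
    refine integral_mono_ae (hsint.mono_set hE) (integrableOn_log_norm_exp_sub L w hE)
      (ae_restrict_of_ae ?_)
    filter_upwards [hsin0] with x hx
    exact Real.log_le_log (abs_pos.2 hx) (abs_sin_sub_arg_le _ _)
  refine le_trans ?_ key
  have h1 : ∫ x in Icc (-A) A, s x ≤ ∫ x in E, s x := by
    have := setIntegral_mono_set (f := fun x => - s x) (s := E) (t := Icc (-A) A) (μ := volume)
      hsint.neg (Filter.Eventually.of_forall fun x => by simpa using hs0 x)
      (Filter.Eventually.of_forall hE)
    simp only [integral_neg] at this
    linarith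
  refine le_trans ?_ h1
  rw [integral_Icc_eq_integral_Ioc, ← intervalIntegral.integral_of_le (by linarith)]
  have h2 : ∫ x in (-A)..A, s x = L⁻¹ * ∫ x in (L * (-A) - w.arg)..(L * A - w.arg), Real.log |Real.sin x| := by
    rw [hs, intervalIntegral.integral_comp_mul_sub (fun x => Real.log |Real.sin x|) hL0.ne']
    simp
  rw [h2]
  set n := ⌈2 * L * A / Real.pi⌉₊ with hn
  have hn1 : 2 * L * A ≤ n * Real.pi := by
    rw [← div_le_iff₀ hπ]; exact Nat.le_ceil _
  have hn2 : n * Real.pi ≤ 2 * L * A + Real.pi := by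
    have := (Nat.ceil_lt_add_one (a := 2 * L * A / Real.pi) (by positivity)).le
    rw [← hn] at this
    calc n * Real.pi ≤ (2 * L * A / Real.pi + 1) * Real.pi := by gcongr
      _ = _ := by field_simp
  set a := L * (-A) - w.arg
  have h3 : ∫ x in a..(a + n * Real.pi), Real.log |Real.sin x| ≤
      ∫ x in a..(L * A - w.arg), Real.log |Real.sin x| := by
    rw [← intervalIntegral.integral_add_adjacent_intervals
      (intervalIntegrable_log_abs_sin a (L * A - w.arg)) (intervalIntegrable_log_abs_sin _ _)]
    have : ∫ x in (L * A - w.arg)..(a + n * Real.pi), Real.log |Real.sin x| ≤ 0 := by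
      rw [intervalIntegral.integral_of_le (by simp only [a]; linarith)]
      exact integral_nonpos fun x => Real.log_nonpos (abs_nonneg _) (Real.abs_sin_le_one _)
    linarith
  rw [integral_log_abs_sin_period] at h3
  have hlog := Real.log_pos (one_lt_two)
  have h4 : (n : ℝ) * (Real.log 2 * Real.pi) ≤ (2 * L * A + Real.pi) * Real.log 2 := by
    nlinarith
  have h5 : L⁻¹ * (-((2 * L * A + Real.pi) * Real.log 2)) ≤
      L⁻¹ * ∫ x in a..(L * A - w.arg), Real.log |Real.sin x| := by
    gcongr; linarith
  refine le_trans ?_ h5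
  have h6 : L⁻¹ * (-((2 * L * A + Real.pi) * Real.log 2)) =
    -((2 * A + L⁻¹ * Real.pi) * Real.log 2) := by field_simp
  rw [h6]
  have h7 : L⁻¹ ≤ 1 := inv_le_one_of_one_le₀ hL
  nlinarith [mul_nonneg (mul_nonneg hπ.le hlog.le) (sub_nonneg.2 h7)]

lemma ofReal_exp_average_le {α : Type*} [MeasurableSpace α] {ν : Measure α} [IsFiniteMeasure ν]
    {g : α → ℝ} (hg : Integrable g ν) (h0 : ν ≠ 0) :
    ENNReal.ofReal (Real.exp ((∫ x, g x ∂ν) / ν.real univ) * ν.real univ) ≤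
      ∫⁻ x, ENNReal.ofReal (Real.exp (g x)) ∂ν := by
  by_cases hfin : ∫⁻ x, ENNReal.ofReal (Real.exp (g x)) ∂ν = ⊤
  · rw [hfin]; exact le_top
  have hint : Integrable (fun x => Real.exp (g x)) ν := by
    refine ⟨Real.continuous_exp.comp_aestronglyMeasurable hg.1, ?_⟩
    rw [hasFiniteIntegral_iff_ofReal (Filter.Eventually.of_forall fun x => (Real.exp_pos _).le)]
    exact lt_top_iff_ne_top.2 hfin
  rw [← ofReal_integral_eq_lintegral_ofReal hint
    (Filter.Eventually.of_forall fun x => (Real.exp_pos _).le)]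
  apply ENNReal.ofReal_le_ofReal
  have hV : 0 < ν.real univ := by
    rw [measureReal_def, ENNReal.toReal_pos_iff]
    exact ⟨pos_iff_ne_zero.2 (by simpa using h0), measure_lt_top _ _⟩
  set a := (∫ x, g x ∂ν) / ν.real univ with ha
  have h1 : ∀ x, Real.exp a * (1 + (g x - a)) ≤ Real.exp (g x) := by
    intro x
    calc Real.exp a * (1 + (g x - a)) ≤ Real.exp a * Real.exp (g x - a) := by
          gcongr; linarith [Real.add_one_le_exp (g x - a)]
      _ = _ := by rw [← Real.exp_add]; ring_nf
  have h2 := integral_mono (μ := ν)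
    (((integrable_const 1).add (hg.sub (integrable_const a))).const_mul (Real.exp a)) hint h1
  refine le_trans (le_of_eq ?_) h2
  rw [integral_const_mul, integral_add' (integrable_const _) (hg.sub (integrable_const a)),
    integral_sub' hg (integrable_const _)]
  simp only [integral_const, smul_eq_mul, mul_one]
  rw [ha]; field_simp; ring

lemma ae_exp_mul_I_ne {L : ℝ} (hL : L ≠ 0) (w : ℂ) :
    ∀ᵐ x : ℝ, Complex.exp ((L * x : ℝ) * Complex.I) ≠ w := by
  have hcount : {x : ℝ | Complex.exp ((L * x : ℝ) * Complex.I) = w}.Countable := by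
    rcases eq_empty_or_nonempty {x : ℝ | Complex.exp ((L * x : ℝ) * Complex.I) = w} with h | ⟨y, hy⟩
    · rw [h]; exact countable_empty
    have : {x : ℝ | Complex.exp ((L * x : ℝ) * Complex.I) = w} ⊆
        range (fun n : ℤ => (L * y + n * (2 * Real.pi)) / L) := by
      intro x hx
      have h1 : Complex.exp ((L * x : ℝ) * Complex.I) = Complex.exp ((L * y : ℝ) * Complex.I) :=
        (show _ = w from hx).trans (show _ = w from hy).symm
      obtain ⟨n, hn⟩ := Complex.exp_eq_exp_iff_exists_int.1 h1
      refine ⟨n, ?_⟩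
      have h2 : ((L * x : ℝ) : ℂ) = ((L * y + n * (2 * Real.pi) : ℝ) : ℂ) := by
        apply mul_right_cancel₀ Complex.I_ne_zero
        rw [hn]; push_cast; ring
      simp only
      rw [← Complex.ofReal_injective h2]; field_simp
    exact (countable_range _).mono this
  exact measure_eq_zero_iff_ae_notMem.1 (hcount.measure_zero volume)

lemma multiset_sum_log_norm_exp_sub {A L : ℝ} (hA : 0 < A) (hL : 1 ≤ L) {E : Set ℝ}
    (hEm : MeasurableSet E) (hE : E ⊆ Icc (-A) A) (s : Multiset ℂ) :
    IntegrableOn (fun x : ℝ =>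
        (s.map fun w => Real.log ‖Complex.exp ((L * x : ℝ) * Complex.I) - w‖).sum) E ∧
    -(s.card * ((2 * A + Real.pi) * Real.log 2)) ≤ ∫ x in E,
        (s.map fun w => Real.log ‖Complex.exp ((L * x : ℝ) * Complex.I) - w‖).sum ∧
    ∀ᵐ x : ℝ, Real.exp
        (s.map fun w => Real.log ‖Complex.exp ((L * x : ℝ) * Complex.I) - w‖).sum =
      ‖(s.map fun w => Complex.exp ((L * x : ℝ) * Complex.I) - w).prod‖ := by
  induction s using Multiset.induction_on with
  | empty => simp
  | cons w s ih =>
    obtain ⟨h1, h2, h3⟩ := ih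
    have h4 := integrableOn_log_norm_exp_sub L w hE
    have h5 := le_setIntegral_log_norm_exp_sub hA hL w hEm hE
    simp only [Multiset.map_cons, Multiset.sum_cons, Multiset.prod_cons, Multiset.card_cons]
    refine ⟨h4.add h1, ?_, ?_⟩
    · rw [integral_add h4 h1, Nat.cast_add, Nat.cast_one, add_mul]; linarith
    · filter_upwards [h3, ae_exp_mul_I_ne (L := L) (by linarith) w] with x hx hxw
      rw [Real.exp_add, hx, Real.exp_log (norm_pos_iff.2 (sub_ne_zero.2 hxw)), norm_mul]

/-- Trigonometric polynomials with leading coefficient one are at worst exponentially small in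
`L²(μ)`, uniformly in the frequency step. -/
lemma exists_exp_le_integral_norm_eval_sq {μ : Measure ℝ} [IsProbabilityMeasure μ] {A : ℝ}
    (hA0 : 0 < A) {E : Set ℝ} (hEm : MeasurableSet E) (hE : E ⊆ Icc (-A) A) (hE0 : volume E ≠ 0)
    {δ : ℝ} (hδ : 0 < δ) (hδμ : ENNReal.ofReal δ • volume.restrict E ≤ μ) :
    ∃ κ : ℝ, 0 < κ ∧ ∀ L : ℝ, 1 ≤ L → ∀ p : Polynomial ℂ, p.Monic →
      Real.exp (-(κ * (p.natDegree + 1))) ≤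
        ∫ x, ‖p.eval (Complex.exp ((L * x : ℝ) * Complex.I))‖ ^ 2 ∂μ := by
  have hEfin : volume E ≠ ⊤ := ((measure_mono hE).trans_lt (by simp)).ne
  set v := volume.real E with hv
  have hv0 : 0 < v := ENNReal.toReal_pos hE0 hEfin
  set C := (2 * A + Real.pi) * Real.log 2 with hC
  have hC0 : 0 < C := by have := Real.log_pos one_lt_two; positivity
  refine ⟨2 * C / v + |Real.log (δ * v)|, by positivity, fun L hL p hp => ?_⟩
  have hcont : Continuous fun x : ℝ => ‖p.eval (Complex.exp ((L * x : ℝ) * Complex.I))‖ ^ 2 := by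
    have := p.continuous
    fun_prop
  have hbd : ∃ K, ∀ x : ℝ, ‖p.eval (Complex.exp ((L * x : ℝ) * Complex.I))‖ ^ 2 ≤ K := by
    obtain ⟨K, hK⟩ := (isCompact_sphere (0 : ℂ) 1).exists_bound_of_continuousOn
      (f := fun z => p.eval z) p.continuous.continuousOn
    refine ⟨K ^ 2, fun x => ?_⟩
    have := hK (Complex.exp ((L * x : ℝ) * Complex.I))
      (by rw [mem_sphere_zero_iff_norm, Complex.norm_exp_ofReal_mul_I])
    gcongr
  obtain ⟨K, hK⟩ := hbd
  have hint : Integrable (fun x : ℝ => ‖p.eval (Complex.exp ((L * x : ℝ) * Complex.I))‖ ^ 2) μ :=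
    (integrable_const K).mono' hcont.aestronglyMeasurable
      (Filter.Eventually.of_forall fun x => by
        rw [Real.norm_of_nonneg (by positivity)]; exact hK x)
  obtain ⟨h1, h2, h3⟩ := multiset_sum_log_norm_exp_sub hA0 hL hEm hE p.roots
  have hprod : ∀ z : ℂ, p.eval z = (p.roots.map fun w => z - w).prod := fun z => by
    exact (IsAlgClosed.splits p).eval_eq_prod_roots_of_monic hp z
  have hcard : p.roots.card = p.natDegree := (IsAlgClosed.splits p).natDegree_eq_card_roots.symm
  rw [hcard] at h2
  haveI : IsFiniteMeasure (volume.restrict E) := ⟨by simpa using hEfin.lt_top⟩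
  have hJ := ofReal_exp_average_le (h1.const_mul 2) (by simpa using hE0)
  have hreal : (volume.restrict E).real univ = v := by simp [measureReal_def, hv]
  rw [hreal, integral_const_mul] at hJ
  have hle : ENNReal.ofReal δ * ∫⁻ x in E,
        ENNReal.ofReal (‖p.eval (Complex.exp ((L * x : ℝ) * Complex.I))‖ ^ 2) ≤
      ∫⁻ x, ENNReal.ofReal (‖p.eval (Complex.exp ((L * x : ℝ) * Complex.I))‖ ^ 2) ∂μ := by
    rw [← smul_eq_mul, ← lintegral_smul_measure]
    exact lintegral_mono' hδμ le_rfl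
  have heq : ∫⁻ x in E, ENNReal.ofReal (Real.exp (2 * (p.roots.map fun w =>
        Real.log ‖Complex.exp ((L * x : ℝ) * Complex.I) - w‖).sum)) =
      ∫⁻ x in E, ENNReal.ofReal (‖p.eval (Complex.exp ((L * x : ℝ) * Complex.I))‖ ^ 2) := by
    refine lintegral_congr_ae (ae_restrict_of_ae ?_)
    filter_upwards [h3] with x hx
    rw [hprod, ← hx, ← Real.exp_nat_mul]; norm_num
  rw [heq] at hJ
  have h6 := (mul_le_mul_right hJ (ENNReal.ofReal δ)).trans hle
  rw [← ofReal_integral_eq_lintegral_ofReal hint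
    (Filter.Eventually.of_forall fun x => by positivity), ← ENNReal.ofReal_mul hδ.le,
    ENNReal.ofReal_le_ofReal_iff (integral_nonneg fun x => by positivity)] at h6
  refine le_trans ?_ h6
  have h7 : δ * (Real.exp (2 * (∫ x in E, (p.roots.map fun w =>
        Real.log ‖Complex.exp ((L * x : ℝ) * Complex.I) - w‖).sum) / v) * v) =
      Real.exp (2 * (∫ x in E, (p.roots.map fun w =>
        Real.log ‖Complex.exp ((L * x : ℝ) * Complex.I) - w‖).sum) / v + Real.log (δ * v)) := by
    rw [Real.exp_add, Real.exp_log (by positivity)]; ring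
  rw [h7]
  apply Real.exp_le_exp.2
  have h8 : -(2 * C / v * p.natDegree) ≤ 2 * (∫ x in E, (p.roots.map fun w =>
        Real.log ‖Complex.exp ((L * x : ℝ) * Complex.I) - w‖).sum) / v := by
    rw [le_div_iff₀ hv0]
    have : -(2 * C / v * p.natDegree) * v = 2 * -(p.natDegree * C) := by field_simp
    rw [this]; linarith
  have h9 := neg_abs_le (Real.log (δ * v))
  have h10 : 0 ≤ |Real.log (δ * v)| * p.natDegree := by positivity
  have h11 : 0 ≤ 2 * C / v := by positivity
  nlinarith

/-- Jensen's inequality for finitely many distinct zeros of an entire function. -/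
lemma log_norm_add_sum_le_circleAverage {f : ℂ → ℂ} (hf : Differentiable ℂ f) {c : ℂ} {r : ℝ}
    (hr : 0 < r) (hc : f c ≠ 0) (S : Finset ℂ) (hS : ∀ z ∈ S, f z = 0 ∧ ‖c - z‖ ≤ r) :
    Real.log ‖f c‖ + ∑ z ∈ S, (Real.log r - Real.log ‖c - z‖) ≤
      Real.circleAverage (fun z => Real.log ‖f z‖) c r := by
  have han : AnalyticOnNhd ℂ f univ := fun z _ => hf.analyticAt z
  have hanB : AnalyticOnNhd ℂ f (Metric.closedBall c |r|) := han.mono (subset_univ _)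
  rw [hanB.circleAverage_log_norm hr.ne' hc, add_comm]
  gcongr
  set D := MeromorphicOn.divisor f (Metric.closedBall c |r|) with hD
  have hD0 : 0 ≤ D := MeromorphicOn.AnalyticOnNhd.divisor_nonneg hanB
  have hfin : (Function.support fun u => (D u : ℝ) * Real.log (r * ‖c - u‖⁻¹)).Finite := by
    refine (D.finiteSupport (isCompact_closedBall c |r|)).subset fun u hu => ?_
    simp only [Function.mem_support] at hu ⊢
    intro h; simp [h] at hu
  have hin : ∀ u, u ∉ Metric.closedBall c |r| → D u = 0 := fun u hu =>
    D.apply_eq_zero_of_notMem hu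
  have hlog : ∀ u, u ∈ Metric.closedBall c |r| → 0 ≤ Real.log (r * ‖c - u‖⁻¹) := by
    intro u hu
    rw [mem_closedBall_iff_norm', abs_of_pos hr] at hu
    rcases eq_or_ne (‖c - u‖) 0 with h | h
    · simp [h]
    · apply Real.log_nonneg
      rw [← div_eq_mul_inv, one_le_div (lt_of_le_of_ne (norm_nonneg _) h.symm)]
      exact hu
  have hterm : ∀ u, 0 ≤ (D u : ℝ) * Real.log (r * ‖c - u‖⁻¹) := by
    intro u
    by_cases hu : u ∈ Metric.closedBall c |r|
    · exact mul_nonneg (by exact_mod_cast hD0 u) (hlog u hu)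
    · simp [hin u hu]
  rw [finsum_eq_sum_of_support_subset (s := hfin.toFinset ∪ S) _
    (by intro u hu; simp only [Finset.coe_union, Finite.coe_toFinset]; exact Or.inl hu)]
  refine le_trans ?_ (Finset.sum_le_sum_of_subset_of_nonneg Finset.subset_union_right
    fun u _ _ => hterm u)
  refine Finset.sum_le_sum fun z hz => ?_
  obtain ⟨hz0, hzr⟩ := hS z hz
  have hzB : z ∈ Metric.closedBall c |r| := by
    rw [mem_closedBall_iff_norm', abs_of_pos hr]; exact hzr
  have hcz : ‖c - z‖ ≠ 0 := by
    rw [norm_ne_zero_iff, sub_ne_zero]; rintro rfl; exact hc hz0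
  have h1 : (1 : ℤ) ≤ D z := by
    have hne : analyticOrderAt f z ≠ 0 := ((hf.analyticAt z).analyticOrderAt_ne_zero).2 hz0
    have hnt : analyticOrderAt f z ≠ ⊤ := by
      refine han.analyticOrderAt_ne_top_of_isPreconnected isPreconnected_univ
        (mem_univ c) (mem_univ z) ?_
      rw [(hf.analyticAt c).analyticOrderAt_eq_zero.2 hc]; simp
    rw [hD, MeromorphicOn.AnalyticOnNhd.divisor_apply hanB hzB]
    obtain ⟨n, hn⟩ := ENat.ne_top_iff_exists.1 hnt
    rw [← hn] at hne ⊢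
    have : n ≠ 0 := by rintro rfl; simp at hne
    simp; omega
  have h2 := hlog z hzB
  have h3 : Real.log (r * ‖c - z‖⁻¹) = Real.log r - Real.log ‖c - z‖ := by
    rw [Real.log_mul hr.ne' (inv_ne_zero hcz), Real.log_inv]; ring
  rw [← h3]
  have h4 : (1 : ℝ) ≤ D z := by exact_mod_cast h1
  nlinarith

lemma integral_abs_sin_zero_two_pi : ∫ θ in (0 : ℝ)..(2 * Real.pi), |Real.sin θ| = 4 := by
  have hc : ∀ a b : ℝ, IntervalIntegrable (fun θ => |Real.sin θ|) volume a b := fun a b =>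
    (Real.continuous_sin.abs).intervalIntegrable a b
  rw [← intervalIntegral.integral_add_adjacent_intervals (hc 0 Real.pi) (hc Real.pi _)]
  have h1 : ∫ θ in (0 : ℝ)..Real.pi, |Real.sin θ| = 2 := by
    rw [intervalIntegral.integral_congr (g := Real.sin) (fun x hx => ?_)]
    · rw [integral_sin]; norm_num
    · rw [uIcc_of_le Real.pi_pos.le] at hx
      exact abs_of_nonneg (Real.sin_nonneg_of_mem_Icc hx)
  have h2 : ∫ θ in Real.pi..(2 * Real.pi), |Real.sin θ| = 2 := by
    have := intervalIntegral.integral_comp_add_right (a := 0) (b := Real.pi)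
      (fun θ => |Real.sin θ|) Real.pi
    simp only [Real.sin_add_pi, abs_neg] at this
    rw [h1] at this
    rw [zero_add, ← two_mul] at this
    exact this.symm
  rw [h1, h2]; norm_num

lemma circleAverage_log_norm_le {f : ℂ → ℂ} (hf : Differentiable ℂ f) {M B r x : ℝ}
    (hM : 1 ≤ M) (hB : 0 ≤ B) (hr : 0 < r)
    (hbd : ∀ z : ℂ, |z.re - x| ≤ r → |z.im| ≤ r → ‖f z‖ ≤ M * Real.exp (B * |z.im|)) :
    Real.circleAverage (fun z => Real.log ‖f z‖) x r ≤ Real.log M + 2 * B * r / Real.pi := by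
  have hint : CircleIntegrable (fun z => Real.log ‖f z‖) x r :=
    MeromorphicOn.circleIntegrable_log_norm fun z _ => (hf.analyticAt z).meromorphicAt
  have hint2 : CircleIntegrable (fun z : ℂ => Real.log M + B * |z.im|) x r := by
    apply ContinuousOn.circleIntegrable hr.le
    have := Complex.continuous_im
    fun_prop
  refine (Real.circleAverage_mono hint hint2 ?_).trans (le_of_eq ?_)
  · intro z hz
    rw [mem_sphere_iff_norm, abs_of_pos hr] at hz
    have h1 := Complex.abs_re_le_norm (z - x)
    have h2 := Complex.abs_im_le_norm (z - x)
    simp only [Complex.sub_re, Complex.ofReal_re, Complex.sub_im, Complex.ofReal_im, sub_zero, hz]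
      at h1 h2
    have h3 := hbd z h1 h2
    have hle : Real.log M + B * |z.im| = Real.log (M * Real.exp (B * |z.im|)) := by
      rw [Real.log_mul (by linarith) (Real.exp_pos _).ne', Real.log_exp]
    show Real.log ‖f z‖ ≤ Real.log M + B * |z.im|
    rcases eq_or_ne (f z) 0 with h0 | h0
    · rw [h0, norm_zero, Real.log_zero]
      have := Real.log_nonneg hM
      positivity
    · rw [hle]; exact Real.log_le_log (norm_pos_iff.2 h0) h3
  · rw [Real.circleAverage]
    have : ∀ θ : ℝ, Real.log M + B * |(circleMap x r θ).im| =
        Real.log M + B * r * |Real.sin θ| := by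
      intro θ
      simp only [circleMap, Complex.add_im, Complex.ofReal_im, zero_add, Complex.re_ofReal_mul,
        Complex.im_ofReal_mul, Complex.exp_ofReal_mul_I_im]
      rw [abs_mul, abs_of_pos hr]; ring
    simp only [this]
    rw [intervalIntegral.integral_add intervalIntegrable_const
      (Continuous.intervalIntegrable (by fun_prop) _ _),
      intervalIntegral.integral_const_mul, integral_abs_sin_zero_two_pi]
    simp
    have := Real.pi_pos
    field_simp; ring

lemma integral_log_sub_log_abs_sub (r z : ℝ) :
    IntervalIntegrable (fun x => Real.log r - Real.log |x - z|) volume (z - r) (z + r) ∧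
    ∫ x in (z - r)..(z + r), (Real.log r - Real.log |x - z|) = 2 * r := by
  have h0 : IntervalIntegrable (fun x => Real.log r - Real.log x) volume (-r) r :=
    intervalIntegrable_const.sub intervalIntegral.intervalIntegrable_log'
  simp only [Real.log_abs]
  constructor
  · have := h0.comp_sub_right z
    rwa [neg_add_eq_sub, add_comm r z] at this
  · rw [intervalIntegral.integral_comp_sub_right (fun x => Real.log r - Real.log x) z,
      intervalIntegral.integral_sub intervalIntegrable_const
        intervalIntegral.intervalIntegrable_log', integral_log]
    simp
    ring

/-- The integrated form of Jensen's inequality on a horizontal strip: real zeros force the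
logarithm of a function of exponential type to have a small integral over the real line. -/
lemma integral_log_abs_le {f : ℂ → ℂ} (hf : Differentiable ℂ f) {F : ℝ → ℝ}
    (hfF : ∀ x : ℝ, f x = F x) {x₀ : ℝ} (hx₀ : F x₀ ≠ 0) {M B r T : ℝ} (hM : 1 ≤ M) (hB : 0 ≤ B)
    (hr : 0 < r) (hT : 0 ≤ T)
    (hbd : ∀ z : ℂ, -(2 * r) ≤ z.re → z.re ≤ T + 2 * r → |z.im| ≤ r →
      ‖f z‖ ≤ M * Real.exp (B * |z.im|))
    (S : Finset ℝ) (hS : ∀ z ∈ S, z ∈ Icc 0 T ∧ F z = 0) :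
    IntervalIntegrable (fun x => Real.log |F x|) volume (-r) (T + r) ∧
    ∫ x in (-r)..(T + r), Real.log |F x| ≤
      (T + 2 * r) * (Real.log M + 2 * B * r / Real.pi) - 2 * r * S.card := by
  have hanR : AnalyticOnNhd ℝ (fun x : ℝ => f x) univ := fun x _ => by
    have h2 : AnalyticAt ℝ f (Complex.ofRealCLM x) := (hf.analyticAt _).restrictScalars
    simpa [Function.comp_def] using h2.comp (Complex.ofRealCLM.analyticAt x)
  have hnorm : ∀ x : ℝ, Real.log ‖f x‖ = Real.log |F x| := fun x => by
    rw [hfF, Complex.norm_real, Real.norm_eq_abs]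
  have hint : IntervalIntegrable (fun x => Real.log |F x|) volume (-r) (T + r) := by
    have := intervalIntegrable_log_norm_meromorphicOn (f := fun x : ℝ => f x) (a := -r)
      (b := T + r) (hanR.meromorphicOn.mono_set (subset_univ _))
    simpa only [hnorm] using this
  refine ⟨hint, ?_⟩
  have hle : -r ≤ T + r := by linarith
  have hae : ∀ᵐ x : ℝ, F x ≠ 0 := by
    have h1 := hanR.preimage_zero_mem_codiscrete (x := x₀) (by simpa [hfF] using hx₀)
    have h2 := ae_restrict_le_codiscreteWithin (U := (univ : Set ℝ)) (μ := volume)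
      MeasurableSet.univ h1
    rw [Measure.restrict_univ] at h2
    filter_upwards [h2] with x hx
    simpa [hfF] using hx
  set G : ℝ → ℝ → ℝ := fun z => (Icc (z - r) (z + r)).indicator
    (fun x => Real.log r - Real.log |x - z|) with hG
  have hGint : ∀ z ∈ S, IntervalIntegrable (G z) volume (-r) (T + r) ∧
      ∫ x in (-r)..(T + r), G z x = 2 * r := by
    intro z hz
    have hz' := (hS z hz).1
    obtain ⟨h1, h2⟩ := integral_log_sub_log_abs_sub r z
    have hsub : Icc (z - r) (z + r) ⊆ Icc (-r) (T + r) :=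
      Icc_subset_Icc (by linarith [hz'.1]) (by linarith [hz'.2])
    constructor
    · rw [intervalIntegrable_iff_integrableOn_Icc_of_le hle]
      rw [intervalIntegrable_iff_integrableOn_Icc_of_le (by linarith)] at h1
      exact ((integrable_indicator_iff measurableSet_Icc).2 h1).integrableOn
    · rw [intervalIntegral.integral_of_le hle, ← integral_Icc_eq_integral_Ioc,
        setIntegral_indicator measurableSet_Icc, inter_eq_right.2 hsub,
        integral_Icc_eq_integral_Ioc, ← intervalIntegral.integral_of_le (by linarith), h2]
  set K := Real.log M + 2 * B * r / Real.pi with hK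
  have hpt : ∀ x ∈ Icc (-r) (T + r), F x ≠ 0 → Real.log |F x| + ∑ z ∈ S, G z x ≤ K := by
    intro x hx hFx
    have h1 := circleAverage_log_norm_le (x := x) hf hM hB hr (fun z h1 h2 => by
      rw [abs_le] at h1
      exact hbd z (by linarith [hx.1]) (by linarith [hx.2]) h2)
    refine le_trans ?_ h1
    have h2 := log_norm_add_sum_le_circleAverage hf (c := (x : ℂ)) hr (by simpa [hfF] using hFx)
      ((S.filter fun z => |x - z| ≤ r).image (fun z : ℝ => (z : ℂ))) (by
        intro w hw
        obtain ⟨z, hz, rfl⟩ := Finset.mem_image.1 hw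
        rw [Finset.mem_filter] at hz
        refine ⟨by rw [hfF, (hS z hz.1).2]; simp, ?_⟩
        rw [← Complex.ofReal_sub, Complex.norm_real]; exact hz.2)
    refine le_trans (le_of_eq ?_) h2
    rw [hnorm, Finset.sum_image (by simp), Finset.sum_filter]
    congr 1
    refine Finset.sum_congr rfl fun z _ => ?_
    have : x ∈ Icc (z - r) (z + r) ↔ |x - z| ≤ r := by
      rw [abs_le, mem_Icc]; constructor <;> rintro ⟨_, _⟩ <;> constructor <;> linarith
    rw [hG, ← Complex.ofReal_sub, Complex.norm_real, Real.norm_eq_abs]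
    simp only [indicator, this]
  have hsumint : IntervalIntegrable (fun x => ∑ z ∈ S, G z x) volume (-r) (T + r) := by
    have := IntervalIntegrable.sum S (f := G) (fun z hz => (hGint z hz).1)
    simpa [Finset.sum_fn] using this
  have hmain : ∫ x in (-r)..(T + r), (Real.log |F x| + ∑ z ∈ S, G z x) ≤
      ∫ x in (-r)..(T + r), K := by
    refine intervalIntegral.integral_mono_ae_restrict hle (hint.add hsumint) intervalIntegrable_const ?_
    filter_upwards [ae_restrict_mem measurableSet_Icc, ae_restrict_of_ae hae] with x hx hFx
    exact hpt x hx hFx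
  rw [intervalIntegral.integral_add hint hsumint, intervalIntegral.integral_finset_sum
    (fun z hz => (hGint z hz).1), Finset.sum_congr rfl (fun z hz => (hGint z hz).2)] at hmain
  simp only [Finset.sum_const, nsmul_eq_mul, intervalIntegral.integral_const, smul_eq_mul] at hmain
  linarith

/-- The trigonometric polynomial `∑ c(t) e^{iλt}` of a finitely supported coefficient function. -/
noncomputable def trigSum (c : ℝ →₀ ℝ) (l : ℝ) : ℂ :=
  Finsupp.linearCombination ℝ (fun t : ℝ => Complex.exp ((l * t : ℝ) * Complex.I)) c

/-- The linear combination `∑ c(t) F_t` of the values of a process. -/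
noncomputable def linComb {Ω : Type*} (F : ℝ → Ω → ℝ) (c : ℝ →₀ ℝ) (ω : Ω) : ℝ :=
  Finsupp.linearCombination ℝ (fun t : ℝ => F t ω) c

/-- A stationary Gaussian process whose values are measurable, with the laws of its linear
combinations expressed through the spectral measure. -/
structure IsSpectralGP {Ω : Type*} [MeasurableSpace Ω] (P : Measure Ω) (μ : Measure ℝ)
    (F : ℝ → Ω → ℝ) : Prop where
  cont : ∀ ω, Continuous fun t => F t ω
  meas : ∀ t, Measurable (F t)
  law : ∀ c : ℝ →₀ ℝ, P.map (linComb F c) = gaussianReal 0 (∫ l, ‖trigSum c l‖ ^ 2 ∂μ).toNNReal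

lemma normSq_sum_exp {n : ℕ} (t c : Fin n → ℝ) (l : ℝ) :
    ‖∑ i, (c i : ℂ) * Complex.exp ((l * t i : ℝ) * Complex.I)‖ ^ 2 =
      ∑ i, ∑ j, c i * c j * Real.cos (l * (t i - t j)) := by
  rw [← Complex.normSq_eq_norm_sq]
  have : (Complex.normSq (∑ i, (c i : ℂ) * Complex.exp ((l * t i : ℝ) * Complex.I)) : ℂ) =
      ((∑ i, ∑ j, (c i * c j : ℂ) * Complex.exp ((l * (t i - t j) : ℝ) * Complex.I))) := by
    rw [← Complex.mul_conj, map_sum, Finset.sum_mul_sum]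
    refine Finset.sum_congr rfl fun i _ => Finset.sum_congr rfl fun j _ => ?_
    rw [map_mul, ← Complex.exp_conj, Complex.conj_ofReal, map_mul, Complex.conj_I,
      Complex.conj_ofReal, mul_mul_mul_comm, ← Complex.exp_add]
    congr 2
    push_cast; ring
  have h2 := congrArg Complex.re this
  rw [Complex.ofReal_re] at h2
  rw [h2, Complex.re_sum]
  refine Finset.sum_congr rfl fun i _ => ?_
  rw [Complex.re_sum]
  refine Finset.sum_congr rfl fun j _ => ?_
  rw [← Complex.ofReal_mul, Complex.re_ofReal_mul, Complex.exp_ofReal_mul_I_re]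

lemma sum_covKernel {μ : Measure ℝ} [IsFiniteMeasure μ] {n : ℕ} (t c : Fin n → ℝ) :
    ∑ i, ∑ j, c i * c j * covKernel μ (t i - t j) =
      ∫ l, ‖∑ i, (c i : ℂ) * Complex.exp ((l * t i : ℝ) * Complex.I)‖ ^ 2 ∂μ := by
  simp only [normSq_sum_exp]
  have hint : ∀ i j, Integrable (fun l => c i * c j * Real.cos (l * (t i - t j))) μ := by
    intro i j
    refine Integrable.const_mul ?_ _
    refine Integrable.of_bound (by fun_prop) 1 (Filter.Eventually.of_forall fun l => ?_)
    exact Real.abs_cos_le_one _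
  rw [integral_finset_sum _ fun i _ => integrable_finset_sum _ fun j _ => hint i j]
  refine Finset.sum_congr rfl fun i _ => ?_
  rw [integral_finset_sum _ fun j _ => hint i j]
  refine Finset.sum_congr rfl fun j _ => ?_
  rw [integral_const_mul, covKernel]

lemma IsSGP.map_linComb {Ω : Type*} [MeasurableSpace Ω] {P : Measure Ω} {μ : Measure ℝ}
    [IsFiniteMeasure μ] {F : ℝ → Ω → ℝ} (hF : IsSGP P μ F) (c : ℝ →₀ ℝ) :
    P.map (linComb F c) = gaussianReal 0 (∫ l, ‖trigSum c l‖ ^ 2 ∂μ).toNNReal := by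
  set e := c.support.equivFin with he
  have h := hF.2 c.support.card (fun i => e.symm i) (fun i => c (e.symm i))
  rw [sum_covKernel] at h
  have h1 : ∀ ω, ∑ i, c (e.symm i) * F (e.symm i) ω = linComb F c ω := by
    intro ω
    rw [linComb, Finsupp.linearCombination_apply, Finsupp.sum,
      ← Finset.sum_coe_sort c.support]
    exact Equiv.sum_comp e.symm fun t : c.support => c t * F t ω
  have h2 : ∀ l, ∑ i, (c (e.symm i) : ℂ) * Complex.exp ((l * (e.symm i : ℝ) : ℝ) * Complex.I) =
      trigSum c l := by
    intro l
    rw [trigSum, Finsupp.linearCombination_apply, Finsupp.sum,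
      ← Finset.sum_coe_sort c.support]
    simp only [Complex.real_smul]
    exact Equiv.sum_comp e.symm
      fun t : c.support => (c t : ℂ) * Complex.exp ((l * (t : ℝ) : ℝ) * Complex.I)
  simp only [h1, h2] at h
  exact h

lemma linComb_single {Ω : Type*} (F : ℝ → Ω → ℝ) (t : ℝ) (ω : Ω) :
    linComb F (Finsupp.single t 1) ω = F t ω := by
  simp [linComb]

/-- A continuous stationary Gaussian process has a version with measurable values and the same
sample paths almost surely. -/
lemma IsSGP.exists_isSpectralGP {Ω : Type*} [MeasurableSpace Ω] {P : Measure Ω}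
    {μ : Measure ℝ} [IsFiniteMeasure μ] {F : ℝ → Ω → ℝ} (hF : IsSGP P μ F) :
    ∃ F' : ℝ → Ω → ℝ, IsSpectralGP P μ F' ∧ ∀ᵐ ω ∂P, ∀ t, F' t ω = F t ω := by
  have hae : ∀ t, AEMeasurable (F t) P := by
    intro t
    have h := hF.map_linComb (Finsupp.single t 1)
    have h2 : linComb F (Finsupp.single t 1) = F t := funext fun ω => linComb_single F t ω
    rw [h2] at h
    apply AEMeasurable.of_map_ne_zero
    rw [h]
    exact IsProbabilityMeasure.ne_zero _
  have h1 : ∀ᵐ ω ∂P, ∀ q : ℚ, F q ω = (hae q).mk (F q) ω := ae_all_iff.2 fun q => (hae q).ae_eq_mk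
  obtain ⟨s, hs, hsm, hs0⟩ := exists_measurable_superset_of_null h1
  have hsub : ∀ ω, ω ∉ s → ∀ q : ℚ, F q ω = (hae q).mk (F q) ω := by
    intro ω hω
    by_contra hcon
    exact hω (hs hcon)
  classical
  set F' : ℝ → Ω → ℝ := fun t => sᶜ.indicator (F t) with hF'
  have hFF : ∀ᵐ ω ∂P, ∀ t, F' t ω = F t ω := by
    filter_upwards [measure_eq_zero_iff_ae_notMem.1 hs0] with ω hω t
    exact indicator_of_mem (s := sᶜ) hω _
  have hcont : ∀ ω, Continuous fun t => F' t ω := by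
    intro ω
    by_cases hω : ω ∈ s
    · have : (fun t => F' t ω) = fun _ => 0 := by ext t; simp [hF', hω]
      rw [this]; exact continuous_const
    · have : (fun t => F' t ω) = fun t => F t ω := by ext t; simp [hF', hω]
      rw [this]; exact hF.1 ω
  have hq : ∀ q : ℚ, Measurable (F' q) := by
    intro q
    have : F' q = sᶜ.indicator ((hae q).mk (F q)) := by
      ext ω
      by_cases hω : ω ∈ s
      · simp [hF', hω]
      · simp [hF', hω, hsub ω hω q]
    rw [this]
    exact (hae q).measurable_mk.indicator hsm.compl
  refine ⟨F', ⟨hcont, fun t => ?_, fun c => ?_⟩, hFF⟩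
  · obtain ⟨u, hu⟩ := mem_closure_iff_seq_limit.1 (Rat.denseRange_cast (𝕜 := ℝ) t)
    choose q hq' using hu.1
    refine measurable_of_tendsto_metrizable (f := fun n => F' (u n)) (fun n => ?_) ?_
    · rw [← hq' n]; exact hq _
    · rw [tendsto_pi_nhds]
      intro ω
      exact ((hcont ω).tendsto t).comp hu.2
  · rw [← hF.map_linComb c]
    apply Measure.map_congr
    filter_upwards [hFF] with ω hω
    simp only [linComb, hω]

section
variable {Ω : Type*} [MeasurableSpace Ω] {P : Measure Ω} {μ : Measure ℝ} {F : ℝ → Ω → ℝ}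

lemma IsSpectralGP.measurable_linComb (hF : IsSpectralGP P μ F) (c : ℝ →₀ ℝ) :
    Measurable (linComb F c) := by
  have : linComb F c = fun ω => ∑ t ∈ c.support, c t * F t ω := by
    ext ω; simp [linComb, Finsupp.linearCombination_apply, Finsupp.sum]
  rw [this]
  exact Finset.measurable_sum _ fun t _ => (hF.meas t).const_mul _

lemma IsSpectralGP.memLp (hF : IsSpectralGP P μ F) (c : ℝ →₀ ℝ) : MemLp (linComb F c) 2 P := by
  have h := memLp_id_gaussianReal (μ := 0) (v := (∫ l, ‖trigSum c l‖ ^ 2 ∂μ).toNNReal) 2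
  rw [← hF.law c] at h
  exact (memLp_map_measure_iff (by fun_prop) (hF.measurable_linComb c).aemeasurable).1 h

lemma IsSpectralGP.integral_eq_zero (hF : IsSpectralGP P μ F) (c : ℝ →₀ ℝ) :
    ∫ ω, linComb F c ω ∂P = 0 := by
  have h := integral_map (μ := P) (hF.measurable_linComb c).aemeasurable
    (f := fun x : ℝ => x) (by fun_prop)
  rw [← h, hF.law, integral_id_gaussianReal]

lemma IsSpectralGP.integral_sq (hF : IsSpectralGP P μ F) (c : ℝ →₀ ℝ) :
    ∫ ω, linComb F c ω ^ 2 ∂P = ∫ l, ‖trigSum c l‖ ^ 2 ∂μ := by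
  have h := integral_map (μ := P) (hF.measurable_linComb c).aemeasurable
    (f := fun x : ℝ => x ^ 2) (by fun_prop)
  rw [← h, hF.law]
  set v := (∫ l, ‖trigSum c l‖ ^ 2 ∂μ).toNNReal with hv
  have h2 := variance_of_integral_eq_zero (μ := gaussianReal 0 v) (X := fun x : ℝ => x)
    (by fun_prop) integral_id_gaussianReal
  rw [variance_fun_id_gaussianReal] at h2
  rw [← h2, hv, Real.coe_toNNReal]
  positivity

lemma linComb_add (F : ℝ → Ω → ℝ) (a b : ℝ →₀ ℝ) (ω : Ω) :
    linComb F (a + b) ω = linComb F a ω + linComb F b ω := by simp [linComb]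

lemma linComb_sub (F : ℝ → Ω → ℝ) (a b : ℝ →₀ ℝ) (ω : Ω) :
    linComb F (a - b) ω = linComb F a ω - linComb F b ω := by simp [linComb]

lemma linComb_sum_smul {ι : Type*} (s : Finset ι) (F : ℝ → Ω → ℝ) (x : ι → ℝ) (a : ι → ℝ →₀ ℝ)
    (ω : Ω) : linComb F (∑ i ∈ s, x i • a i) ω = ∑ i ∈ s, x i * linComb F (a i) ω := by
  simp [linComb, map_sum]

lemma IsSpectralGP.indepFun [IsProbabilityMeasure P] (hF : IsSpectralGP P μ F)
    {ι κ : Type*} [Fintype ι] [Fintype κ]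
    (a : ι → ℝ →₀ ℝ) (b : κ → ℝ →₀ ℝ)
    (h : ∀ i j, ∫ ω, linComb F (a i) ω * linComb F (b j) ω ∂P = 0) :
    IndepFun (fun ω i => linComb F (a i) ω) (fun ω j => linComb F (b j) ω) P := by
  classical
  have hm : Measurable (fun ω => ((fun i => linComb F (a i) ω : ι → ℝ),
      (fun j => linComb F (b j) ω : κ → ℝ))) :=
    (measurable_pi_lambda _ fun i => hF.measurable_linComb _).prodMk
      (measurable_pi_lambda _ fun i => hF.measurable_linComb _)
  refine HasGaussianLaw.indepFun_of_covariance_eval ⟨?_⟩ fun i j => ?_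
  · refine isGaussian_of_map_eq_gaussianReal fun L => ?_
    rw [Measure.map_map (by fun_prop) hm]
    refine ⟨0, _, Eq.trans ?_
      (hF.law (∑ i, L (Pi.single i 1, 0) • a i + ∑ j, L (0, Pi.single j 1) • b j))⟩
    · congr 1
      ext ω
      rw [linComb_add, linComb_sum_smul, linComb_sum_smul, Function.comp]
      have h1 : ((fun i => linComb F (a i) ω : ι → ℝ), (fun j => linComb F (b j) ω : κ → ℝ)) =
          ∑ i, linComb F (a i) ω • ((Pi.single i 1 : ι → ℝ), (0 : κ → ℝ)) +
          ∑ j, linComb F (b j) ω • ((0 : ι → ℝ), (Pi.single j 1 : κ → ℝ)) := by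
        ext k
        · simp [Prod.fst_sum, Finset.sum_apply, Pi.single_apply]
        · simp [Prod.snd_sum, Finset.sum_apply, Pi.single_apply]
      rw [h1, map_add, map_sum, map_sum]
      simp only [map_smul, smul_eq_mul, mul_comm]
  · rw [covariance_eq_sub (hF.memLp _) (hF.memLp _), hF.integral_eq_zero]
    simpa using h i j

lemma exists_inner_sub_sum_eq_zero {V : Type*} [NormedAddCommGroup V] [InnerProductSpace ℝ V]
    {m : ℕ} (x : V) (v : Fin m → V) :
    ∃ c : Fin m → ℝ, ∀ j, inner ℝ (x - ∑ k, c k • v k) (v j) = 0 := by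
  set W := Submodule.span ℝ (range v) with hW
  haveI : FiniteDimensional ℝ W := FiniteDimensional.span_of_finite ℝ (finite_range v)
  have h2 : W.starProjection x ∈ W := Submodule.starProjection_apply_mem W x
  obtain ⟨c, hc⟩ := (Submodule.mem_span_range_iff_exists_fun ℝ).1 h2
  refine ⟨c, fun j => ?_⟩
  rw [hc]
  exact Submodule.starProjection_inner_eq_zero (K := W) x (v j) (Submodule.subset_span ⟨j, rfl⟩)

/-- Orthogonal projection of one value of a linear combination on finitely many others. -/
lemma IsSpectralGP.exists_orthogonal (hF : IsSpectralGP P μ F) {m : ℕ} (a : ℝ →₀ ℝ)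
    (b : Fin m → ℝ →₀ ℝ) :
    ∃ c : Fin m → ℝ, ∀ j, ∫ ω, linComb F (a - ∑ k, c k • b k) ω * linComb F (b j) ω ∂P = 0 := by
  obtain ⟨c, hc⟩ := exists_inner_sub_sum_eq_zero (hF.memLp a).toLp (fun k => (hF.memLp (b k)).toLp)
  refine ⟨c, fun j => ?_⟩
  rw [← hc j, L2.inner_def]
  refine integral_congr_ae ?_
  have h2 : (((hF.memLp a).toLp - ∑ k, c k • (hF.memLp (b k)).toLp : Lp ℝ 2 P) : Ω → ℝ) =ᵐ[P]
      linComb F (a - ∑ k, c k • b k) := by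
    have h3 : ((hF.memLp a).toLp - ∑ k, c k • (hF.memLp (b k)).toLp : Lp ℝ 2 P) =
        ((hF.memLp (a - ∑ k, c k • b k)).toLp) := by
      have h4 : ∀ s : Finset (Fin m), ∑ k ∈ s, c k • (hF.memLp (b k)).toLp =
          ((hF.memLp (∑ k ∈ s, c k • b k)).toLp) := by
        intro s
        classical
        induction s using Finset.induction_on with
        | empty =>
          simp only [Finset.sum_empty]
          rw [← MemLp.toLp_zero (MemLp.zero (ε := ℝ) (p := 2) (μ := P))]
          exact MemLp.toLp_congr _ _ (Filter.Eventually.of_forall fun ω => by simp [linComb])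
        | insert i s hi ih =>
          simp only [Finset.sum_insert hi]
          rw [ih, ← MemLp.toLp_const_smul, ← MemLp.toLp_add]
          refine MemLp.toLp_congr _ _ (Filter.Eventually.of_forall fun ω => ?_)
          simp [linComb]
      rw [h4, ← MemLp.toLp_sub]
      refine MemLp.toLp_congr _ _ (Filter.Eventually.of_forall fun ω => ?_)
      simp [linComb]
    rw [h3]
    exact MemLp.coeFn_toLp _
  filter_upwards [h2, (hF.memLp (b j)).coeFn_toLp] with ω h5 h6
  rw [h5, h6]
  simp [mul_comm]
end

lemma lintegral_Icc_exp_neg_log_abs_le {a : ℝ} (ha : 0 < a) :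
    ∫⁻ y in Icc (-a) a, ENNReal.ofReal (Real.exp (-(1 / 2) * Real.log |y|)) ≤
      ENNReal.ofReal (4 * Real.sqrt a) := by
  set f : ℝ → ℝ := fun y => |y| ^ (-(1 / 2) : ℝ) with hf
  have h1 : ∀ᵐ y : ℝ, ENNReal.ofReal (Real.exp (-(1 / 2) * Real.log |y|)) =
      ENNReal.ofReal (f y) := by
    filter_upwards [measure_eq_zero_iff_ae_notMem.1 (measure_singleton (μ := volume) (0 : ℝ))]
      with y hy
    have : 0 < |y| := abs_pos.2 (by simpa using hy)
    simp only [hf]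
    rw [Real.rpow_def_of_pos this, mul_comm]
  have h0 : IntervalIntegrable f volume 0 a := by
    have h := intervalIntegral.intervalIntegrable_rpow' (a := 0) (b := a)
      (r := (-(1 / 2) : ℝ)) (by norm_num)
    refine h.congr fun x hx => ?_
    rw [uIoc_of_le ha.le] at hx
    simp only [hf, abs_of_pos hx.1]
  have h0' : IntervalIntegrable f volume (-a) 0 := by
    have := (h0.comp_mul_left (c := -1))
    simp only [hf, neg_mul, one_mul, abs_neg] at this
    simpa only [zero_div, div_neg, div_one, neg_zero] using this.symm
  have hi0 : ∫ y in (0 : ℝ)..a, f y = 2 * Real.sqrt a := by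
    rw [intervalIntegral.integral_congr (g := fun y => y ^ (-(1 / 2) : ℝ)) (fun y hy => ?_),
      integral_rpow (Or.inl (by norm_num)), Real.sqrt_eq_rpow]
    · norm_num; ring
    · rw [uIcc_of_le ha.le] at hy
      simp only [hf, abs_of_nonneg hy.1]
  have hi0' : ∫ y in (-a)..0, f y = 2 * Real.sqrt a := by
    have := intervalIntegral.integral_comp_neg (a := 0) (b := a) f
    simp only [hf, abs_neg, neg_zero] at this
    rw [← this]; exact hi0
  have hint : IntegrableOn f (Icc (-a) a) := by
    rw [← intervalIntegrable_iff_integrableOn_Icc_of_le (by linarith)]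
    exact h0'.trans h0
  rw [lintegral_congr_ae (ae_restrict_of_ae h1), ← ofReal_integral_eq_lintegral_ofReal hint
    (Filter.Eventually.of_forall fun y => by positivity)]
  apply ENNReal.ofReal_le_ofReal
  rw [integral_Icc_eq_integral_Ioc, ← intervalIntegral.integral_of_le (by linarith),
    ← intervalIntegral.integral_add_adjacent_intervals h0' h0, hi0, hi0']
  linarith

/-- Uniform bound on the moment of order `-1/2` of a Gaussian variable. -/
lemma lintegral_gaussianReal_exp_neg_log_abs_le (m : ℝ) {v : ℝ≥0} (hv : v ≠ 0) :
    ∫⁻ y, ENNReal.ofReal (Real.exp (-(1 / 2) * Real.log |y|)) ∂(gaussianReal m v) ≤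
      ENNReal.ofReal (5 * Real.exp (-(1 / 4) * Real.log v)) := by
  set a := Real.sqrt v with ha
  have hv0 : (0 : ℝ) < v := by positivity
  have ha0 : 0 < a := Real.sqrt_pos.2 hv0
  have hloga : Real.log v = 2 * Real.log a := by
    rw [ha, Real.log_sqrt hv0.le]; ring
  set ψ : ℝ → ℝ≥0∞ := fun y => ENNReal.ofReal (Real.exp (-(1 / 2) * Real.log |y|)) with hψ
  have hψm : Measurable ψ := by fun_prop
  set q := Real.exp (-(1 / 2) * Real.log a) with hq
  have hqpos : 0 < q := Real.exp_pos _
  have hqs : q * Real.sqrt a = 1 := by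
    rw [hq, Real.sqrt_eq_rpow, Real.rpow_def_of_pos ha0, ← Real.exp_add]
    simp; ring
  have hsq : Real.sqrt a * Real.sqrt a = a := Real.mul_self_sqrt ha0.le
  rw [← lintegral_add_compl ψ (measurableSet_Icc (a := -a) (b := a))]
  have hin : ∫⁻ y in Icc (-a) a, ψ y ∂(gaussianReal m v) ≤ ENNReal.ofReal (4 * q) := by
    rw [gaussianReal_of_var_ne_zero m hv, restrict_withDensity measurableSet_Icc,
      lintegral_withDensity_eq_lintegral_mul _ (measurable_gaussianPDF m v) hψm]
    calc ∫⁻ y in Icc (-a) a, (gaussianPDF m v * ψ) y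
        ≤ ∫⁻ y in Icc (-a) a, ENNReal.ofReal (1 / a) * ψ y := by
          refine lintegral_mono fun y => ?_
          simp only [Pi.mul_apply]
          gcongr
          rw [gaussianPDF]
          apply ENNReal.ofReal_le_ofReal
          rw [gaussianPDFReal]
          have h1 : Real.exp (-(y - m) ^ 2 / (2 * v)) ≤ 1 := by
            apply Real.exp_le_one_iff.2
            apply div_nonpos_of_nonpos_of_nonneg <;> nlinarith [sq_nonneg (y - m)]
          have h2 : a ≤ Real.sqrt (2 * Real.pi * v) := by
            apply Real.sqrt_le_sqrt
            nlinarith [Real.pi_gt_three]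
          calc (Real.sqrt (2 * Real.pi * v))⁻¹ * Real.exp (-(y - m) ^ 2 / (2 * v))
              ≤ a⁻¹ * 1 := by gcongr
            _ = 1 / a := by simp
      _ = ENNReal.ofReal (1 / a) * ∫⁻ y in Icc (-a) a, ψ y := by
          rw [lintegral_const_mul _ hψm]
      _ ≤ ENNReal.ofReal (1 / a) * ENNReal.ofReal (4 * Real.sqrt a) := by
          gcongr; exact lintegral_Icc_exp_neg_log_abs_le ha0
      _ = ENNReal.ofReal (4 * q) := by
          rw [← ENNReal.ofReal_mul (by positivity)]
          congr 1
          have : Real.sqrt a ≠ 0 := (Real.sqrt_pos.2 ha0).ne'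
          have hq' : q = 1 / Real.sqrt a := by field_simp; exact hqs
          rw [hq']
          field_simp
          rw [pow_two, hsq]
  have hout : ∫⁻ y in (Icc (-a) a)ᶜ, ψ y ∂(gaussianReal m v) ≤ ENNReal.ofReal q := by
    calc ∫⁻ y in (Icc (-a) a)ᶜ, ψ y ∂(gaussianReal m v)
        ≤ ∫⁻ y in (Icc (-a) a)ᶜ, ENNReal.ofReal q ∂(gaussianReal m v) := by
          refine setLIntegral_mono measurable_const fun y hy => ?_
          apply ENNReal.ofReal_le_ofReal
          rw [hq]
          have h1 : a ≤ |y| := by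
            by_contra hcon
            push Not at hcon
            exact hy (abs_le.1 hcon.le)
          have h2 := Real.log_le_log ha0 h1
          apply Real.exp_le_exp.2
          linarith
      _ ≤ ENNReal.ofReal q := by
          rw [lintegral_const]
          calc _ ≤ ENNReal.ofReal q * 1 := by gcongr; rw [Measure.restrict_apply MeasurableSet.univ]; exact prob_le_one
            _ = _ := mul_one _
  calc _ ≤ ENNReal.ofReal (4 * q) + ENNReal.ofReal q := add_le_add hin hout
    _ = _ := by
      rw [← ENNReal.ofReal_add (by positivity) (by positivity), hloga]
      congr 1
      rw [hq, show -(1 / 4) * (2 * Real.log a) = -(1 / 2) * Real.log a by ring]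
      ring

section
variable {Ω : Type*} [MeasurableSpace Ω] {P : Measure Ω} {μ : Measure ℝ} {F : ℝ → Ω → ℝ}

lemma trigSum_sub_sum (a : ℝ →₀ ℝ) {m : ℕ} (c : Fin m → ℝ) (b : Fin m → ℝ →₀ ℝ) (l : ℝ) :
    trigSum (a - ∑ k, c k • b k) l = trigSum a l - ∑ k, (c k : ℂ) * trigSum (b k) l := by
  simp [trigSum, map_sum]

lemma trigSum_single (t l : ℝ) :
    trigSum (Finsupp.single t 1) l = Complex.exp ((l * t : ℝ) * Complex.I) := by
  simp [trigSum]

/-- The value at the end of an arithmetic progression of times has conditional variance bounded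
below by the value of a monic polynomial extremal problem. -/
lemma variance_progression_ge {κ : ℝ}
    (hκ : ∀ L : ℝ, 1 ≤ L → ∀ p : Polynomial ℂ, p.Monic → Real.exp (-(κ * (p.natDegree + 1))) ≤
      ∫ x, ‖p.eval (Complex.exp ((L * x : ℝ) * Complex.I))‖ ^ 2 ∂μ)
    {L : ℝ} (hL : 1 ≤ L) (s : ℝ) {m : ℕ} (c : Fin m → ℝ) :
    Real.exp (-(κ * (m + 1))) ≤ ∫ l, ‖trigSum (Finsupp.single (s + m * L) 1 -
      ∑ k : Fin m, c k • Finsupp.single (s + (k : ℕ) * L) 1) l‖ ^ 2 ∂μ := by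
  set q : Polynomial ℂ := ∑ k : Fin m, Polynomial.monomial (k : ℕ) (-(c k : ℂ)) with hq
  have hdeg : q.degree < (m : ℕ) := by
    rw [hq]
    refine (Polynomial.degree_sum_le _ _).trans_lt ?_
    rw [Finset.sup_lt_iff (by exact WithBot.bot_lt_coe m)]
    intro k _
    refine (Polynomial.degree_monomial_le _ _).trans_lt ?_
    exact_mod_cast k.2
  have hmon := Polynomial.monic_X_pow_add hdeg
  have hnd : (Polynomial.X ^ m + q).natDegree = m :=
    Polynomial.natDegree_eq_of_degree_eq_some <| by
      rw [Polynomial.degree_add_eq_left_of_degree_lt (by rwa [Polynomial.degree_X_pow]),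
        Polynomial.degree_X_pow]
  have h := hκ L hL _ hmon
  rw [hnd] at h
  refine h.trans (le_of_eq ?_)
  refine integral_congr_ae (Filter.Eventually.of_forall fun l => ?_)
  simp only
  congr 1
  rw [trigSum_sub_sum]
  have he : ∀ k : ℕ, trigSum (Finsupp.single (s + k * L) 1) l =
      Complex.exp ((l * s : ℝ) * Complex.I) * Complex.exp ((L * l : ℝ) * Complex.I) ^ k := by
    intro k
    rw [trigSum_single, ← Complex.exp_nat_mul, ← Complex.exp_add]
    congr 1; push_cast; ring
  simp only [he]
  rw [← one_mul ‖Polynomial.eval _ _‖, ← Complex.norm_exp_ofReal_mul_I (l * s), ← norm_mul]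
  congr 1
  simp only [hq, Polynomial.eval_add, Polynomial.eval_pow, Polynomial.eval_X,
    Polynomial.eval_finset_sum, Polynomial.eval_monomial, mul_add, sub_eq_add_neg,
    Finset.mul_sum, ← Finset.sum_neg_distrib]
  congr 1
  refine Finset.sum_congr rfl fun k _ => ?_
  ring

/-- Negative moments of products of values along an arithmetic progression. -/
lemma IsSpectralGP.lintegral_exp_neg_sum_log_le [IsProbabilityMeasure P]
    (hF : IsSpectralGP P μ F) {κ : ℝ} (hκ0 : 0 < κ)
    (hκ : ∀ L : ℝ, 1 ≤ L → ∀ p : Polynomial ℂ, p.Monic → Real.exp (-(κ * (p.natDegree + 1))) ≤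
      ∫ x, ‖p.eval (Complex.exp ((L * x : ℝ) * Complex.I))‖ ^ 2 ∂μ)
    {L : ℝ} (hL : 1 ≤ L) (s : ℝ) (m : ℕ) :
    ∫⁻ ω, ENNReal.ofReal (Real.exp (-(1 / 2) *
        ∑ k ∈ Finset.range m, Real.log |F (s + k * L) ω|)) ∂P ≤
      ENNReal.ofReal (Real.exp ((5 + κ) * m ^ 2)) := by
  induction m with
  | zero => simp
  | succ m ih =>
    set b : Fin m → ℝ →₀ ℝ := fun k => Finsupp.single (s + (k : ℕ) * L) 1 with hb
    set a : ℝ →₀ ℝ := Finsupp.single (s + m * L) 1 with ha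
    obtain ⟨c, hc⟩ := hF.exists_orthogonal a b
    set z := a - ∑ k, c k • b k with hz
    have hind := hF.indepFun (fun _ : Unit => z) b (fun _ j => hc j)
    have hind2 := hind.comp (φ := fun x : Unit → ℝ => x ()) (ψ := id)
      (measurable_pi_apply (X := fun _ : Unit => ℝ) ())
      measurable_id
    have hvar := variance_progression_ge hκ hL s c
    set V := ∫ l, ‖trigSum z l‖ ^ 2 ∂μ with hV
    have hV0 : 0 < V := (Real.exp_pos _).trans_le hvar
    have hVne : V.toNNReal ≠ 0 := by simpa using hV0
    have hYm : Measurable (fun ω (j : Fin m) => linComb F (b j) ω) :=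
      measurable_pi_lambda _ fun j => hF.measurable_linComb _
    have hlaw := (indepFun_iff_map_prod_eq_prod_map_map (hF.measurable_linComb z).aemeasurable
      hYm.aemeasurable).1 hind2
    rw [hF.law] at hlaw
    set Φ : ℝ × (Fin m → ℝ) → ℝ≥0∞ := fun p =>
      ENNReal.ofReal (Real.exp (-(1 / 2) * Real.log |p.1 + ∑ k, c k * p.2 k|)) *
      ENNReal.ofReal (Real.exp (-(1 / 2) * ∑ k, Real.log |p.2 k|)) with hΦ
    have hΦm : Measurable Φ := by fun_prop
    have h1 : ∀ ω, ENNReal.ofReal (Real.exp (-(1 / 2) *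
        ∑ k ∈ Finset.range (m + 1), Real.log |F (s + k * L) ω|)) =
        Φ (linComb F z ω, fun j => linComb F (b j) ω) := by
      intro ω
      have h2 : linComb F z ω + ∑ k, c k * linComb F (b k) ω = F (s + m * L) ω := by
        rw [hz, linComb_sub, linComb_sum_smul, ha, linComb_single]; ring
      simp only [hΦ, h2]
      rw [← ENNReal.ofReal_mul (Real.exp_pos _).le, ← Real.exp_add, Finset.sum_range_succ,
        Finset.sum_range]
      simp only [hb, linComb_single]
      congr 2; ring
    have h3 : ∫⁻ ω, ENNReal.ofReal (Real.exp (-(1 / 2) *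
        ∑ k ∈ Finset.range (m + 1), Real.log |F (s + k * L) ω|)) ∂P =
        ∫⁻ p, Φ p ∂((gaussianReal 0 V.toNNReal).prod
          (P.map (fun ω (j : Fin m) => linComb F (b j) ω))) := by
      simp only [h1]
      rw [← hlaw, lintegral_map hΦm ((hF.measurable_linComb z).prodMk hYm)]
    have : IsProbabilityMeasure (P.map (fun ω (j : Fin m) => linComb F (b j) ω)) :=
      Measure.isProbabilityMeasure_map hYm.aemeasurable
    rw [h3, lintegral_prod_symm' _ hΦm]
    have h4 : ∀ y : Fin m → ℝ, ∫⁻ x, Φ (x, y) ∂(gaussianReal 0 V.toNNReal) ≤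
        ENNReal.ofReal (Real.exp ((5 + κ) * (m + 1))) *
          ENNReal.ofReal (Real.exp (-(1 / 2) * ∑ k, Real.log |y k|)) := by
      intro y
      simp only [hΦ]
      rw [lintegral_mul_const _ (by fun_prop)]
      gcongr
      have h5 := lintegral_gaussianReal_exp_neg_log_abs_le (0 + ∑ k, c k * y k) hVne
      rw [← gaussianReal_map_add_const, lintegral_map (by fun_prop) (by fun_prop)] at h5
      refine h5.trans (ENNReal.ofReal_le_ofReal ?_)
      rw [Real.coe_toNNReal _ hV0.le]
      have h6 : -(κ * (m + 1)) ≤ Real.log V := by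
        rw [Real.le_log_iff_exp_le hV0]; exact hvar
      have h7 : (5 : ℝ) ≤ Real.exp 4 := by linarith [Real.add_one_le_exp (4 : ℝ)]
      calc 5 * Real.exp (-(1 / 4) * Real.log V) ≤ Real.exp 4 * Real.exp (κ * (m + 1)) := by
            refine mul_le_mul h7 (Real.exp_le_exp.2 ?_) (Real.exp_pos _).le (Real.exp_pos _).le
            nlinarith [mul_nonneg hκ0.le (by positivity : (0 : ℝ) ≤ m + 1)]
        _ ≤ Real.exp ((5 + κ) * (m + 1)) := by
            rw [← Real.exp_add]
            apply Real.exp_le_exp.2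
            nlinarith [(Nat.cast_nonneg m : (0 : ℝ) ≤ m)]
    calc _ ≤ ∫⁻ y, ENNReal.ofReal (Real.exp ((5 + κ) * (m + 1))) *
          ENNReal.ofReal (Real.exp (-(1 / 2) * ∑ k, Real.log |y k|))
          ∂(P.map (fun ω (j : Fin m) => linComb F (b j) ω)) := lintegral_mono h4
      _ = ENNReal.ofReal (Real.exp ((5 + κ) * (m + 1))) *
          ∫⁻ ω, ENNReal.ofReal (Real.exp (-(1 / 2) *
            ∑ k ∈ Finset.range m, Real.log |F (s + k * L) ω|)) ∂P := by
          rw [lintegral_const_mul _ (by fun_prop), lintegral_map (by fun_prop) hYm]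
          congr 2
          ext ω
          rw [Finset.sum_range]
          simp only [hb, linComb_single]
      _ ≤ ENNReal.ofReal (Real.exp ((5 + κ) * (m + 1))) *
          ENNReal.ofReal (Real.exp ((5 + κ) * m ^ 2)) := by gcongr
      _ ≤ _ := by
          rw [← ENNReal.ofReal_mul (Real.exp_pos _).le, ← Real.exp_add]
          apply ENNReal.ofReal_le_ofReal
          apply Real.exp_le_exp.2
          push_cast
          nlinarith [mul_nonneg (by linarith : (0 : ℝ) ≤ 5 + κ) (Nat.cast_nonneg m : (0 : ℝ) ≤ m)]
end

/-- The generalized binomial coefficient `w (w - 1) ⋯ (w - k + 1) / k!`. -/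
noncomputable def binomCoeff {K : Type*} [Field K] (w : K) (k : ℕ) : K :=
  ∏ j ∈ Finset.range k, (w - j) / (j + 1)

lemma binomCoeff_eq_choose {K : Type*} [Field K] [CharZero K] (w : K) (k : ℕ) :
    binomCoeff w k = Ring.choose w k := by
  induction k with
  | zero => simp [binomCoeff, Ring.choose_zero_right]
  | succ k ih =>
    rw [binomCoeff, Finset.prod_range_succ, ← binomCoeff, ih, Ring.choose_eq_smul,
      Ring.choose_eq_smul, descPochhammer_succ_right, Polynomial.smeval_mul]
    have : ((Polynomial.X - (k : Polynomial ℤ)).smeval w) = w - k := by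
      simp [Polynomial.smeval_sub, Polynomial.smeval_X, Polynomial.smeval_natCast]
    rw [this, Nat.factorial_succ, smul_eq_mul, smul_eq_mul]
    push_cast
    have h1 : (k.factorial : K) ≠ 0 := by exact_mod_cast k.factorial_ne_zero
    have h2 : (k : K) + 1 ≠ 0 := by exact_mod_cast k.succ_ne_zero
    field_simp

lemma hasSum_binomCoeff (a : ℂ) {y : ℂ} (hy : ‖y‖ < 1) :
    HasSum (fun k => binomCoeff a k * y ^ k) ((1 + y) ^ a) := by
  have hy' : ‖y‖ₑ < 1 := by rw [← ofReal_norm_eq_enorm, ENNReal.ofReal_lt_one]; exact hy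
  have h := (Complex.one_add_cpow_hasFPowerSeriesOnBall_zero (a := a)).hasSum (y := y) (by
    simpa using hy')
  simp only [binomialSeries_apply, List.ofFn_const, List.prod_replicate, zero_add,
    smul_eq_mul] at h
  simpa only [binomCoeff_eq_choose] using h

lemma hasSum_prod_add_div {x q : ℝ} (hq0 : 0 ≤ q) (hq : q < 1) :
    HasSum (fun k => (∏ j ∈ Finset.range k, (x + j) / (j + 1)) * q ^ k) ((1 - q) ^ (-x)) := by
  have hq' : ‖-q‖ₑ < 1 := by
    rw [← ofReal_norm_eq_enorm, ENNReal.ofReal_lt_one, norm_neg, Real.norm_eq_abs,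
      abs_of_nonneg hq0]
    exact hq
  have h := (Real.one_add_rpow_hasFPowerSeriesOnBall_zero (a := -x)).hasSum (y := -q) (by
    simpa using hq')
  simp only [binomialSeries_apply, List.ofFn_const, List.prod_replicate, zero_add,
    smul_eq_mul] at h
  rw [sub_eq_add_neg]
  convert! h using 2 with k
  rw [← binomCoeff_eq_choose, binomCoeff, ← neg_one_mul q, mul_pow, ← mul_assoc]
  congr 1
  have h1 : ((-1 : ℝ)) ^ k = ∏ _j ∈ Finset.range k, (-1 : ℝ) := by simp
  rw [h1, ← Finset.prod_mul_distrib]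
  refine Finset.prod_congr rfl fun j _ => ?_
  ring

lemma norm_binomCoeff_le {w : ℂ} {x : ℝ} (hw : ‖w‖ ≤ x) (k : ℕ) :
    ‖binomCoeff w k‖ ≤ ∏ j ∈ Finset.range k, (x + j) / (j + 1) := by
  rw [binomCoeff, norm_prod]
  refine Finset.prod_le_prod (fun _ _ => norm_nonneg _) fun j _ => ?_
  rw [norm_div]
  have h1 : ‖(j : ℂ) + 1‖ = j + 1 := by
    rw [← Nat.cast_succ, Complex.norm_natCast]; simp
  rw [h1]
  gcongr
  calc ‖w - j‖ ≤ ‖w‖ + ‖(j : ℂ)‖ := norm_sub_le _ _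
    _ ≤ x + j := by rw [Complex.norm_natCast]; gcongr

/-- Newton interpolation series with geometrically small differences define entire functions of
exponential type. -/
lemma exists_entire_newton_series {X : ℕ → ℝ} {M q h : ℝ} (hh : 0 < h)
    (hq0 : 0 ≤ q) (hq : q ≤ 1 / 2) (hX : ∀ k, |X k| ≤ M * q ^ k) :
    ∃ G : ℂ → ℂ, Differentiable ℂ G ∧
      (∀ w : ℂ, HasSum (fun k => binomCoeff (w / h) k * (X k : ℂ)) (G w)) ∧
      ∀ w, ‖G w‖ ≤ M * Real.exp (‖w‖ / h * (q + 2 * q ^ 2)) := by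
  have hq1 : q < 1 := by linarith
  have hM : 0 ≤ M := by simpa using (abs_nonneg _).trans (hX 0)
  have hterm : ∀ {x : ℝ} {w : ℂ}, ‖w‖ ≤ x → ∀ k, ‖binomCoeff (w / h) k * (X k : ℂ)‖ ≤
      M * ((∏ j ∈ Finset.range k, (x / h + j) / (j + 1)) * q ^ k) := by
    intro x w hw k
    rw [norm_mul, Complex.norm_real, Real.norm_eq_abs]
    have h1 : ‖w / h‖ ≤ x / h := by
      rw [norm_div, Complex.norm_real, Real.norm_eq_abs, abs_of_pos hh]; gcongr
    have h0 : 0 ≤ x / h := (norm_nonneg _).trans h1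
    calc ‖binomCoeff (w / h) k‖ * |X k|
        ≤ (∏ j ∈ Finset.range k, (x / h + j) / (j + 1)) * (M * q ^ k) := by
          apply mul_le_mul (norm_binomCoeff_le h1 k) (hX k) (abs_nonneg _)
          exact Finset.prod_nonneg fun j _ => by positivity
      _ = _ := by ring
  have hsum : ∀ x : ℝ, Summable (fun k =>
      M * ((∏ j ∈ Finset.range k, (x / h + j) / (j + 1)) * q ^ k)) := fun x =>
    (hasSum_prod_add_div hq0 hq1).summable.mul_left M
  have hS : ∀ w : ℂ, Summable (fun k => binomCoeff (w / h) k * (X k : ℂ)) := fun w =>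
    Summable.of_norm_bounded (hsum ‖w‖) (hterm le_rfl)
  refine ⟨fun w => ∑' k, binomCoeff (w / h) k * (X k : ℂ), ?_, fun w => (hS w).hasSum, ?_⟩
  · intro w
    have hd : DifferentiableOn ℂ (fun w : ℂ => ∑' k, binomCoeff (w / h) k * (X k : ℂ))
        (Metric.ball 0 (‖w‖ + 1)) := by
      refine Complex.differentiableOn_tsum_of_summable_norm (hsum (‖w‖ + 1)) (fun k => ?_)
        Metric.isOpen_ball fun k v hv => hterm (by simpa using (mem_ball_zero_iff.1 hv).le) k
      refine Differentiable.differentiableOn ?_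
      unfold binomCoeff
      fun_prop
    exact hd.differentiableAt (Metric.isOpen_ball.mem_nhds (by simp))
  · intro w
    have h1 : ‖∑' k, binomCoeff (w / h) k * (X k : ℂ)‖ ≤ M * (1 - q) ^ (-(‖w‖ / h)) :=
      tsum_of_norm_bounded ((hasSum_prod_add_div hq0 hq1).mul_left M) (hterm le_rfl)
    refine h1.trans ?_
    gcongr
    have h1q : 0 < 1 - q := by linarith
    rw [Real.rpow_def_of_pos h1q]
    apply Real.exp_le_exp.2
    have h2 : -Real.log (1 - q) ≤ q + 2 * q ^ 2 := by
      rw [← Real.log_inv]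
      have h3 := Real.log_le_sub_one_of_pos (inv_pos.2 h1q)
      refine h3.trans ?_
      rw [sub_le_iff_le_add, inv_le_iff_one_le_mul₀ h1q]
      nlinarith [sq_nonneg q, mul_nonneg hq0 hq0, mul_nonneg (sq_nonneg q) (by linarith : 0 ≤ 1 - 2 * q)]
    calc Real.log (1 - q) * -(‖w‖ / h) = ‖w‖ / h * (-Real.log (1 - q)) := by ring
      _ ≤ _ := by gcongr

/-- The coefficients of the `k`-th forward difference with step `h` at `a`. -/
noncomputable def fwdComb (h : ℝ) : ℕ → ℝ → (ℝ →₀ ℝ)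
  | 0, a => Finsupp.single a 1
  | k + 1, a => fwdComb h k (a + h) - fwdComb h k a

lemma trigSum_fwdComb (h : ℝ) (k : ℕ) (a l : ℝ) :
    trigSum (fwdComb h k a) l = Complex.exp ((l * a : ℝ) * Complex.I) *
      (Complex.exp ((l * h : ℝ) * Complex.I) - 1) ^ k := by
  induction k generalizing a with
  | zero => simp [fwdComb, trigSum_single]
  | succ k ih =>
    have : trigSum (fwdComb h (k + 1) a) l =
        trigSum (fwdComb h k (a + h)) l - trigSum (fwdComb h k a) l := by
      simp [fwdComb, trigSum]
    rw [this, ih, ih, pow_succ]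
    have h2 : Complex.exp ((l * (a + h) : ℝ) * Complex.I) =
        Complex.exp ((l * a : ℝ) * Complex.I) * Complex.exp ((l * h : ℝ) * Complex.I) := by
      rw [← Complex.exp_add]; congr 1; push_cast; ring
    rw [h2]; ring

lemma norm_exp_mul_I_sub_one_le {A h l : ℝ} (hh : 0 ≤ h) (hl : |l| ≤ A) :
    ‖Complex.exp ((l * h : ℝ) * Complex.I) - 1‖ ≤ A * h := by
  have h1 := Real.norm_exp_I_mul_ofReal_sub_one_le (x := l * h)
  rw [mul_comm] at h1
  refine h1.trans ?_
  rw [Real.norm_eq_abs, abs_mul, abs_of_nonneg hh]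
  gcongr

/-- The coefficients of the error of the truncated Newton series of the value at `a + t`. -/
noncomputable def newtonError (h a t : ℝ) (N : ℕ) : ℝ →₀ ℝ :=
  Finsupp.single (a + t) 1 - ∑ k : Fin N, binomCoeff (t / h) (k : ℕ) • fwdComb h k a

lemma tendsto_integral_trigSum_newtonError {μ : Measure ℝ} [IsFiniteMeasure μ] {A h : ℝ}
    (hA : ∀ᵐ l ∂μ, |l| ≤ A) (hA0 : 0 ≤ A) (hh : 0 < h) (hAh : A * h ≤ 1 / 2) (a t : ℝ) :
    Filter.Tendsto (fun N => ∫ l, ‖trigSum (newtonError h a t N) l‖ ^ 2 ∂μ) Filter.atTop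
      (nhds 0) := by
  set y : ℝ → ℂ := fun l => Complex.exp ((l * h : ℝ) * Complex.I) - 1 with hy
  have hform : ∀ N l, ‖trigSum (newtonError h a t N) l‖ =
      ‖Complex.exp ((l * t : ℝ) * Complex.I) -
        ∑ k ∈ Finset.range N, binomCoeff ((t / h : ℝ) : ℂ) k * y l ^ k‖ := by
    intro N l
    have hb : ∀ k, ((binomCoeff (t / h) k : ℝ) : ℂ) = binomCoeff ((t / h : ℝ) : ℂ) k := by
      intro k; simp [binomCoeff]
    rw [newtonError, trigSum_sub_sum, trigSum_single]
    simp only [trigSum_fwdComb, hb]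
    have h2 : Complex.exp ((l * (a + t) : ℝ) * Complex.I) =
        Complex.exp ((l * a : ℝ) * Complex.I) * Complex.exp ((l * t : ℝ) * Complex.I) := by
      rw [← Complex.exp_add]; congr 1; push_cast; ring
    rw [← one_mul ‖_ - ∑ k ∈ Finset.range N, _‖, ← Complex.norm_exp_ofReal_mul_I (l * a),
      ← norm_mul, h2, mul_sub, Finset.mul_sum, Finset.sum_range]
    congr 2
    refine Finset.sum_congr rfl fun k _ => ?_
    ring
  simp only [hform]
  have hq0 : 0 ≤ A * h := by positivity
  have hs := hasSum_prod_add_div (x := |t / h|) hq0 (by linarith)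
  have hterm : ∀ l, |l| ≤ A → ∀ k, ‖binomCoeff ((t / h : ℝ) : ℂ) k * y l ^ k‖ ≤
      (∏ j ∈ Finset.range k, (|t / h| + j) / (j + 1)) * (A * h) ^ k := by
    intro l hl k
    rw [norm_mul, norm_pow]
    gcongr
    · exact norm_binomCoeff_le (by rw [Complex.norm_real, Real.norm_eq_abs]) k
    · exact norm_exp_mul_I_sub_one_le hh.le hl
  have h0 : (0 : ℝ) = ∫ _, (0 : ℝ) ∂μ := by simp
  rw [h0]
  refine tendsto_integral_of_dominated_convergence
    (fun _ => (1 + (1 - A * h) ^ (-|t / h|)) ^ 2) (fun N => ?_) (integrable_const _)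
    (fun N => ?_) ?_
  · apply Continuous.aestronglyMeasurable
    fun_prop
  · filter_upwards [hA] with l hl
    rw [Real.norm_eq_abs, abs_of_nonneg (by positivity)]
    gcongr
    refine (norm_sub_le _ _).trans ?_
    rw [Complex.norm_exp_ofReal_mul_I]
    gcongr
    calc _ ≤ ∑ k ∈ Finset.range N, ‖binomCoeff ((t / h : ℝ) : ℂ) k * y l ^ k‖ := norm_sum_le _ _
      _ ≤ ∑ k ∈ Finset.range N,
          (∏ j ∈ Finset.range k, (|t / h| + j) / (j + 1)) * (A * h) ^ k :=
        Finset.sum_le_sum fun k _ => hterm l hl k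
      _ ≤ _ := sum_le_hasSum _ (fun k _ => by positivity) hs
  · filter_upwards [hA] with l hl
    have hyl : ‖y l‖ < 1 := by
      have := norm_exp_mul_I_sub_one_le hh.le hl
      exact this.trans_lt (by linarith)
    have h1 := (hasSum_binomCoeff ((t / h : ℝ) : ℂ) hyl).tendsto_sum_nat
    have h2 : (1 + y l) ^ ((t / h : ℝ) : ℂ) = Complex.exp ((l * t : ℝ) * Complex.I) := by
      simp only [hy, add_sub_cancel]
      rw [Complex.cpow_def_of_ne_zero (Complex.exp_ne_zero _), Complex.log_exp]
      · have hhc : (h : ℂ) ≠ 0 := by exact_mod_cast hh.ne'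
        congr 1; push_cast; field_simp
      · rw [Complex.im_ofReal_mul, Complex.I_im]
        have h3 : |l * h| ≤ 1 / 2 := by
          rw [abs_mul, abs_of_pos hh]; exact (by gcongr : |l| * h ≤ A * h).trans hAh
        linarith [(abs_le.1 h3).1, Real.pi_gt_three]
      · rw [Complex.im_ofReal_mul, Complex.I_im]
        have h3 : |l * h| ≤ 1 / 2 := by
          rw [abs_mul, abs_of_pos hh]; exact (by gcongr : |l| * h ≤ A * h).trans hAh
        linarith [(abs_le.1 h3).2, Real.pi_gt_three]
    rw [h2] at h1
    have h3 := ((h1.const_sub (Complex.exp ((l * t : ℝ) * Complex.I))).norm).pow 2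
    simpa using h3

section
variable {Ω : Type*} [MeasurableSpace Ω] {P : Measure Ω} {μ : Measure ℝ} {F : ℝ → Ω → ℝ}

/-- If the variances of linear combinations tend to zero, any pointwise limit vanishes almost
surely. -/
lemma IsSpectralGP.ae_limit_eq_zero (hF : IsSpectralGP P μ F) {c : ℕ → ℝ →₀ ℝ}
    (hc : Filter.Tendsto (fun n => ∫ l, ‖trigSum (c n) l‖ ^ 2 ∂μ) Filter.atTop (nhds 0)) :
    ∀ᵐ ω ∂P, ∀ y, Filter.Tendsto (fun n => linComb F (c n) ω) Filter.atTop (nhds y) → y = 0 := by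
  have hm : ∀ n, Measurable fun ω => ENNReal.ofReal (linComb F (c n) ω ^ 2) := fun n =>
    ((hF.measurable_linComb (c n)).pow_const 2).ennreal_ofReal
  have h1 := lintegral_liminf_le (μ := P) (u := Filter.atTop) hm
  have h2 : ∀ n, ∫⁻ ω, ENNReal.ofReal (linComb F (c n) ω ^ 2) ∂P =
      ENNReal.ofReal (∫ l, ‖trigSum (c n) l‖ ^ 2 ∂μ) := by
    intro n
    rw [← hF.integral_sq, ofReal_integral_eq_lintegral_ofReal (hF.memLp (c n)).integrable_sq
      (Filter.Eventually.of_forall fun _ => sq_nonneg _)]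
  have h3 : Filter.Tendsto (fun n => ENNReal.ofReal (∫ l, ‖trigSum (c n) l‖ ^ 2 ∂μ))
      Filter.atTop (nhds 0) := by
    simpa using ENNReal.tendsto_ofReal hc
  simp only [h2, h3.liminf_eq] at h1
  have h4 := (lintegral_eq_zero_iff (Measurable.liminf hm)).1 (le_antisymm h1 bot_le)
  filter_upwards [h4] with ω hω y hy
  have h5 : Filter.Tendsto (fun n => ENNReal.ofReal (linComb F (c n) ω ^ 2)) Filter.atTop
      (nhds (ENNReal.ofReal (y ^ 2))) := ENNReal.tendsto_ofReal (hy.pow 2)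
  rw [h5.liminf_eq] at hω
  have h6 := ENNReal.ofReal_eq_zero.1 hω
  exact pow_eq_zero_iff two_ne_zero |>.1 (le_antisymm h6 (sq_nonneg y))

lemma IsSpectralGP.measure_ge_le [IsProbabilityMeasure P] (hF : IsSpectralGP P μ F)
    {c : ℝ →₀ ℝ} {a w : ℝ} (ha : 0 ≤ a) (hw : 0 < w) (hcw : ∫ l, ‖trigSum c l‖ ^ 2 ∂μ ≤ w) :
    P {ω | a ≤ linComb F c ω} ≤ ENNReal.ofReal (Real.exp (-(a ^ 2 / (2 * w)))) := by
  have hint : Integrable (fun ω => Real.exp (a / w * linComb F c ω)) P := by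
    have h1 := integrable_exp_mul_gaussianReal (μ := 0)
      (v := (∫ l, ‖trigSum c l‖ ^ 2 ∂μ).toNNReal) (a / w)
    rw [← hF.law c] at h1
    exact h1.comp_measurable (hF.measurable_linComb c)
  have h := ProbabilityTheory.measure_ge_le_exp_mul_mgf (μ := P) (X := linComb F c) a
    (t := a / w) (by positivity) hint
  rw [mgf_gaussianReal (hF.law c), ← Real.exp_add, Real.coe_toNNReal _ (by positivity)] at h
  rw [← ofReal_measureReal]
  refine ENNReal.ofReal_le_ofReal (h.trans (Real.exp_le_exp.2 ?_))
  have h2 : (∫ l, ‖trigSum c l‖ ^ 2 ∂μ) * (a / w) ^ 2 / 2 ≤ w * (a / w) ^ 2 / 2 := by gcongr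
  have h3 : -(a / w) * a + (0 * (a / w) + w * (a / w) ^ 2 / 2) = -(a ^ 2 / (2 * w)) := by
    field_simp; ring
  linarith

lemma IsSpectralGP.measure_abs_ge_le [IsProbabilityMeasure P] (hF : IsSpectralGP P μ F)
    {c : ℝ →₀ ℝ} {a w : ℝ} (ha : 0 ≤ a) (hw : 0 < w) (hcw : ∫ l, ‖trigSum c l‖ ^ 2 ∂μ ≤ w) :
    P {ω | a ≤ |linComb F c ω|} ≤ 2 * ENNReal.ofReal (Real.exp (-(a ^ 2 / (2 * w)))) := by
  have hneg : ∫ l, ‖trigSum (-c) l‖ ^ 2 ∂μ ≤ w := by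
    simpa [trigSum] using hcw
  have hsub : {ω | a ≤ |linComb F c ω|} ⊆
      {ω | a ≤ linComb F c ω} ∪ {ω | a ≤ linComb F (-c) ω} := by
    intro ω hω
    have hω : a ≤ |linComb F c ω| := hω
    rcases le_abs.1 hω with h | h
    · exact Or.inl h
    · exact Or.inr (by simpa [linComb] using h)
  calc _ ≤ _ := measure_mono hsub
    _ ≤ _ := measure_union_le _ _
    _ ≤ _ := add_le_add (hF.measure_ge_le ha hw hcw) (hF.measure_ge_le ha hw hneg)
    _ = _ := (two_mul _).symm

lemma integral_trigSum_fwdComb_le [IsProbabilityMeasure μ] {A h : ℝ} (hA : ∀ᵐ l ∂μ, |l| ≤ A)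
    (hh : 0 ≤ h) (k : ℕ) (a : ℝ) :
    ∫ l, ‖trigSum (fwdComb h k a) l‖ ^ 2 ∂μ ≤ ((A * h) ^ k) ^ 2 := by
  have h1 : ∀ᵐ l ∂μ, ‖trigSum (fwdComb h k a) l‖ ^ 2 ≤ ((A * h) ^ k) ^ 2 := by
    filter_upwards [hA] with l hl
    rw [trigSum_fwdComb, norm_mul, norm_pow, Complex.norm_exp_ofReal_mul_I, one_mul]
    gcongr
    exact norm_exp_mul_I_sub_one_le hh hl
  have h2 := integral_mono_of_nonneg (Filter.Eventually.of_forall fun _ => by positivity)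
    (integrable_const _) h1
  simpa using h2

lemma IsSpectralGP.measure_fwdComb_gt_le [IsProbabilityMeasure P] [IsProbabilityMeasure μ]
    (hF : IsSpectralGP P μ F) {A T : ℝ} (hA : ∀ᵐ l ∂μ, |l| ≤ A) (hA0 : 0 < A) (hT : 1 ≤ T)
    (a : ℝ) :
    P {ω | ∃ k, 2 * T * (A * T⁻¹ * (1 + T⁻¹)) ^ k < |linComb F (fwdComb T⁻¹ k a) ω|} ≤
      ENNReal.ofReal (4 * Real.exp (-2 * T ^ 2)) := by
  have hT0 : 0 < T := by linarith
  have hk : ∀ k : ℕ, P {ω | 2 * T * (A * T⁻¹ * (1 + T⁻¹)) ^ k < |linComb F (fwdComb T⁻¹ k a) ω|} ≤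
      ENNReal.ofReal (2 * Real.exp (-2 * T ^ 2) * (1 / 2) ^ k) := by
    intro k
    refine (measure_mono (t := {ω | 2 * T * (A * T⁻¹ * (1 + T⁻¹)) ^ k ≤
      |linComb F (fwdComb T⁻¹ k a) ω|}) fun ω hω => le_of_lt (mem_setOf_eq ▸ hω)).trans
      ((hF.measure_abs_ge_le
      (a := 2 * T * (A * T⁻¹ * (1 + T⁻¹)) ^ k) (by positivity)
      (by positivity : 0 < ((A * T⁻¹) ^ k) ^ 2)
      (integral_trigSum_fwdComb_le hA (by positivity) k a)).trans ?_)
    rw [show (2 : ℝ≥0∞) = ENNReal.ofReal 2 by simp, ← ENNReal.ofReal_mul (zero_le_two)]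
    apply ENNReal.ofReal_le_ofReal
    rw [mul_assoc 2 (Real.exp _)]
    refine mul_le_mul_of_nonneg_left ?_ (by norm_num)
    have h1 : (1 / 2 : ℝ) ≥ Real.exp (-1) := by
      rw [Real.exp_neg]
      have := Real.add_one_le_exp (1 : ℝ)
      rw [ge_iff_le, inv_le_comm₀ (Real.exp_pos _) (by norm_num)]
      linarith
    have h2 : Real.exp (-2 * T ^ 2) * Real.exp (-1) ^ k ≤ Real.exp (-2 * T ^ 2) * (1 / 2) ^ k := by
      gcongr
    refine le_trans ?_ h2
    rw [← Real.exp_nat_mul, ← Real.exp_add]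
    apply Real.exp_le_exp.2
    have h3 : (2 * T * (A * T⁻¹ * (1 + T⁻¹)) ^ k) ^ 2 / (2 * ((A * T⁻¹) ^ k) ^ 2) =
        2 * T ^ 2 * (1 + T⁻¹) ^ (2 * k) := by
      rw [mul_pow (A * T⁻¹), pow_mul' _ 2 k]
      field_simp
      try ring
    rw [h3]
    have h4 := one_add_mul_le_pow (a := T⁻¹) (by have : 0 < T⁻¹ := by positivity
                                                 linarith) (2 * k)
    have h5 : 2 * T ^ 2 * (1 + ((2 * k : ℕ) : ℝ) * T⁻¹) ≤ 2 * T ^ 2 * (1 + T⁻¹) ^ (2 * k) := by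
      gcongr
    have h6 : 2 * T ^ 2 * (1 + ((2 * k : ℕ) : ℝ) * T⁻¹) = 2 * T ^ 2 + 4 * k * T := by
      push_cast; field_simp; try ring
    have h7 : (k : ℝ) * 1 ≤ k * T := by gcongr
    nlinarith
  rw [setOf_exists]
  refine (measure_iUnion_le _).trans ((ENNReal.tsum_le_tsum hk).trans ?_)
  rw [← ENNReal.ofReal_tsum_of_nonneg (fun _ => by positivity)
    (summable_geometric_two.mul_left _), _root_.tsum_mul_left, tsum_geometric_two]
  apply ENNReal.ofReal_le_ofReal
  apply le_of_eq; ring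

/-- Entire functions agreeing with translates of a real function, each with an exponential bound,
glue to an entire extension of exponential type. -/
lemma exists_entire_of_translates {φ : ℝ → ℝ} {M B : ℝ} {K : ℕ} (hM : 0 ≤ M) (hB : 0 ≤ B)
    (h : ∀ n : ℤ, n ∈ Finset.Icc (-(K : ℤ)) K → ∃ G : ℂ → ℂ, Differentiable ℂ G ∧
      (∀ t : ℝ, G t = φ (n + t)) ∧ ∀ w, ‖G w‖ ≤ M * Real.exp (B * ‖w‖)) :
    ∃ f : ℂ → ℂ, Differentiable ℂ f ∧ (∀ x : ℝ, f x = φ x) ∧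
      ∀ z : ℂ, |z.re| ≤ K → ‖f z‖ ≤ M * Real.exp (B * (|z.im| + 1)) := by
  obtain ⟨f, hf, hfφ, -⟩ := h 0 (by simp)
  refine ⟨f, hf, fun x => by simpa using hfφ x, fun z hz => ?_⟩
  obtain ⟨G, hG, hGφ, hGb⟩ := h ⌊z.re⌋ (by
    rw [Finset.mem_Icc, Int.le_floor]
    have h1 := abs_le.1 hz
    refine ⟨by push_cast; exact h1.1, ?_⟩
    have h2 : (⌊z.re⌋ : ℝ) ≤ (K : ℤ) := (Int.floor_le _).trans (by exact_mod_cast h1.2)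
    exact_mod_cast h2)
  have heq : G = fun w => f (⌊z.re⌋ + w) := by
    refine AnalyticOnNhd.eq_of_frequently_eq (𝕜 := ℂ) (z₀ := 0) (fun x _ => hG.analyticAt x)
      (fun x _ => Differentiable.analyticAt (by fun_prop) x) ?_
    have h1 : Filter.Tendsto (fun t : ℝ => (t : ℂ)) (nhdsWithin 0 {0}ᶜ) (nhdsWithin 0 {0}ᶜ) := by
      refine tendsto_nhdsWithin_iff.2 ⟨?_, ?_⟩
      · exact (Complex.continuous_ofReal.tendsto' 0 0 (by simp)).mono_left nhdsWithin_le_nhds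
      · filter_upwards [self_mem_nhdsWithin] with t ht
        simpa using ht
    refine h1.frequently (Filter.Eventually.frequently (Filter.Eventually.of_forall fun t => ?_))
    have h2 := hfφ (⌊z.re⌋ + t)
    push_cast at h2
    rw [hGφ, h2]
    simp
  have h3 : f z = G (z - ⌊z.re⌋) := by rw [heq]; congr 1; ring
  rw [h3]
  refine (hGb _).trans ?_
  gcongr
  refine (Complex.norm_le_abs_re_add_abs_im _).trans ?_
  have h4 : |(z - ⌊z.re⌋).re| ≤ 1 := by
    have h5 : (z - (⌊z.re⌋ : ℂ)).re = z.re - ⌊z.re⌋ := by simp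
    rw [h5, abs_le]
    constructor <;> linarith [Int.floor_le z.re, Int.lt_floor_add_one z.re]
  have h6 : (z - (⌊z.re⌋ : ℂ)).im = z.im := by simp
  rw [h6]; linarith

lemma IsSpectralGP.ae_exists_newton_extension [IsProbabilityMeasure μ]
    (hF : IsSpectralGP P μ F) {A h q M : ℝ} (hA : ∀ᵐ l ∂μ, |l| ≤ A) (hA0 : 0 ≤ A) (hh : 0 < h)
    (hAh : A * h ≤ 1 / 2) (hq0 : 0 ≤ q) (hq : q ≤ 1 / 2) :
    ∀ᵐ ω ∂P, ∀ n : ℤ, (∀ k, |linComb F (fwdComb h k n) ω| ≤ M * q ^ k) →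
      ∃ G : ℂ → ℂ, Differentiable ℂ G ∧ (∀ t : ℝ, G t = F (n + t) ω) ∧
        ∀ w, ‖G w‖ ≤ M * Real.exp (‖w‖ / h * (q + 2 * q ^ 2)) := by
  have hae : ∀ᵐ ω ∂P, ∀ (n : ℤ) (t : ℚ), ∀ y,
      Filter.Tendsto (fun N => linComb F (newtonError h n t N) ω) Filter.atTop (nhds y) → y = 0 :=
    ae_all_iff.2 fun n => ae_all_iff.2 fun t =>
      hF.ae_limit_eq_zero (tendsto_integral_trigSum_newtonError hA hA0 hh hAh n t)
  filter_upwards [hae] with ω hω n hn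
  obtain ⟨G, hG, hGs, hGb⟩ := exists_entire_newton_series hh hq0 hq hn
  refine ⟨G, hG, ?_, hGb⟩
  have hrat : ∀ t : ℚ, G ((t : ℝ) : ℂ) = F (n + (t : ℝ)) ω := by
    intro t
    have h1 := (Complex.continuous_re.tendsto _).comp (hGs ((t : ℝ) : ℂ)).tendsto_sum_nat
    have hterm : ∀ k, binomCoeff (((t : ℝ) : ℂ) / h) k * ((linComb F (fwdComb h k n) ω : ℝ) : ℂ) =
        ((binomCoeff ((t : ℝ) / h) k * linComb F (fwdComb h k n) ω : ℝ) : ℂ) := by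
      intro k; simp [binomCoeff]
    have him : (G ((t : ℝ) : ℂ)).im = 0 := by
      have h2 := (Complex.continuous_im.tendsto _).comp (hGs ((t : ℝ) : ℂ)).tendsto_sum_nat
      refine tendsto_nhds_unique h2 ?_
      simp only [hterm, Function.comp_def, Complex.im_sum, Complex.ofReal_im,
        Finset.sum_const_zero]
      exact tendsto_const_nhds
    have hlin : ∀ N, linComb F (newtonError h n t N) ω = F (n + (t : ℝ)) ω -
        (∑ k ∈ Finset.range N, binomCoeff (((t : ℝ) : ℂ) / h) k *
          ((linComb F (fwdComb h k n) ω : ℝ) : ℂ)).re := by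
      intro N
      rw [newtonError, linComb_sub, linComb_single, linComb_sum_smul]
      simp only [hterm, Complex.re_sum, Complex.ofReal_re]
      rw [Finset.sum_range]
    have h3 := hω n t (F (n + (t : ℝ)) ω - (G ((t : ℝ) : ℂ)).re) (by
      simp only [hlin]
      exact h1.const_sub _)
    apply Complex.ext
    · simp only [Complex.ofReal_re]; linarith
    · simpa using him
  have hc1 : Continuous fun t : ℝ => G t := hG.continuous.comp Complex.continuous_ofReal
  have hc2 : Continuous fun t : ℝ => ((F (n + t) ω : ℝ) : ℂ) :=
    Complex.continuous_ofReal.comp ((hF.cont ω).comp (continuous_const.add continuous_id))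
  have heq := (Rat.denseRange_cast (𝕜 := ℝ)).equalizer hc1 hc2 (funext fun t => hrat t)
  exact fun t => congrFun heq t

/-- Outside an event of Gaussian-small probability, the sample paths extend to entire functions of
exponential type at most `A` in the large. -/
lemma IsSpectralGP.exists_entire_extension [IsProbabilityMeasure P] [IsProbabilityMeasure μ]
    (hF : IsSpectralGP P μ F) {A T : ℝ} (hA : ∀ᵐ l ∂μ, |l| ≤ A) (hA0 : 0 < A) (hT : 1 ≤ T)
    (hTA : 4 * A ≤ T) :
    ∃ s : Set Ω, P s ≤ ENNReal.ofReal ((16 * T + 12) * Real.exp (-2 * T ^ 2)) ∧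
      ∀ᵐ ω ∂P, ω ∉ s → ∃ f : ℂ → ℂ, Differentiable ℂ f ∧ (∀ x : ℝ, f x = F x ω) ∧
        ∀ z : ℂ, |z.re| ≤ 2 * T → |z.im| ≤ T →
          ‖f z‖ ≤ 2 * T * Real.exp (A * (3 + 16 * A)) * Real.exp (A * |z.im|) := by
  have hT0 : 0 < T := by linarith
  set h := T⁻¹ with hh
  have hh0 : 0 < h := by positivity
  have hh1 : h ≤ 1 := inv_le_one_of_one_le₀ hT
  have hTh : T * h = 1 := mul_inv_cancel₀ hT0.ne'
  set q := A * h * (1 + h) with hq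
  have hq0 : 0 ≤ q := by positivity
  have hAh : A * h ≤ 1 / 4 := by
    have : 4 * A * h ≤ T * h := by gcongr
    linarith
  have hq2 : q ≤ 2 * (A * h) := by
    have : A * h * (1 + h) ≤ A * h * 2 := by gcongr; linarith
    linarith
  set K := ⌈2 * T⌉₊ with hK
  set I := Finset.Icc (-(K : ℤ)) K with hI
  refine ⟨⋃ n ∈ I, {ω | ∃ k, 2 * T * q ^ k < |linComb F (fwdComb h k (n : ℝ)) ω|}, ?_, ?_⟩
  · refine (measure_biUnion_finset_le I _).trans ?_
    have hb : ∀ n ∈ I, P {ω | ∃ k, 2 * T * q ^ k < |linComb F (fwdComb h k (n : ℝ)) ω|} ≤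
        ENNReal.ofReal (4 * Real.exp (-2 * T ^ 2)) := fun n _ =>
      hF.measure_fwdComb_gt_le hA hA0 hT (n : ℝ)
    refine (Finset.sum_le_sum hb).trans ?_
    rw [Finset.sum_const, nsmul_eq_mul, ← ENNReal.ofReal_natCast,
      ← ENNReal.ofReal_mul (by positivity)]
    apply ENNReal.ofReal_le_ofReal
    have hcard : (I.card : ℝ) ≤ 4 * T + 3 := by
      have h1 : I.card = 2 * K + 1 := by
        rw [hI, Int.card_Icc]; omega
      have h2 : (K : ℝ) < 2 * T + 1 := Nat.ceil_lt_add_one (by positivity)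
      rw [h1]; push_cast; linarith
    calc (I.card : ℝ) * (4 * Real.exp (-2 * T ^ 2))
        ≤ (4 * T + 3) * (4 * Real.exp (-2 * T ^ 2)) := by gcongr
      _ = _ := by ring
  · filter_upwards [hF.ae_exists_newton_extension (M := 2 * T) hA hA0.le hh0 (by linarith) hq0
      (by linarith)] with ω hω hωs
    simp only [mem_iUnion, mem_setOf_eq, not_exists, not_lt] at hωs
    set B := (q + 2 * q ^ 2) / h with hB
    have hB0 : 0 ≤ B := by positivity
    obtain ⟨f, hf, hfF, hfb⟩ := exists_entire_of_translates (φ := fun x => F x ω) (M := 2 * T)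
      (B := B) (K := K) (by positivity) hB0 (fun n hn => by
        obtain ⟨G, hG, hG1, hG2⟩ := hω n (hωs n hn)
        refine ⟨G, hG, hG1, fun w => (hG2 w).trans_eq ?_⟩
        congr 2
        rw [hB]; ring)
    refine ⟨f, hf, hfF, fun z hz1 hz2 => (hfb z (hz1.trans (Nat.le_ceil _))).trans ?_⟩
    rw [mul_assoc (2 * T), ← Real.exp_add]
    gcongr
    have hBA : B ≤ A + A * h * (1 + 8 * A) := by
      rw [hB, div_le_iff₀ hh0]
      have e1 : q + 2 * q ^ 2 ≤ q + 2 * q * (2 * (A * h)) := by nlinarith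
      have e2 : q * (A * h) ≤ 2 * (A * h) * (A * h) := by gcongr
      have e3 : q = A * h + A * h * h := by rw [hq]; ring
      nlinarith
    have e4 : h * |z.im| ≤ 1 := by
      rw [← hTh, mul_comm]; gcongr
    have e5 : B * (|z.im| + 1) ≤ (A + A * h * (1 + 8 * A)) * (|z.im| + 1) := by gcongr
    have e6 : A * (1 + 8 * A) * (h * |z.im|) ≤ A * (1 + 8 * A) * 1 := by gcongr
    have e7 : A * (1 + 8 * A) * h ≤ A * (1 + 8 * A) * 1 := by gcongr
    nlinarith

lemma IsSpectralGP.ae_ne_zero [IsProbabilityMeasure P] [IsProbabilityMeasure μ]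
    (hF : IsSpectralGP P μ F) (t : ℝ) : ∀ᵐ ω ∂P, F t ω ≠ 0 := by
  have h1 := hF.law (Finsupp.single t 1)
  have h2 : linComb F (Finsupp.single t 1) = F t := funext fun ω => linComb_single F t ω
  have h3 : ∫ l, ‖trigSum (Finsupp.single t 1) l‖ ^ 2 ∂μ = 1 := by
    simp only [trigSum_single, Complex.norm_exp_ofReal_mul_I]; simp
  rw [h2, h3] at h1
  have := noAtoms_gaussianReal (μ := 0) (v := (1 : ℝ).toNNReal) (by simp)
  have h4 : P.map (F t) {0} = 0 := by rw [h1]; exact measure_singleton 0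
  rw [Measure.map_apply (hF.meas t) (measurableSet_singleton 0)] at h4
  exact measure_eq_zero_iff_ae_notMem.1 h4

end

lemma exists_finset_le_card {α : Type*} {Z : Set α} {x : ℝ}
    (h : ENNReal.ofReal x ≤ (Z.encard : ℝ≥0∞)) :
    ∃ S : Finset α, (S : Set α) ⊆ Z ∧ x ≤ S.card := by
  by_cases hZ : Z.Finite
  · refine ⟨hZ.toFinset, by simp, ?_⟩
    rw [hZ.encard_eq_coe_toFinset_card] at h
    have h2 : ENNReal.ofReal x ≤ ((hZ.toFinset.card : ℕ) : ℝ≥0∞) := by simpa using h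
    rw [← ENNReal.ofReal_natCast] at h2
    exact (ENNReal.ofReal_le_ofReal_iff (by positivity)).1 h2
  · obtain ⟨S, hS, hc⟩ := Set.Infinite.exists_subset_card_eq hZ ⌈x⌉₊
    exact ⟨S, hS, by rw [hc]; exact Nat.le_ceil x⟩

/-- An excess of zeros of a function of exponential type `A` forces the average of its logarithm
to be very negative. -/
lemma integral_log_abs_le_of_card {f : ℂ → ℂ} (hf : Differentiable ℂ f) {φ : ℝ → ℝ}
    (hfφ : ∀ x : ℝ, f x = φ x) (h0 : φ 0 ≠ 0) {A T ε M : ℝ} (hA : 0 < A) (hT : 0 < T)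
    (hε : 0 < ε) (hεA : ε ≤ 2 * A / Real.pi) (hM : 1 ≤ M)
    (hbd : ∀ z : ℂ, |z.re| ≤ 2 * T → |z.im| ≤ T → ‖f z‖ ≤ M * Real.exp (A * |z.im|))
    (hlogM : Real.log M ≤ Real.pi / (16 * A) * ε ^ 2 * T)
    {S : Finset ℝ} (hS : ∀ z ∈ S, z ∈ Icc 0 T ∧ φ z = 0)
    (hcard : A / Real.pi * T + ε * T ≤ S.card) :
    let r := Real.pi * ε * T / (4 * A)
    IntervalIntegrable (fun x => Real.log |φ x|) volume (-r) (T + r) ∧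
      ∫ x in (-r)..(T + r), Real.log |φ x| ≤ -(Real.pi / (16 * A) * ε ^ 2 * T) * (T + 2 * r) := by
  intro r
  have hπ := Real.pi_pos
  have hr0 : 0 < r := by positivity
  have hrT : r ≤ T / 2 := by
    have h1 : Real.pi * ε ≤ 2 * A := by
      rw [le_div_iff₀ hπ] at hεA; linarith
    rw [div_le_iff₀ (by positivity)]
    nlinarith
  obtain ⟨hi, hle⟩ := integral_log_abs_le hf hfφ h0 hM hA.le hr0 hT.le (fun z h1 h2 h3 =>
    hbd z (abs_le.2 ⟨by linarith, by linarith⟩) (h3.trans (by linarith))) S hS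
  refine ⟨hi, hle.trans ?_⟩
  have hrε : 2 * A * r / Real.pi = ε * T / 2 := by
    simp only [r]; field_simp; ring
  have h1 : 2 * r * (A / Real.pi * T + ε * T) ≤ 2 * r * S.card := by gcongr
  have h2 : 2 * r * (A / Real.pi * T + ε * T) = ε * T / 2 * T + 2 * r * (ε * T) := by
    rw [← hrε]; ring
  have h3 : (T + 2 * r) * Real.log M ≤ (T + 2 * r) * (Real.pi / (16 * A) * ε ^ 2 * T) := by gcongr
  have h4 : r * (ε * T) = 4 * T * (Real.pi / (16 * A) * ε ^ 2 * T) := by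
    simp only [r]; field_simp; try ring
  have h5 : 0 ≤ Real.pi / (16 * A) * ε ^ 2 * T := by positivity
  rw [hrε]
  nlinarith

section
variable {Ω : Type*} [MeasurableSpace Ω] {P : Measure Ω} {μ : Measure ℝ} {F : ℝ → Ω → ℝ}

/-- Large-deviation bound for the average of the logarithm of a stationary Gaussian process. -/
lemma IsSpectralGP.measure_integral_log_le [IsProbabilityMeasure P] (hF : IsSpectralGP P μ F)
    {κ : ℝ} (hκ0 : 0 < κ) (hκ : ∀ L : ℝ, 1 ≤ L → ∀ p : Polynomial ℂ, p.Monic →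
      Real.exp (-(κ * (p.natDegree + 1))) ≤
        ∫ x, ‖p.eval (Complex.exp ((L * x : ℝ) * Complex.I))‖ ^ 2 ∂μ)
    {a b K : ℝ} {m : ℕ} (hm : 1 ≤ m) (hab : (m : ℝ) ≤ b - a) :
    P {ω | IntervalIntegrable (fun x => Real.log |F x ω|) volume a b ∧
        ∫ x in a..b, Real.log |F x ω| ≤ -K * (b - a)} ≤
      ENNReal.ofReal (Real.exp (-(K * m / 2) + (5 + κ) * m ^ 2)) := by
  have hm0 : (0 : ℝ) < m := by exact_mod_cast hm
  set L := (b - a) / m with hLdef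
  have hmL : m * L = b - a := by rw [hLdef]; field_simp
  have hL : 1 ≤ L := by rw [hLdef, le_div_iff₀ hm0]; linarith
  have hL0 : 0 < L := by linarith
  set Q : Ω → ℝ → ℝ := fun ω s => ∑ k ∈ Finset.range m, Real.log |F (a + s + k * L) ω| with hQ
  set ν := volume.restrict (Ioc 0 L) with hν
  have hνL : ν.real univ = L := by simp [hν, hL0.le]
  have hFm : Measurable fun p : ℝ × Ω => F p.1 p.2 :=
    measurable_uncurry_of_continuous_of_measurable (u := fun t ω => F t ω)
      (fun ω => hF.cont ω) hF.meas
  have hjoint : Measurable fun p : Ω × ℝ => ENNReal.ofReal (Real.exp (-(1 / 2) * Q p.1 p.2)) := by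
    apply Measurable.ennreal_ofReal
    apply Real.measurable_exp.comp
    apply Measurable.const_mul
    refine Finset.measurable_sum _ fun k _ => ?_
    apply Real.measurable_log.comp
    refine Measurable.abs (hFm.comp (Measurable.prodMk ?_ measurable_fst))
    fun_prop
  set Ψ : Ω → ℝ≥0∞ := fun ω => ∫⁻ s, ENNReal.ofReal (Real.exp (-(1 / 2) * Q ω s)) ∂ν with hΨ
  have hΨm : Measurable Ψ := hjoint.lintegral_prod_right'
  have hΨint : ∫⁻ ω, Ψ ω ∂P ≤ ENNReal.ofReal (Real.exp ((5 + κ) * m ^ 2) * L) := by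
    rw [hΨ, lintegral_lintegral_swap hjoint.aemeasurable]
    calc _ ≤ ∫⁻ _, ENNReal.ofReal (Real.exp ((5 + κ) * m ^ 2)) ∂ν :=
          lintegral_mono fun s => hF.lintegral_exp_neg_sum_log_le hκ0 hκ hL (a + s) m
      _ = _ := by
        rw [lintegral_const, ENNReal.ofReal_mul (by positivity), ← hνL, ofReal_measureReal]
  have hsub : {ω | IntervalIntegrable (fun x => Real.log |F x ω|) volume a b ∧
        ∫ x in a..b, Real.log |F x ω| ≤ -K * (b - a)} ⊆
      {ω | ENNReal.ofReal (Real.exp (K * m / 2) * L) ≤ Ψ ω} := by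
    rintro ω ⟨hi, hle⟩
    have hii : ∀ k ∈ Finset.range m, IntervalIntegrable (fun x => Real.log |F x ω|) volume
        (a + k * L) (a + (k + 1 : ℕ) * L) := by
      intro k hk
      have hk' : ((k + 1 : ℕ) : ℝ) ≤ m := by exact_mod_cast Finset.mem_range.1 hk
      refine hi.mono_set ?_
      have h1 : (k : ℝ) * L ≤ (k + 1 : ℕ) * L := by gcongr; simp
      have h2 : ((k + 1 : ℕ) : ℝ) * L ≤ m * L := by gcongr
      have h3 : 0 ≤ (k : ℝ) * L := by positivity
      rw [uIcc_of_le (by linarith), uIcc_of_le (by linarith)]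
      exact Icc_subset_Icc (by linarith) (by linarith)
    have hii' : ∀ k ∈ Finset.range m, IntervalIntegrable
        (fun s => Real.log |F (a + s + k * L) ω|) volume 0 L := by
      intro k hk
      have h1 := (hii k hk).comp_add_right (a + k * L)
      have e1 : a + k * L - (a + k * L) = 0 := by ring
      have e2 : a + (k + 1 : ℕ) * L - (a + k * L) = L := by push_cast; ring
      rw [e1, e2] at h1
      refine h1.congr_ae (Filter.Eventually.of_forall fun s => ?_)
      simp only
      rw [show s + (a + k * L) = a + s + k * L by ring]
    have hQi : Integrable (Q ω) ν := by
      refine integrable_finset_sum _ fun k hk => ?_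
      exact (intervalIntegrable_iff_integrableOn_Ioc_of_le hL0.le).1 (hii' k hk)
    have hQint : ∫ s, Q ω s ∂ν = ∫ x in a..b, Real.log |F x ω| := by
      rw [hν, ← intervalIntegral.integral_of_le hL0.le,
        intervalIntegral.integral_finset_sum hii']
      have h1 := intervalIntegral.sum_integral_adjacent_intervals
        (f := fun x => Real.log |F x ω|) (μ := volume) (a := fun k : ℕ => a + k * L) (n := m)
        (fun k hk => hii k (Finset.mem_range.2 hk))
      have e1 : a + (m : ℝ) * L = b := by linarith
      simp only [Nat.cast_zero, zero_mul, add_zero, e1] at h1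
      rw [← h1]
      refine Finset.sum_congr rfl fun k _ => ?_
      have h2 := intervalIntegral.integral_comp_add_right
        (f := fun x => Real.log |F x ω|) (a := 0) (b := L) (a + k * L)
      rw [show 0 + (a + k * L) = a + k * L by ring,
        show L + (a + k * L) = a + (k + 1 : ℕ) * L by push_cast; ring] at h2
      rw [← h2]
      refine intervalIntegral.integral_congr fun s _ => ?_
      rw [show s + (a + k * L) = a + s + k * L by ring]
    have hν0 : ν ≠ 0 := by
      intro h
      rw [h] at hνL
      simp at hνL
      linarith
    have hJ := ofReal_exp_average_le (hQi.const_mul (-(1 / 2))) hν0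
    rw [integral_const_mul, hQint, hνL] at hJ
    refine le_trans (ENNReal.ofReal_le_ofReal ?_) hJ
    refine mul_le_mul_of_nonneg_right (Real.exp_le_exp.2 ?_) hL0.le
    rw [le_div_iff₀ hL0]
    have : K * m / 2 * L = K * (b - a) / 2 := by rw [← hmL]; ring
    linarith
  have hLpos : 0 < Real.exp (K * m / 2) * L := by positivity
  refine (measure_mono hsub).trans ((meas_ge_le_lintegral_div hΨm.aemeasurable
    (by simpa using hLpos) ENNReal.ofReal_ne_top).trans ?_)
  refine (ENNReal.div_le_div_right hΨint _).trans ?_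
  rw [← ENNReal.ofReal_div_of_pos hLpos]
  apply ENNReal.ofReal_le_ofReal
  rw [Real.exp_add, Real.exp_neg]
  apply le_of_eq
  field_simp

end

lemma mul_exp_neg_two_mul_sq_le {T : ℝ} (hT : 64 ≤ T) :
    (16 * T + 12) * Real.exp (-2 * T ^ 2) ≤ Real.exp (-T ^ 2) := by
  have h1 : 16 * T + 12 ≤ Real.exp (T ^ 2) := by
    have := Real.add_one_le_exp (T ^ 2)
    nlinarith
  calc (16 * T + 12) * Real.exp (-2 * T ^ 2) ≤ Real.exp (T ^ 2) * Real.exp (-2 * T ^ 2) := by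
        gcongr
    _ = Real.exp (-T ^ 2) := by rw [← Real.exp_add]; congr 1; ring

lemma exp_add_exp_le_exp {x y z : ℝ} (hx : 2 * z ≤ x) (hy : 2 * z ≤ y) (hz : 1 ≤ z) :
    Real.exp (-x) + Real.exp (-y) ≤ Real.exp (-z) := by
  have h1 : Real.exp (-x) ≤ Real.exp (-(2 * z)) := Real.exp_le_exp.2 (by linarith)
  have h2 : Real.exp (-y) ≤ Real.exp (-(2 * z)) := Real.exp_le_exp.2 (by linarith)
  have h3 : Real.exp (-(2 * z)) = Real.exp (-z) * Real.exp (-z) := by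
    rw [← Real.exp_add]; congr 1; ring
  have h4 : Real.exp (-z) ≤ 1 / 2 := by
    rw [Real.exp_neg, one_div]
    apply inv_anti₀ (by norm_num)
    linarith [Real.add_one_le_exp z]
  nlinarith [Real.exp_pos (-z)]

lemma div_log_pow_four_le {ε : ℝ} (hε0 : 0 < ε) (hε : ε ≤ Real.exp (-1)) :
    (ε / Real.log ε) ^ 4 ≤ ε ^ 4 := by
  have h1 : Real.log ε ≤ -1 := by
    rw [← Real.log_exp (-1)]; exact Real.log_le_log hε0 hε
  have h2 : 1 ≤ Real.log ε ^ 4 := by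
    have : 1 ≤ Real.log ε ^ 2 := by nlinarith
    nlinarith
  rw [div_pow]
  exact div_le_self (by positivity) h2

lemma add_exp_le_exp_div_log {c c₀ T ε : ℝ} (hc0 : 0 < c) (hcc₀ : 2 * c ≤ c₀) (hc1 : 2 * c ≤ 1)
    (hT : 64 ≤ T) (hε0 : 0 < ε) (hεe : ε ≤ Real.exp (-1)) (hz1 : 1 ≤ c * ε ^ 4 * T ^ 2) :
    (16 * T + 12) * Real.exp (-2 * T ^ 2) + Real.exp (-(c₀ * (ε ^ 4 * T ^ 2))) ≤
      Real.exp (-c * (ε / Real.log ε) ^ 4 * T ^ 2) := by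
  have hε1 : ε ≤ 1 := hεe.trans (Real.exp_le_one_iff.2 (by norm_num))
  calc _ ≤ Real.exp (-T ^ 2) + Real.exp (-(c₀ * (ε ^ 4 * T ^ 2))) := by
        gcongr
        exact mul_exp_neg_two_mul_sq_le hT
    _ ≤ Real.exp (-(c * ε ^ 4 * T ^ 2)) := by
        have h4 : ε ^ 4 ≤ 1 := pow_le_one₀ hε0.le hε1
        rw [show -T ^ 2 = -(T ^ 2) by ring]
        refine exp_add_exp_le_exp ?_ ?_ hz1
        · have : 2 * c * ε ^ 4 * T ^ 2 ≤ 1 * 1 * T ^ 2 := by gcongr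
          linarith
        · have : 2 * c * (ε ^ 4 * T ^ 2) ≤ c₀ * (ε ^ 4 * T ^ 2) := by gcongr
          linarith
    _ ≤ _ := by
        apply Real.exp_le_exp.2
        have : c * (ε / Real.log ε) ^ 4 * T ^ 2 ≤ c * ε ^ 4 * T ^ 2 := by
          exact mul_le_mul_of_nonneg_right
            (mul_le_mul_of_nonneg_left (div_log_pow_four_le hε0 hεe) hc0.le) (sq_nonneg T)
        linarith

lemma sq_mul_log_sq_le {d ε T : ℝ} (hT0 : 0 < T) (hd : 0 ≤ d) (hlog : 0 ≤ Real.log T)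
    (h : d * Real.log T / Real.sqrt T ≤ ε) : d ^ 2 * Real.log T ^ 2 ≤ ε ^ 2 * T := by
  rw [div_le_iff₀ (Real.sqrt_pos.2 hT0)] at h
  calc d ^ 2 * Real.log T ^ 2 = (d * Real.log T) ^ 2 := by ring
    _ ≤ (ε * Real.sqrt T) ^ 2 := pow_le_pow_left₀ (by positivity) h 2
    _ = ε ^ 2 * T := by rw [mul_pow, Real.sq_sqrt hT0.le]

section
variable {Ω : Type*} [MeasurableSpace Ω] {P : Measure Ω} {μ : Measure ℝ} {F : ℝ → Ω → ℝ}

lemma IsSpectralGP.measure_zeroCount_ge_le [IsProbabilityMeasure P] [IsProbabilityMeasure μ]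
    (hF : IsSpectralGP P μ F) {A : ℝ} (hA : ∀ᵐ l ∂μ, |l| ≤ A) (hA0 : 0 < A)
    {κ : ℝ} (hκ0 : 0 < κ) (hκ : ∀ L : ℝ, 1 ≤ L → ∀ p : Polynomial ℂ, p.Monic →
      Real.exp (-(κ * (p.natDegree + 1))) ≤
        ∫ x, ‖p.eval (Complex.exp ((L * x : ℝ) * Complex.I))‖ ^ 2 ∂μ)
    {T ε : ℝ} (hT : 1 ≤ T) (hTA : 4 * A ≤ T) (hε : 0 < ε) (hεA : ε ≤ 2 * A / Real.pi)
    (hM : Real.log (2 * T) + A * (3 + 16 * A) ≤ Real.pi / (16 * A) * ε ^ 2 * T)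
    (hK : 4 * (5 + κ) ≤ Real.pi / (16 * A) * ε ^ 2 * T) (hε1 : ε ≤ 1) :
    P {ω | ENNReal.ofReal (A / Real.pi * T + ε * T) ≤ (zeroCount F T ω : ℝ≥0∞)} ≤
      ENNReal.ofReal ((16 * T + 12) * Real.exp (-2 * T ^ 2) +
        Real.exp (-((Real.pi / (16 * A) * ε ^ 2 * T) ^ 2 / (32 * (5 + κ))))) := by
  have hT0 : 0 < T := by linarith
  have hπ := Real.pi_pos
  obtain ⟨s, hs, hsf⟩ := hF.exists_entire_extension hA hA0 hT hTA
  set K := Real.pi / (16 * A) * ε ^ 2 * T with hKdef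
  set r := Real.pi * ε * T / (4 * A) with hr
  have hr0 : 0 < r := by positivity
  have hK0 : 0 < K := by positivity
  set M := 2 * T * Real.exp (A * (3 + 16 * A)) with hMdef
  have hM1 : 1 ≤ M := by
    have h1 : 1 ≤ Real.exp (A * (3 + 16 * A)) := Real.one_le_exp (by positivity)
    rw [hMdef]; nlinarith
  have hlogM : Real.log M ≤ K := by
    rw [hMdef, Real.log_mul (by positivity) (Real.exp_pos _).ne', Real.log_exp]; exact hM
  set m := ⌊K / (4 * (5 + κ))⌋₊ with hm
  have hm1 : 1 ≤ m := by
    rw [hm, Nat.le_floor_iff (by positivity), Nat.cast_one, le_div_iff₀ (by positivity)]; linarith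
  have hm1' : (1 : ℝ) ≤ m := by exact_mod_cast hm1
  have hmle : (m : ℝ) ≤ K / (4 * (5 + κ)) := Nat.floor_le (by positivity)
  have hmge : K / (4 * (5 + κ)) < m + 1 := Nat.lt_floor_add_one _
  have hmT : (m : ℝ) ≤ (T + r) - (-r) := by
    have h1 : K ≤ T := by
      have h2 : Real.pi / (16 * A) * ε ≤ 1 := by
        rw [div_mul_eq_mul_div, div_le_one (by positivity)]
        rw [le_div_iff₀ hπ] at hεA
        linarith
      have h3 : Real.pi / (16 * A) * ε ^ 2 = Real.pi / (16 * A) * ε * ε := by ring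
      have h4 : Real.pi / (16 * A) * ε ^ 2 ≤ 1 := by rw [h3]; nlinarith
      rw [hKdef]; nlinarith
    have h5 : K / (4 * (5 + κ)) ≤ K := div_le_self hK0.le (by linarith)
    linarith
  have hsmall := hF.measure_integral_log_le hκ0 hκ (a := -r) (b := T + r) (K := K) hm1 hmT
  set s' := {ω | IntervalIntegrable (fun x => Real.log |F x ω|) volume (-r) (T + r) ∧
        ∫ x in (-r)..(T + r), Real.log |F x ω| ≤ -K * (T + r - -r)} with hs'
  have hsub : {ω | ENNReal.ofReal (A / Real.pi * T + ε * T) ≤ (zeroCount F T ω : ℝ≥0∞)}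
      ≤ᵐ[P] (s ∪ s' : Set Ω) := by
    filter_upwards [hsf, hF.ae_ne_zero 0] with ω h1 h2 h3
    by_cases hω : ω ∈ s
    · exact Or.inl hω
    right
    obtain ⟨f, hf, hfF, hbd⟩ := h1 hω
    obtain ⟨S, hS, hcard⟩ := exists_finset_le_card h3
    have h4 := integral_log_abs_le_of_card hf hfF h2 hA0 hT0 hε hεA hM1 hbd hlogM
      (fun z hz => hS hz) hcard
    refine ⟨h4.1, h4.2.trans_eq ?_⟩
    ring
  calc _ ≤ P (s ∪ s') := measure_mono_ae hsub
    _ ≤ P s + P s' := measure_union_le _ _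
    _ ≤ _ := add_le_add hs hsmall
    _ ≤ _ := by
      rw [← ENNReal.ofReal_add (by positivity) (by positivity)]
      apply ENNReal.ofReal_le_ofReal
      gcongr
      rw [neg_add_eq_sub, sub_le_iff_le_add, neg_add_eq_sub, le_sub_comm]
      have h1 : K ≤ 8 * (5 + κ) * m := by
        rw [div_lt_iff₀ (by positivity)] at hmge
        nlinarith
      have h2 : 4 * (5 + κ) * m ≤ K := by
        rw [le_div_iff₀ (by positivity)] at hmle; linarith
      rw [div_le_iff₀ (by positivity)]
      nlinarith [mul_le_mul_of_nonneg_left h2 (by positivity : 0 ≤ (5 + κ) * m),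
        mul_le_mul_of_nonneg_left h1 hK0.le]

lemma IsSpectralGP.measure_zeroCount_ge_le_exp [IsProbabilityMeasure P] [IsProbabilityMeasure μ]
    (hF : IsSpectralGP P μ F) {A : ℝ} (hAae : ∀ᵐ l ∂μ, |l| ≤ A) (hA0 : 0 < A)
    {κ : ℝ} (hκ0 : 0 < κ) (hκ : ∀ L : ℝ, 1 ≤ L → ∀ p : Polynomial ℂ, p.Monic →
      Real.exp (-(κ * (p.natDegree + 1))) ≤
        ∫ x, ‖p.eval (Complex.exp ((L * x : ℝ) * Complex.I))‖ ^ 2 ∂μ)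
    {β c c₀ d₁ : ℝ} (hβ : β = Real.pi / (16 * A)) (hc₀ : c₀ = β ^ 2 / (32 * (5 + κ)))
    (hc0 : 0 < c) (hcc₀ : 2 * c ≤ c₀) (hc1 : 2 * c ≤ 1) (hd1 : 1 ≤ d₁) (hd1c : 1 ≤ c * d₁)
    (hd1A : A ≤ d₁) (hd1M : 2 + A * (3 + 16 * A) ≤ β * d₁) (hd1K : 4 * (5 + κ) ≤ β * d₁)
    {T ε : ℝ} (hT : Real.exp 8 ≤ T) (hε1 : d₁ * Real.log T / Real.sqrt T ≤ ε)
    (hεe : ε ≤ Real.exp (-1)) (hεA : ε ≤ 2 * A / Real.pi) :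
    P {ω | ENNReal.ofReal (A / Real.pi * T + ε * T) ≤ (zeroCount F T ω : ℝ≥0∞)} ≤
      ENNReal.ofReal (Real.exp (-c * (ε / Real.log ε) ^ 4 * T ^ 2)) := by
  have hβ0 : 0 < β := by rw [hβ]; have := Real.pi_pos; positivity
  have hT0 : 0 < T := (Real.exp_pos 8).trans_le hT
  have hlogT : 8 ≤ Real.log T := (Real.le_log_iff_exp_le hT0).2 hT
  have hε0 : 0 < ε := by
    refine lt_of_lt_of_le (div_pos (mul_pos ?_ ?_) (Real.sqrt_pos.2 hT0)) hε1 <;> linarith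
  have hε1' : ε ≤ 1 := hεe.trans (Real.exp_le_one_iff.2 (by norm_num))
  have hεT := sq_mul_log_sq_le hT0 (by linarith : 0 ≤ d₁) (by linarith) hε1
  have hd1sq : d₁ ≤ d₁ ^ 2 := by nlinarith
  have hεT1 : 8 * d₁ * Real.log T ≤ ε ^ 2 * T := by
    have h1 : d₁ * (8 * Real.log T) ≤ d₁ ^ 2 * Real.log T ^ 2 := by
      apply mul_le_mul hd1sq _ (by positivity) (by positivity)
      nlinarith
    linarith
  have hεT2 : 64 * d₁ ≤ ε ^ 2 * T := by nlinarith
  have hε2' : ε ^ 2 ≤ 1 := by nlinarith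
  have hT64 : 64 * d₁ ≤ T := hεT2.trans (by nlinarith)
  have hmain := hF.measure_zeroCount_ge_le hAae hA0 hκ0 hκ (T := T) (ε := ε) (by linarith)
    (by linarith) hε0 hεA (by
      rw [Real.log_mul two_ne_zero hT0.ne', ← hβ]
      have h1 : Real.log 2 ≤ 1 := by linarith [Real.log_two_lt_d9]
      have h2 : β * (8 * d₁ * Real.log T) ≤ β * (ε ^ 2 * T) := by gcongr
      have h3 : (2 + A * (3 + 16 * A)) * Real.log T ≤ β * d₁ * Real.log T := by gcongr
      have h4 : A * (3 + 16 * A) * 1 ≤ A * (3 + 16 * A) * Real.log T := by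
        gcongr; linarith
      have h5 : 0 ≤ β * d₁ * Real.log T := by positivity
      linarith) (by
      rw [← hβ]
      have h2 : β * (64 * d₁) ≤ β * (ε ^ 2 * T) := by gcongr
      have h5 : 0 ≤ β * d₁ := by positivity
      linarith) hε1'
  refine hmain.trans (ENNReal.ofReal_le_ofReal ?_)
  have hz1 : 1 ≤ c * ε ^ 4 * T ^ 2 := by
    have h1 : 1 ≤ ε ^ 2 * T := by linarith
    have h2 : 1 ≤ c * (ε ^ 2 * T) := hd1c.trans (by gcongr; linarith)
    have h3 : c * ε ^ 4 * T ^ 2 = c * (ε ^ 2 * T) * (ε ^ 2 * T) := by ring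
    rw [h3]; nlinarith
  refine le_trans (le_of_eq ?_)
    (add_exp_le_exp_div_log hc0 hcc₀ hc1 (by linarith : 64 ≤ T) hε0 hεe hz1)
  rw [hc₀, ← hβ]
  congr 3
  ring

end

theorem overcrowding_upper
    {Ω : Type*} [MeasurableSpace Ω] (P : Measure Ω) [IsProbabilityMeasure P]
    (μ : Measure ℝ) [IsProbabilityMeasure μ]
    (hsymm : μ.map (fun x => -x) = μ)
    (hcpt : Bornology.IsBounded (msupport μ))
    (hac : MeasureTheory.volume.withDensity (μ.rnDeriv MeasureTheory.volume) ≠ 0)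
    (A : ℝ) (hA : A = sSup ((fun x : ℝ => abs x) '' msupport μ))
    (F : ℝ → Ω → ℝ) (hF : IsSGP P μ F) :
    ∃ c > 0, ∃ d₁ > 0, ∃ d₂ > 0, ∀ T ≥ Real.exp 8, ∀ ε : ℝ,
      d₁ * Real.log T / Real.sqrt T ≤ ε → ε ≤ d₂ →
      P {ω | ENNReal.ofReal (A / Real.pi * T + ε * T) ≤ (zeroCount F T ω : ℝ≥0∞)} ≤
        ENNReal.ofReal (Real.exp (-c * (ε / Real.log ε) ^ 4 * T ^ 2)) := by
  have hAae : ∀ᵐ l ∂μ, |l| ≤ A := hA ▸ ae_abs_le_sSup_msupport hcpt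
  obtain ⟨E, hEm, hE, hE0, δ, hδ, hδμ⟩ := exists_smul_volume_restrict_le hAae hac
  have hA0 : 0 < A := by
    by_contra! h
    refine hE0 (measure_mono_null hE ?_)
    rw [Real.volume_Icc, ENNReal.ofReal_eq_zero]
    linarith
  obtain ⟨κ, hκ0, hκ⟩ := exists_exp_le_integral_norm_eval_sq hA0 hEm hE hE0 hδ hδμ
  obtain ⟨F', hF', hFF'⟩ := hF.exists_isSpectralGP
  have hπ := Real.pi_pos
  obtain ⟨β, hβ⟩ : ∃ x, x = Real.pi / (16 * A) := ⟨_, rfl⟩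
  have hβ0 : 0 < β := by rw [hβ]; positivity
  obtain ⟨c₀, hc₀⟩ : ∃ x, x = β ^ 2 / (32 * (5 + κ)) := ⟨_, rfl⟩
  have hc₀0 : 0 < c₀ := by rw [hc₀]; positivity
  obtain ⟨c, hc⟩ : ∃ x, x = min c₀ 1 / 2 := ⟨_, rfl⟩
  have hc0 : 0 < c := by rw [hc]; positivity
  have hcc₀ : 2 * c ≤ c₀ := by have := min_le_left c₀ 1; rw [hc]; linarith
  have hc1 : 2 * c ≤ 1 := by have := min_le_right c₀ 1; rw [hc]; linarith
  obtain ⟨d₁, hd₁⟩ : ∃ x, x = 1 + 1 / c + A + (2 + A * (3 + 16 * A)) / β + 4 * (5 + κ) / β :=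
    ⟨_, rfl⟩
  have p1 : 0 < 1 / c := by positivity
  have p2 : 0 < (2 + A * (3 + 16 * A)) / β := by positivity
  have p3 : 0 < 4 * (5 + κ) / β := by positivity
  have hd1 : 1 ≤ d₁ := by linarith
  have hd1c : 1 ≤ c * d₁ := by
    have : 1 / c ≤ d₁ := by linarith
    rw [div_le_iff₀ hc0] at this; linarith
  have hd1A : A ≤ d₁ := by linarith
  have hd1M : 2 + A * (3 + 16 * A) ≤ β * d₁ := by
    have : (2 + A * (3 + 16 * A)) / β ≤ d₁ := by linarith
    rw [div_le_iff₀ hβ0] at this; linarith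
  have hd1K : 4 * (5 + κ) ≤ β * d₁ := by
    have : 4 * (5 + κ) / β ≤ d₁ := by linarith
    rw [div_le_iff₀ hβ0] at this; linarith
  refine ⟨c, hc0, d₁, by linarith, min (Real.exp (-1)) (2 * A / Real.pi), by positivity,
    fun T hT ε hε1 hε2 => ?_⟩
  have hev : P {ω | ENNReal.ofReal (A / Real.pi * T + ε * T) ≤ (zeroCount F T ω : ℝ≥0∞)} ≤
      P {ω | ENNReal.ofReal (A / Real.pi * T + ε * T) ≤ (zeroCount F' T ω : ℝ≥0∞)} := by
    apply measure_mono_ae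
    filter_upwards [hFF'] with ω hω h
    have h1 : zeroCount F' T ω = zeroCount F T ω := by simp only [zeroCount, hω]
    change _ ≤ _
    rw [h1]; exact h
  exact hev.trans (hF'.measure_zeroCount_ge_le_exp hAae hA0 hκ0 hκ hβ hc₀ hc0 hcc₀ hc1 hd1 hd1c
    hd1A hd1M hd1K hT hε1 (hε2.trans (min_le_left _ _)) (hε2.trans (min_le_right _ _)))
end

section
/- Let μ be a compactly supported symmetric Borel probability measure on ℝ whose absolutely continuous part (with respect to Lebesgue measure) is nonzero, let A = sup{|λ| : λ ∈ supp μ}, and let F be a continuous centered stationary Gaussian process with spectral measure μ. Then for every ε > 0 there exists c > 0 such that for all T ≥ 1, P( N_F(T) ≥ (A/π)·T − ε·T ) ≥ exp(−c·T). -/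
open MeasureTheory ProbabilityTheory Set ENNReal NNReal

lemma card_le_encard_zeros {f : ℝ → ℝ} (hf : Continuous f) {n : ℕ} {z : Fin n → ℝ} {s T : ℝ}
    (hs : 0 ≤ s) (h0 : ∀ k, 0 ≤ z k - s) (hT : ∀ k, z k + s ≤ T)
    (hz : ∀ k l, k < l → z k + s < z l - s) (S : Finset (Fin n))
    (hS : ∀ k ∈ S, f (z k - s) * f (z k + s) ≤ 0) :
    (S.card : ℕ∞) ≤ {t ∈ Set.Icc (0:ℝ) T | f t = 0}.encard := by
  have h : ∀ k : Fin n, ∃ t ∈ Set.Icc (z k - s) (z k + s), k ∈ S → f t = 0 := by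
    intro k
    by_cases hk : k ∈ S
    · have h1 : (0:ℝ) ∈ Set.uIcc (f (z k - s)) (f (z k + s)) := by
        rw [Set.mem_uIcc]
        rcases mul_nonpos_iff.mp (hS k hk) with h | h
        · right; exact ⟨h.2, h.1⟩
        · left; exact h
      obtain ⟨t, ht, hft⟩ := intermediate_value_uIcc hf.continuousOn h1
      rw [Set.uIcc_of_le (by linarith)] at ht
      exact ⟨t, ht, fun _ => hft⟩
    · exact ⟨z k, ⟨by linarith, by linarith⟩, fun h => absurd h hk⟩
  choose t ht hft using h
  have hinj : Function.Injective t := by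
    intro k l hkl
    by_contra hne
    rcases lt_or_gt_of_ne hne with h | h
    · have := hz k l h; have := (ht k).2; have := (ht l).1; linarith
    · have := hz l k h; have := (ht l).2; have := (ht k).1; linarith
  rw [← Set.encard_coe_eq_coe_finsetCard, ← hinj.encard_image]
  apply Set.encard_le_encard
  rintro _ ⟨k, hk, rfl⟩
  exact ⟨⟨(h0 k).trans (ht k).1, (ht k).2.trans (hT k)⟩, hft k hk⟩

lemma exists_Ico_measureReal_ge (μ : Measure ℝ) [IsFiniteMeasure μ] (a b : ℝ) (hab : a < b) {K : ℕ}
    (hK : 0 < K) : ∃ j < K, μ.real (Ico a b) / K ≤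
      μ.real (Ico (a + j * ((b - a) / K)) (a + j * ((b - a) / K) + (b - a) / K)) := by
  by_contra! hcon
  have hK' : (0:ℝ) < K := by exact_mod_cast hK
  set w := (b - a) / K with hw
  have hw0 : 0 < w := div_pos (by linarith) hK'
  have hsub : Ico a b ⊆ ⋃ j ∈ Finset.range K, Ico (a + (j:ℝ) * w) (a + j * w + w) := by
    intro x hx
    have hnn : 0 ≤ (x - a) / w := div_nonneg (by linarith [hx.1]) hw0.le
    have h1 := Nat.floor_le hnn
    have h2 := Nat.lt_floor_add_one ((x - a) / w)
    rw [le_div_iff₀ hw0] at h1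
    rw [div_lt_iff₀ hw0] at h2
    simp only [Set.mem_iUnion, Finset.mem_range]
    refine ⟨⌊(x - a) / w⌋₊, ?_, by linarith, by linarith⟩
    rw [Nat.floor_lt hnn, div_lt_iff₀ hw0, hw, mul_div_cancel₀ _ hK'.ne']
    linarith [hx.2]
  have h1 : μ.real (Ico a b) ≤ ∑ j ∈ Finset.range K, μ.real (Ico (a + (j:ℝ) * w) (a + j * w + w)) :=
    (measureReal_mono hsub (measure_ne_top _ _)).trans (measureReal_biUnion_finset_le _ _)
  have h2 : ∑ j ∈ Finset.range K, μ.real (Ico (a + (j:ℝ) * w) (a + j * w + w))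
      < ∑ j ∈ Finset.range K, μ.real (Ico a b) / K :=
    Finset.sum_lt_sum_of_nonempty ⟨0, by simpa using hK⟩
      (fun j hj => hcon j (by simpa using hj))
  rw [Finset.sum_const, Finset.card_range, nsmul_eq_mul, mul_div_cancel₀ _ hK'.ne'] at h2
  linarith

lemma exp_le_gaussianReal_Ici (z : ℝ) :
    ENNReal.ofReal (Real.exp (-(z ^ 2 + 2))) ≤ gaussianReal 0 1 (Ici z) := by
  calc ENNReal.ofReal (Real.exp (-(z ^ 2 + 2)))
      = ∫⁻ x in Icc z (z + 1), ENNReal.ofReal (Real.exp (-(z ^ 2 + 2))) := by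
        simp
    _ ≤ ∫⁻ x in Icc z (z + 1), gaussianPDF 0 1 x := by
        refine setLIntegral_mono' measurableSet_Icc fun x hx => ?_
        rw [gaussianPDF, gaussianPDFReal]
        apply ENNReal.ofReal_le_ofReal
        have h1 : Real.exp (-1) ≤ (√(2 * Real.pi * ((1:ℝ≥0):ℝ)))⁻¹ := by
          rw [Real.exp_neg]
          apply inv_anti₀ (by positivity)
          rw [Real.sqrt_le_left (by positivity)]
          have := Real.exp_one_gt_d9
          have := Real.pi_lt_d2
          simp only [NNReal.coe_one, mul_one]
          nlinarith
        have h2 : Real.exp (-(z ^ 2 + 1)) ≤ Real.exp (-(x - 0) ^ 2 / (2 * ((1:ℝ≥0):ℝ))) := by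
          apply Real.exp_le_exp.mpr
          have := hx.1; have := hx.2
          simp only [NNReal.coe_one]
          nlinarith [sq_nonneg (z - 1)]
        calc Real.exp (-(z ^ 2 + 2)) = Real.exp (-1) * Real.exp (-(z ^ 2 + 1)) := by
              rw [← Real.exp_add]; ring_nf
          _ ≤ _ := by gcongr
    _ ≤ ∫⁻ x in Ici z, gaussianPDF 0 1 x := lintegral_mono_set Icc_subset_Ici_self
    _ = gaussianReal 0 1 (Ici z) := (gaussianReal_apply 0 one_ne_zero _).symm

lemma integrable_of_continuous_of_abs_le (ν : Measure ℝ) [IsFiniteMeasure ν] {f : ℝ → ℝ}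
    (hf : Continuous f) (C : ℝ) (hC : ∀ x, |f x| ≤ C) : Integrable f ν :=
  Integrable.of_bound hf.aestronglyMeasurable C (Filter.Eventually.of_forall hC)

lemma sum_covKernel_eq_integral (μ : Measure ℝ) [IsFiniteMeasure μ] {ι : Type*} [Fintype ι]
    (p c : ι → ℝ) :
    ∑ i, ∑ j, c i * c j * covKernel μ (p i - p j) =
      ∫ l, ((∑ i, c i * Real.cos (l * p i)) ^ 2 + (∑ i, c i * Real.sin (l * p i)) ^ 2) ∂μ := by
  have hint : ∀ i j, Integrable (fun l => c i * c j * Real.cos (l * (p i - p j))) μ := fun i j =>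
    (integrable_of_continuous_of_abs_le μ (by fun_prop) 1
      (fun x => Real.abs_cos_le_one _)).const_mul _
  simp only [covKernel, ← integral_const_mul]
  simp_rw [← integral_finsetSum _ (fun j _ => hint _ j)]
  rw [← integral_finsetSum _ (fun i _ => integrable_finsetSum _ (fun j _ => hint i j))]
  congr 1
  ext l
  rw [sq, sq, Finset.sum_mul_sum, Finset.sum_mul_sum, ← Finset.sum_add_distrib]
  refine Finset.sum_congr rfl fun i _ => ?_
  rw [← Finset.sum_add_distrib]
  refine Finset.sum_congr rfl fun j _ => ?_
  rw [mul_sub, Real.cos_sub]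
  ring

lemma sq_integral_le_measureReal_mul_integral_sq {α : Type*} [MeasurableSpace α] (ν : Measure α)
    [IsFiniteMeasure ν] {f : α → ℝ} (hf : Integrable f ν) (hf2 : Integrable (fun x => f x ^ 2) ν) :
    (∫ x, f x ∂ν) ^ 2 ≤ ν.real univ * ∫ x, f x ^ 2 ∂ν := by
  rcases eq_or_ne ν 0 with rfl | hν
  · simp
  have hm : 0 < ν.real univ := by
    simp [measureReal_def, ENNReal.toReal_pos_iff, hν]
  set m := ν.real univ
  set a := ∫ x, f x ∂ν
  have h : 0 ≤ ∫ x, (f x - a / m) ^ 2 ∂ν := integral_nonneg fun x => sq_nonneg _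
  have h2 : ∫ x, (f x - a / m) ^ 2 ∂ν = (∫ x, f x ^ 2 ∂ν) - 2 * (a / m) * a + (a / m) ^ 2 * m := by
    have : ∀ x, (f x - a / m) ^ 2 = (f x ^ 2 - 2 * (a / m) * f x) + (a / m) ^ 2 := fun x => by ring
    simp_rw [this]
    rw [integral_add (f := fun x => f x ^ 2 - 2 * (a / m) * f x) (hf2.sub (hf.const_mul _))
        (integrable_const _),
      integral_sub hf2 (hf.const_mul _), integral_const_mul, integral_const, smul_eq_mul]
    ring
  rw [h2] at h
  have h3 : (∫ x, f x ^ 2 ∂ν) - 2 * (a / m) * a + (a / m) ^ 2 * m = (∫ x, f x ^ 2 ∂ν) - a ^ 2 / m := by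
    field_simp
    ring
  rw [h3, sub_nonneg, div_le_iff₀ hm] at h
  linarith

lemma sq_sum_setIntegral_sin_le (μ : Measure ℝ) [IsFiniteMeasure μ] {ι : Type*} [Fintype ι]
    (p c : ι → ℝ) (φ : ℝ) (I : Set ℝ) :
    (∑ i, c i * ∫ l in I, Real.sin (l * p i - φ) ∂μ) ^ 2 ≤
      μ.real I * ∑ i, ∑ j, c i * c j * covKernel μ (p i - p j) := by
  have hbd : ∀ g : ι → ℝ → ℝ, (∀ i l, |g i l| ≤ 1) → ∀ l, |∑ i, c i * g i l| ≤ ∑ i, |c i| := by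
    intro g hg l
    refine (Finset.abs_sum_le_sum_abs _ _).trans (Finset.sum_le_sum fun i _ => ?_)
    rw [abs_mul]
    exact mul_le_of_le_one_right (abs_nonneg _) (hg i l)
  have hsq : ∀ (ν : Measure ℝ) [IsFiniteMeasure ν] (g : ι → ℝ → ℝ), (∀ i, Continuous (g i)) →
      (∀ i l, |g i l| ≤ 1) → Integrable (fun l => (∑ i, c i * g i l) ^ 2) ν := by
    intro ν _ g hgc hg
    refine integrable_of_continuous_of_abs_le ν (by fun_prop) ((∑ i, |c i|) ^ 2) fun l => ?_
    rw [abs_pow]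
    exact pow_le_pow_left₀ (abs_nonneg _) (hbd g hg l) 2
  have hint : ∀ i, Integrable (fun l => c i * Real.sin (l * p i - φ)) (μ.restrict I) := fun i =>
    (integrable_of_continuous_of_abs_le _ (by fun_prop) 1
      (fun x => Real.abs_sin_le_one _)).const_mul _
  have hsin := hsq (μ.restrict I) (fun i l => Real.sin (l * p i - φ)) (fun i => by fun_prop)
    (fun i l => Real.abs_sin_le_one _)
  have hfull : Integrable (fun l => (∑ i, c i * Real.cos (l * p i)) ^ 2 +
      (∑ i, c i * Real.sin (l * p i)) ^ 2) μ :=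
    (hsq μ (fun i l => Real.cos (l * p i)) (fun i => by fun_prop)
      (fun i l => Real.abs_cos_le_one _)).add
    (hsq μ (fun i l => Real.sin (l * p i)) (fun i => by fun_prop)
      (fun i l => Real.abs_sin_le_one _))
  simp only [← integral_const_mul]
  rw [← integral_finsetSum _ (fun i _ => hint i), sum_covKernel_eq_integral]
  refine (sq_integral_le_measureReal_mul_integral_sq _
    (integrable_finsetSum _ (fun i _ => hint i)) hsin).trans ?_
  rw [measureReal_restrict_apply_univ]
  refine mul_le_mul_of_nonneg_left ?_ measureReal_nonneg
  refine (integral_mono hsin hfull.restrict fun l => ?_).trans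
    (setIntegral_le_integral hfull (Filter.Eventually.of_forall fun l => by positivity))
  simp only [Real.sin_sub]
  have : ∑ i, c i * (Real.sin (l * p i) * Real.cos φ - Real.cos (l * p i) * Real.sin φ) =
      (∑ i, c i * Real.sin (l * p i)) * Real.cos φ - (∑ i, c i * Real.cos (l * p i)) * Real.sin φ := by
    rw [Finset.sum_mul, Finset.sum_mul, ← Finset.sum_sub_distrib]
    exact Finset.sum_congr rfl fun i _ => by ring
  rw [this]
  set u := ∑ i, c i * Real.sin (l * p i)
  set v := ∑ i, c i * Real.cos (l * p i)
  have h1 := Real.sin_sq_add_cos_sq φ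
  have : v ^ 2 + u ^ 2 - (u * Real.cos φ - v * Real.sin φ) ^ 2 =
      (u * Real.sin φ + v * Real.cos φ) ^ 2 := by linear_combination (-(u ^ 2) - v ^ 2) * h1
  nlinarith [sq_nonneg (u * Real.sin φ + v * Real.cos φ)]

lemma covKernel_neg (μ : Measure ℝ) (t : ℝ) : covKernel μ (-t) = covKernel μ t := by
  simp [covKernel]

lemma covKernel_zero (μ : Measure ℝ) [IsProbabilityMeasure μ] : covKernel μ 0 = 1 := by
  simp [covKernel]

/-- The covariance matrix of `(F_{p i})_i`. -/
noncomputable def covMatrix (μ : Measure ℝ) {ι : Type*} (p : ι → ℝ) : Matrix ι ι ℝ :=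
  Matrix.of fun i j => covKernel μ (p i - p j)

lemma covMatrix_isHermitian (μ : Measure ℝ) {ι : Type*} (p : ι → ℝ) :
    (covMatrix μ p).IsHermitian := by
  ext i j
  simp only [covMatrix, Matrix.conjTranspose_apply, Matrix.of_apply, star_trivial]
  rw [← covKernel_neg, neg_sub]

lemma dotProduct_covMatrix_mulVec (μ : Measure ℝ) {ι : Type*} [Fintype ι] (p c : ι → ℝ) :
    c ⬝ᵥ (covMatrix μ p).mulVec c = ∑ i, ∑ j, c i * c j * covKernel μ (p i - p j) := by
  simp only [dotProduct, Matrix.mulVec, covMatrix, Matrix.of_apply, Finset.mul_sum]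
  exact Finset.sum_congr rfl fun i _ => Finset.sum_congr rfl fun j _ => by ring

lemma covMatrix_posSemidef (μ : Measure ℝ) [IsFiniteMeasure μ] {ι : Type*} [Fintype ι] (p : ι → ℝ) :
    (covMatrix μ p).PosSemidef := by
  refine Matrix.PosSemidef.of_dotProduct_mulVec_nonneg (covMatrix_isHermitian μ p) fun c => ?_
  rw [star_trivial, dotProduct_covMatrix_mulVec, sum_covKernel_eq_integral]
  exact integral_nonneg fun l => by positivity

lemma dotProduct_vecMulVec_mulVec {ι : Type*} [Fintype ι] (g c : ι → ℝ) :
    c ⬝ᵥ (Matrix.vecMulVec g g).mulVec c = (∑ i, c i * g i) ^ 2 := by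
  rw [sq, Finset.sum_mul_sum]
  simp only [dotProduct, Matrix.mulVec, Matrix.vecMulVec_apply, Finset.mul_sum]
  exact Finset.sum_congr rfl fun i _ => Finset.sum_congr rfl fun j _ => by ring

lemma covMatrix_sub_vecMulVec_posSemidef (μ : Measure ℝ) [IsFiniteMeasure μ] {ι : Type*} [Fintype ι]
    (p : ι → ℝ) (φ : ℝ) (I : Set ℝ) (g : ι → ℝ)
    (hg : ∀ i, g i = (√(μ.real I))⁻¹ * ∫ l in I, Real.sin (l * p i - φ) ∂μ) :
    (covMatrix μ p - Matrix.vecMulVec g g).PosSemidef := by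
  refine Matrix.PosSemidef.of_dotProduct_mulVec_nonneg ((covMatrix_isHermitian μ p).sub ?_)
    fun c => ?_
  · ext i j
    simp [Matrix.vecMulVec_apply, mul_comm]
  · rw [star_trivial, Matrix.sub_mulVec, dotProduct_sub, dotProduct_covMatrix_mulVec, sub_nonneg]
    have h2 : ∑ i, c i * g i =
        (√(μ.real I))⁻¹ * ∑ i, c i * ∫ l in I, Real.sin (l * p i - φ) ∂μ := by
      rw [Finset.mul_sum]
      exact Finset.sum_congr rfl fun i _ => by rw [hg]; ring
    rw [dotProduct_vecMulVec_mulVec, h2, mul_pow, inv_pow, Real.sq_sqrt measureReal_nonneg]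
    have h3 := sq_sum_setIntegral_sin_le μ p c φ I
    rcases (measureReal_nonneg (μ := μ) (s := I)).eq_or_lt with h | h
    · rw [← h, _root_.inv_zero, zero_mul, sum_covKernel_eq_integral]
      exact integral_nonneg fun l => by positivity
    · rw [inv_mul_le_iff₀ h]
      exact h3

lemma IsSGP.aemeasurable {Ω : Type*} [MeasurableSpace Ω] {P : Measure Ω} {μ : Measure ℝ}
    {F : ℝ → Ω → ℝ} (hF : IsSGP P μ F) (t : ℝ) : AEMeasurable (F t) P := by
  by_contra h
  have h1 := hF.2 1 (fun _ => t) (fun _ => 1)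
  simp only [Finset.univ_unique, Finset.sum_singleton, one_mul] at h1
  rw [Measure.map_of_not_aemeasurable h] at h1
  exact IsProbabilityMeasure.ne_zero _ h1.symm

lemma IsSGP.map_sum {Ω : Type*} [MeasurableSpace Ω] {P : Measure Ω} {μ : Measure ℝ}
    {F : ℝ → Ω → ℝ} (hF : IsSGP P μ F) {ι : Type*} [Fintype ι] (p c : ι → ℝ) :
    P.map (fun ω => ∑ i, c i * F (p i) ω) =
      gaussianReal 0 (∑ i, ∑ j, c i * c j * covKernel μ (p i - p j)).toNNReal := by
  let e := (Fintype.equivFin ι).symm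
  have h := hF.2 _ (fun k => p (e k)) (fun k => c (e k))
  have h1 : (fun ω => ∑ k, c (e k) * F (p (e k)) ω) = fun ω => ∑ i, c i * F (p i) ω := by
    ext ω
    exact e.sum_comp (fun i => c i * F (p i) ω)
  have h2 : ∑ k, ∑ k', c (e k) * c (e k') * covKernel μ (p (e k) - p (e k')) =
      ∑ i, ∑ j, c i * c j * covKernel μ (p i - p j) := by
    rw [← e.sum_comp]
    exact Finset.sum_congr rfl fun k _ =>
      e.sum_comp (fun j => c (e k) * c j * covKernel μ (p (e k) - p j))
  rw [h1, h2] at h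
  exact h

lemma IsSGP.map_eq_multivariateGaussian {Ω : Type*} [MeasurableSpace Ω] {P : Measure Ω}
    [IsProbabilityMeasure P] {μ : Measure ℝ} [IsFiniteMeasure μ]
    {F : ℝ → Ω → ℝ} (hF : IsSGP P μ F) {ι : Type*} [Fintype ι] [DecidableEq ι] (p : ι → ℝ) :
    P.map (fun ω => WithLp.toLp 2 fun i => F (p i) ω) =
      multivariateGaussian 0 (covMatrix μ p) := by
  have hpsd := covMatrix_posSemidef μ p
  have hmeas : AEMeasurable (fun ω => WithLp.toLp 2 fun i => F (p i) ω) P :=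
    (WithLp.measurable_toLp 2 (ι → ℝ)).comp_aemeasurable
      (aemeasurable_pi_lambda _ fun i => hF.aemeasurable (p i))
  have := Measure.isProbabilityMeasure_map hmeas
  refine Measure.ext_of_charFun ?_
  ext c
  rw [charFun_multivariateGaussian hpsd, charFun_apply, integral_map hmeas (by fun_prop)]
  have h1 : charFun (P.map (fun ω => ∑ i, c i * F (p i) ω)) 1 =
      ∫ ω, Complex.exp ((∑ i, c i * F (p i) ω : ℝ) * Complex.I) ∂P := by
    rw [charFun_apply_real, integral_map]
    · simp
    · exact Finset.aemeasurable_fun_sum _ fun i _ => (hF.aemeasurable (p i)).const_mul _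
    · fun_prop
  have h0 := hpsd.dotProduct_mulVec_nonneg c.ofLp
  rw [star_trivial] at h0
  rw [hF.map_sum, charFun_gaussianReal, ← dotProduct_covMatrix_mulVec, Real.coe_toNNReal _ h0] at h1
  simp only [PiLp.inner_apply, RCLike.inner_apply, conj_trivial, WithLp.ofLp_zero, Pi.zero_apply,
    zero_mul, Finset.sum_const_zero]
  simpa using h1.symm

lemma multivariateGaussian_eq_conv {ι : Type*} [Fintype ι] [DecidableEq ι] {S : Matrix ι ι ℝ}
    (hS : S.PosSemidef) (g : ι → ℝ) (hSg : (S - Matrix.vecMulVec g g).PosSemidef) :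
    multivariateGaussian 0 S = multivariateGaussian 0 (S - Matrix.vecMulVec g g) ∗
      (gaussianReal 0 1).map (fun z => z • WithLp.toLp 2 g) := by
  have hm : Measurable (fun z : ℝ => z • WithLp.toLp 2 g) := by fun_prop
  have := Measure.isProbabilityMeasure_map (μ := gaussianReal 0 1) hm.aemeasurable
  refine Measure.ext_of_charFun ?_
  ext c
  rw [charFun_conv, charFun_multivariateGaussian hS, charFun_multivariateGaussian hSg,
    charFun_apply (μ := (gaussianReal 0 1).map _), integral_map hm.aemeasurable (by fun_prop)]
  simp_rw [real_inner_smul_left, mul_comm _ (inner ℝ _ _), Complex.ofReal_mul]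
  rw [← charFun_apply_real, charFun_gaussianReal, ← Complex.exp_add, Matrix.sub_mulVec,
    dotProduct_sub]
  have h1 : c.ofLp ⬝ᵥ (Matrix.vecMulVec g g).mulVec c.ofLp = (inner ℝ (WithLp.toLp 2 g) c) ^ 2 := by
    rw [dotProduct_vecMulVec_mulVec]
    simp only [PiLp.inner_apply, RCLike.inner_apply, conj_trivial]
  rw [h1]
  congr 1
  push_cast
  simp
  ring

lemma mul_le_multivariateGaussian {ι : Type*} [Fintype ι] [DecidableEq ι] {S : Matrix ι ι ℝ}
    (hS : S.PosSemidef) (g : ι → ℝ) (hSg : (S - Matrix.vecMulVec g g).PosSemidef)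
    {B G : Set (EuclideanSpace ℝ ι)} (hG : MeasurableSet G) (z₀ : ℝ)
    (h : ∀ y ∈ B, ∀ z ≥ z₀, y + z • WithLp.toLp 2 g ∈ G) :
    multivariateGaussian 0 (S - Matrix.vecMulVec g g) B * gaussianReal 0 1 (Ici z₀) ≤
      multivariateGaussian 0 S G := by
  have hm : Measurable (fun z : ℝ => z • WithLp.toLp 2 g) := by fun_prop
  have := Measure.isProbabilityMeasure_map (μ := gaussianReal 0 1) hm.aemeasurable
  rw [multivariateGaussian_eq_conv hS g hSg, Measure.conv,
    Measure.map_apply (by fun_prop) hG]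
  calc _ ≤ multivariateGaussian 0 (S - Matrix.vecMulVec g g) B *
        (gaussianReal 0 1).map (fun z => z • WithLp.toLp 2 g)
          ((fun z : ℝ => z • WithLp.toLp 2 g) '' Ici z₀) := by
        gcongr
        exact (measure_mono (Set.subset_preimage_image _ _)).trans
          (Measure.le_map_apply hm.aemeasurable _)
    _ = _ := (Measure.prod_prod _ _).symm
    _ ≤ _ := by
        refine measure_mono ?_
        rintro ⟨y, w⟩ ⟨hy, z, hz, rfl⟩
        exact h y hy z hz

lemma half_le_multivariateGaussian {ι : Type*} [Fintype ι] [DecidableEq ι] [Nonempty ι]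
    {S : Matrix ι ι ℝ} (hS : S.PosSemidef) (hdiag : ∀ i, S i i ≤ 1) :
    ENNReal.ofReal (1 / 2) ≤
      multivariateGaussian 0 S {y | ∑ i, y i ^ 2 ≤ 2 * Fintype.card ι} := by
  set ν := multivariateGaussian 0 S with hν
  have hN : (0:ℝ) < Fintype.card ι := by exact_mod_cast Fintype.card_pos
  have hmem : ∀ i, MemLp (fun y : EuclideanSpace ℝ ι => y i) 2 ν := fun i => by
    have h := (measurePreserving_eval_multivariateGaussian (μ := 0) hS (i := i))
    have h2 := memLp_id_gaussianReal' (μ := (0 : EuclideanSpace ℝ ι) i) (v := (S i i).toNNReal) 2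
      (by norm_num)
    exact h2.comp_measurePreserving h
  have hvar : ∀ i, ∫ y, y i ^ 2 ∂ν = S i i := fun i => by
    rw [← variance_eval_multivariateGaussian (μ := 0) hS i, variance_of_integral_eq_zero]
    · exact (hmem i).aemeasurable
    · have h := (measurePreserving_eval_multivariateGaussian (μ := 0) hS (i := i))
      have h2 := integral_map (μ := ν) (φ := fun y : EuclideanSpace ℝ ι => y i)
        h.measurable.aemeasurable (f := fun x => x) (by fun_prop)
      rw [← h2, hν, h.map_eq]
      simp
  have hint : Integrable (fun y : EuclideanSpace ℝ ι => ∑ i, y i ^ 2) ν :=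
    integrable_finsetSum _ fun i _ => (hmem i).integrable_sq
  have hE : ∫ y, ∑ i, y i ^ 2 ∂ν ≤ Fintype.card ι := by
    rw [integral_finsetSum _ fun i _ => (hmem i).integrable_sq]
    simp_rw [hvar]
    exact (Finset.sum_le_sum fun i _ => hdiag i).trans (by simp)
  have hmk := mul_meas_ge_le_integral_of_nonneg (μ := ν)
    (Filter.Eventually.of_forall fun y => Finset.sum_nonneg fun i _ => sq_nonneg (y i)) hint
    (2 * Fintype.card ι)
  have hcomp : ν.real {y | 2 * (Fintype.card ι : ℝ) ≤ ∑ i, y i ^ 2} ≤ 1 / 2 := by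
    by_contra! hcon
    nlinarith
  have hmeas : Measurable fun y : EuclideanSpace ℝ ι => ∑ i, y i ^ 2 := by fun_prop
  have hB : MeasurableSet {y : EuclideanSpace ℝ ι | ∑ i, y i ^ 2 ≤ 2 * Fintype.card ι} :=
    measurableSet_le hmeas measurable_const
  rw [← ofReal_measureReal]
  apply ENNReal.ofReal_le_ofReal
  have h1 := probReal_add_probReal_compl (μ := ν) hB
  have h2 : ν.real {y : EuclideanSpace ℝ ι | ∑ i, y i ^ 2 ≤ 2 * Fintype.card ι}ᶜ ≤
      ν.real {y | 2 * (Fintype.card ι : ℝ) ≤ ∑ i, y i ^ 2} :=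
    measureReal_mono fun y hy => by
      simp only [mem_compl_iff, mem_ofPred_eq, not_le] at hy ⊢
      exact hy.le
  linarith
lemma mul_measureReal_le_setIntegral {μ : Measure ℝ} [IsFiniteMeasure μ] {I : Set ℝ}
    (hI : MeasurableSet I) {f : ℝ → ℝ} (hf : Integrable f μ) {κ : ℝ} (h : ∀ l ∈ I, κ ≤ f l) :
    κ * μ.real I ≤ ∫ l in I, f l ∂μ := by
  have := setIntegral_mono_on (integrable_const κ).integrableOn hf.integrableOn hI h
  rwa [setIntegral_const, smul_eq_mul, mul_comm] at this

lemma IsSGP.le_measure_zeroCount {Ω : Type*} [MeasurableSpace Ω] {P : Measure Ω}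
    [IsProbabilityMeasure P] {μ : Measure ℝ} [IsProbabilityMeasure μ]
    {F : ℝ → Ω → ℝ} (hF : IsSGP P μ F) {n : ℕ} (hn : 0 < n) {z : Fin n → ℝ} {s T : ℝ}
    (hs : 0 ≤ s) (h0 : ∀ k, 0 ≤ z k - s) (hT : ∀ k, z k + s ≤ T)
    (hz : ∀ k l, k < l → z k + s < z l - s)
    {I : Set ℝ} (hI : MeasurableSet I) (hv : 0 < μ.real I) {φ κ : ℝ} (hκ : 0 < κ)
    (hright : ∀ k : Fin n, ∀ l ∈ I, κ ≤ (-1) ^ (k : ℕ) * Real.sin (l * (z k + s) - φ))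
    (hleft : ∀ k : Fin n, ∀ l ∈ I, κ ≤ -((-1) ^ (k : ℕ) * Real.sin (l * (z k - s) - φ)))
    {M : ℝ} (hM : 0 < M) :
    ENNReal.ofReal (1 / 2) * ENNReal.ofReal (Real.exp (-((M / (κ * √(μ.real I))) ^ 2 + 2))) ≤
      P {ω | ENNReal.ofReal (n - 4 * n / M ^ 2) ≤ (zeroCount F T ω : ℝ≥0∞)} := by
  have : Nonempty (Fin n × Bool) := ⟨⟨⟨0, hn⟩, true⟩⟩
  set v := μ.real I with hvdef
  have hsv : 0 < √v := Real.sqrt_pos.mpr hv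
  let p : Fin n × Bool → ℝ := fun i => bif i.2 then z i.1 + s else z i.1 - s
  let g : Fin n × Bool → ℝ := fun i => (√v)⁻¹ * ∫ l in I, Real.sin (l * p i - φ) ∂μ
  let G : Set (EuclideanSpace ℝ (Fin n × Bool)) := {x | (n - 4 * n / M ^ 2 : ℝ) ≤
    ∑ k : Fin n, if x (k, false) * x (k, true) ≤ 0 then 1 else 0}
  have hint : ∀ t σ, Integrable (fun l => σ * Real.sin (l * t - φ)) μ := fun t σ =>
    (integrable_of_continuous_of_abs_le μ (by fun_prop) 1
      (fun x => Real.abs_sin_le_one _)).const_mul _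
  have hvv : (√v)⁻¹ * (κ * v) = κ * √v := by
    nth_rewrite 2 [← Real.mul_self_sqrt hv.le]
    field_simp
  have hgt : ∀ k : Fin n, κ * √v ≤ (-1) ^ (k : ℕ) * g (k, true) := fun k => by
    have h := mul_measureReal_le_setIntegral hI (hint (z k + s) _) (hright k)
    rw [integral_const_mul, ← hvdef] at h
    calc κ * √v = (√v)⁻¹ * (κ * v) := hvv.symm
      _ ≤ (√v)⁻¹ * _ := mul_le_mul_of_nonneg_left h (by positivity)
      _ = _ := by simp only [g, p, cond_true]; ring
  have hgf : ∀ k : Fin n, κ * √v ≤ -((-1) ^ (k : ℕ) * g (k, false)) := fun k => by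
    have h := mul_measureReal_le_setIntegral hI (hint (z k - s) (-(-1) ^ (k : ℕ)))
      (fun l hl => by rw [neg_mul]; exact hleft k l hl)
    rw [integral_const_mul, ← hvdef] at h
    calc κ * √v = (√v)⁻¹ * (κ * v) := hvv.symm
      _ ≤ (√v)⁻¹ * _ := mul_le_mul_of_nonneg_left h (by positivity)
      _ = _ := by simp only [g, p, cond_false]; ring
  have hG : MeasurableSet G := by
    refine measurableSet_le measurable_const (Finset.measurable_sum _ fun k _ => ?_)
    exact Measurable.ite (measurableSet_le (by fun_prop) measurable_const)
      measurable_const measurable_const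
  have hS := covMatrix_posSemidef μ p
  have hSg := covMatrix_sub_vecMulVec_posSemidef μ p φ I g (fun i => rfl)
  have hdiag : ∀ i, (covMatrix μ p - Matrix.vecMulVec g g) i i ≤ 1 := fun i => by
    simp only [Matrix.sub_apply, covMatrix, Matrix.of_apply, sub_self, covKernel_zero,
      Matrix.vecMulVec_apply]
    nlinarith [mul_self_nonneg (g i)]
  have hBG : ∀ y ∈ {y : EuclideanSpace ℝ (Fin n × Bool) |
      ∑ i, y i ^ 2 ≤ 2 * Fintype.card (Fin n × Bool)},
      ∀ w ≥ M / (κ * √v), y + w • WithLp.toLp 2 g ∈ G := by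
    intro y hy w hw
    rw [mem_ofPred_eq, Fintype.sum_prod_type] at hy
    simp only [Fintype.sum_bool, Fintype.card_prod, Fintype.card_fin, Fintype.card_bool] at hy
    push_cast at hy
    rw [ge_iff_le, div_le_iff₀ (by positivity)] at hw
    have hw0 : 0 < w := by
      by_contra! hcon
      nlinarith [mul_nonpos_of_nonpos_of_nonneg hcon (by positivity : 0 ≤ κ * √v)]
    have hterm : ∀ k : Fin n, M ^ 2 - (y (k, true) ^ 2 + y (k, false) ^ 2) ≤
        M ^ 2 * if (y + w • WithLp.toLp 2 g) (k, false) * (y + w • WithLp.toLp 2 g) (k, true) ≤ 0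
          then 1 else 0 := by
      intro k
      split_ifs with hk
      · nlinarith [sq_nonneg (y (k, true)), sq_nonneg (y (k, false))]
      · by_contra! hcon
        apply hk
        have h1 : |y (k, true)| < M := abs_lt_of_sq_lt_sq
          (by nlinarith [sq_nonneg (y (k, false))]) hM.le
        have h2 : |y (k, false)| < M := abs_lt_of_sq_lt_sq
          (by nlinarith [sq_nonneg (y (k, true))]) hM.le
        have h3 := mul_le_mul_of_nonneg_left (hgt k) hw0.le
        have h4 := mul_le_mul_of_nonneg_left (hgf k) hw0.le
        rw [abs_lt] at h1 h2
        simp only [PiLp.add_apply, PiLp.smul_apply, smul_eq_mul]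
        rcases neg_one_pow_eq_or ℝ (k : ℕ) with h | h <;> rw [h] at h3 h4
        · exact mul_nonpos_of_nonpos_of_nonneg (by linarith) (by linarith)
        · exact mul_nonpos_of_nonneg_of_nonpos (by linarith) (by linarith)
    have hsum := Finset.sum_le_sum fun k (_ : k ∈ Finset.univ) => hterm k
    rw [← Finset.mul_sum, Finset.sum_sub_distrib, Finset.sum_const, Finset.card_univ,
      Fintype.card_fin, nsmul_eq_mul] at hsum
    simp only [G, mem_ofPred_eq]
    rw [← mul_le_mul_iff_right₀ (pow_pos hM 2)]
    refine le_trans ?_ hsum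
    rw [mul_sub, mul_div_cancel₀ _ (pow_pos hM 2).ne']
    linarith
  have hmeas : AEMeasurable (fun ω => WithLp.toLp 2 fun i => F (p i) ω) P :=
    (WithLp.measurable_toLp 2 (Fin n × Bool → ℝ)).comp_aemeasurable
      (aemeasurable_pi_lambda _ fun i => hF.aemeasurable (p i))
  calc _ ≤ _ := mul_le_mul' (half_le_multivariateGaussian hSg hdiag) (exp_le_gaussianReal_Ici _)
    _ ≤ _ := mul_le_multivariateGaussian hS g hSg hG _ hBG
    _ = P ((fun ω => WithLp.toLp 2 fun i => F (p i) ω) ⁻¹' G) := by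
        rw [← hF.map_eq_multivariateGaussian p, Measure.map_apply_of_aemeasurable hmeas hG]
    _ ≤ _ := by
        refine measure_mono fun ω hω => ?_
        simp only [G, mem_preimage, mem_ofPred_eq, p, cond_true, cond_false] at hω ⊢
        rw [Finset.sum_boole] at hω
        have h := card_le_encard_zeros (hF.1 ω) hs h0 hT hz
          {k | F (z k - s) ω * F (z k + s) ω ≤ 0} (fun k hk => (Finset.mem_filter.mp hk).2)
        refine (ENNReal.ofReal_le_ofReal hω).trans ?_
        rw [ENNReal.ofReal_natCast, ← ENat.toENNReal_coe]
        exact ENat.toENNReal_le.mpr h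
lemma exists_measureReal_Ico_pos (μ : Measure ℝ) [IsFiniteMeasure μ]
    (hsymm : μ.map (fun x => -x) = μ) {x a b : ℝ} (hx : x ∈ msupport μ) (ha : a < |x|)
    (hb : |x| < b) : 0 < μ.real (Ico a b) := by
  rw [measureReal_def, ENNReal.toReal_pos_iff]
  refine ⟨?_, measure_lt_top _ _⟩
  rcases abs_cases x with ⟨h, -⟩ | ⟨h, -⟩ <;> rw [h] at ha hb
  · exact hx _ (Ico_mem_nhds ha hb)
  · rw [← hsymm, Measure.map_apply measurable_neg measurableSet_Ico]
    refine hx _ (continuous_neg.continuousAt.preimage_mem_nhds (Ico_mem_nhds ha hb))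

lemma neg_one_pow_mul_sin (k : ℕ) (x : ℝ) :
    (-1) ^ k * Real.sin (x + k * Real.pi) = Real.sin x := by
  rw [Real.sin_add_nat_mul_pi, ← mul_assoc, ← pow_add, ← two_mul, pow_mul]
  simp

lemma le_neg_one_pow_mul_sin {B s T κ l t : ℝ} (k : ℕ) (hκ : 0 ≤ κ) (hT : 0 < T)
    (ht : t ∈ Icc 0 T) (hl : |l - B| ≤ κ / T) (x : ℝ) (hx : B * t - B * s = x + k * Real.pi) :
    Real.sin x - κ ≤ (-1) ^ k * Real.sin (l * t - B * s) ∧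
      (-1) ^ k * Real.sin (l * t - B * s) ≤ Real.sin x + κ := by
  have h1 : |(-1) ^ k * Real.sin (l * t - B * s) - Real.sin x| ≤ κ := by
    rw [← neg_one_pow_mul_sin k x, ← hx, ← mul_sub, abs_mul, abs_pow, abs_neg, abs_one, one_pow,
      one_mul]
    refine (Real.abs_sin_sub_sin_le _ _).trans ?_
    have : l * t - B * s - (B * t - B * s) = (l - B) * t := by ring
    rw [this, abs_mul, abs_of_nonneg ht.1]
    calc |l - B| * t ≤ κ / T * T := mul_le_mul hl ht.2 ht.1 (by positivity)
      _ = κ := div_mul_cancel₀ _ hT.ne'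
  rw [abs_le] at h1
  constructor <;> linarith

set_option maxHeartbeats 1000000 in
theorem overcrowding_lower
    {Ω : Type*} [MeasurableSpace Ω] (P : Measure Ω) [IsProbabilityMeasure P]
    (μ : Measure ℝ) [IsProbabilityMeasure μ]
    (hsymm : μ.map (fun x => -x) = μ)
    (hcpt : Bornology.IsBounded (msupport μ))
    (hac : MeasureTheory.volume.withDensity (μ.rnDeriv MeasureTheory.volume) ≠ 0)
    (A : ℝ) (hA : A = sSup ((fun x : ℝ => abs x) '' msupport μ))
    (F : ℝ → Ω → ℝ) (hF : IsSGP P μ F) :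
    ∀ ε > (0:ℝ), ∃ c > (0:ℝ), ∀ T ≥ (1:ℝ),
      ENNReal.ofReal (Real.exp (-c * T)) ≤
        P {ω | ENNReal.ofReal (A / Real.pi * T - ε * T) ≤ (zeroCount F T ω : ℝ≥0∞)} := by
  intro ε hε
  have hπ := Real.pi_pos
  by_cases hAε : A ≤ ε * Real.pi
  · refine ⟨1, one_pos, fun T hT => ?_⟩
    have hle : A / Real.pi * T - ε * T ≤ 0 := by
      rw [← sub_mul]
      exact mul_nonpos_of_nonpos_of_nonneg (sub_nonpos.mpr ((div_le_iff₀ hπ).mpr hAε))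
        (by linarith)
    simp only [ENNReal.ofReal_of_nonpos hle, zero_le, ofPred_true, measure_univ]
    rw [ENNReal.ofReal_le_one]
    exact Real.exp_le_one_iff.mpr (by linarith)
  push Not at hAε
  have hεπ : 0 < ε * Real.pi := by positivity
  have hA0 : 0 < A := hεπ.trans hAε
  set δ := ε * Real.pi / 4 with hδ
  have hδ0 : 0 < δ := by positivity
  obtain ⟨x, hx, hxA⟩ : ∃ x ∈ msupport μ, A - δ < |x| := by
    have hne : ((fun x : ℝ => |x|) '' msupport μ).Nonempty := by
      by_contra hcon
      rw [Set.not_nonempty_iff_eq_empty] at hcon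
      rw [hcon, Real.sSup_empty] at hA
      linarith
    obtain ⟨_, ⟨x, hx, rfl⟩, h⟩ := exists_lt_of_lt_csSup hne
      (show A - δ < _ by rw [← hA]; linarith)
    exact ⟨x, hx, h⟩
  have hxA' : |x| < 2 * A := by
    obtain ⟨R, hR⟩ := hcpt.exists_norm_le
    have hbdd : BddAbove ((fun x : ℝ => |x|) '' msupport μ) := by
      refine ⟨R, ?_⟩
      rintro _ ⟨y, hy, rfl⟩
      exact hR y hy
    have : |x| ≤ A := by rw [hA]; exact le_csSup hbdd ⟨x, hx, rfl⟩
    linarith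
  set m := μ.real (Ico (A - δ) (2 * A)) with hm
  have hm0 : 0 < m := exists_measureReal_Ico_pos μ hsymm hx hxA hxA'
  set s := min (ε * Real.pi / (16 * A)) (1 / (2 * A)) with hs
  have hs0 : 0 < s := lt_min (by positivity) (by positivity)
  have hs1 : s * (16 * A) ≤ ε * Real.pi :=
    (le_div_iff₀ (by positivity)).mp (min_le_left _ _)
  have hs2 : s * (2 * A) ≤ 1 := (le_div_iff₀ (by positivity)).mp (min_le_right _ _)
  have hπ3 := Real.pi_gt_three
  set κ := Real.sin (A * s / 2) / 2 with hκ
  have hAs : 0 < A * s := by positivity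
  have hκ0 : 0 < κ := half_pos (Real.sin_pos_of_pos_of_lt_pi (by linarith) (by linarith))
  set C := A / Real.pi + 1 with hC
  have hC0 : 0 < C := by positivity
  set M := √(8 * C / ε) with hMdef
  have hM0 : 0 < M := Real.sqrt_pos.mpr (by positivity)
  have hM2 : M ^ 2 = 8 * C / ε := Real.sq_sqrt (by positivity)
  set D := M ^ 2 * (2 * A / κ + 1) / (κ ^ 2 * m) with hD
  have hD0 : 0 < D := by positivity
  refine ⟨D + 3, by positivity, fun T hT => ?_⟩
  have hT0 : 0 < T := by linarith
  set K := ⌈2 * A * T / κ⌉₊ with hK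
  have hKpos : 0 < K := Nat.ceil_pos.mpr (by positivity)
  have hKpos' : (0:ℝ) < K := by exact_mod_cast hKpos
  have hKge : 2 * A * T / κ ≤ K := Nat.le_ceil _
  have hKle : (K:ℝ) ≤ (2 * A / κ + 1) * T := by
    have h1 := (Nat.ceil_lt_add_one (show 0 ≤ 2 * A * T / κ by positivity)).le
    calc (K:ℝ) ≤ 2 * A * T / κ + 1 := h1
      _ ≤ 2 * A * T / κ + T := by linarith
      _ = _ := by ring
  obtain ⟨j, hjK, hj⟩ := exists_Ico_measureReal_ge μ (A - δ) (2 * A) (by linarith) hKpos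
  set w := (2 * A - (A - δ)) / K with hw
  set B := A - δ + j * w with hB
  have hw0 : 0 < w := div_pos (by linarith) hKpos'
  have hwκ : w ≤ κ / T := by
    rw [hw, div_le_div_iff₀ hKpos' hT0]
    rw [div_le_iff₀ hκ0] at hKge
    have h1 : (2 * A - (A - δ)) * T ≤ 2 * A * T := by
      gcongr
      linarith
    linarith
  have hBge : A - δ ≤ B := by
    have : 0 ≤ (j:ℝ) * w := by positivity
    linarith
  have hBle : B ≤ 2 * A := by
    have h1 : (j:ℝ) * w ≤ K * w := by
      have : (j:ℝ) ≤ K := by exact_mod_cast hjK.le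
      gcongr
    have h2 : (K:ℝ) * w = 2 * A - (A - δ) := mul_div_cancel₀ _ hKpos'.ne'
    linarith
  have hBpos : 0 < B := by linarith
  set I := Ico B (B + w) with hI
  have hv : m / K ≤ μ.real I := hj
  have hv0 : 0 < μ.real I := lt_of_lt_of_le (by positivity) hv
  set n := ⌈(A / Real.pi - ε / 2) * T⌉₊ with hn
  have hn1 : 0 < (A / Real.pi - ε / 2) * T := by
    refine mul_pos ?_ hT0
    have : ε < A / Real.pi := (lt_div_iff₀ hπ).mpr hAε
    linarith
  have hnpos : 0 < n := Nat.ceil_pos.mpr hn1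
  have hnge : (A / Real.pi - ε / 2) * T ≤ n := Nat.le_ceil _
  have hnlt : (n:ℝ) < (A / Real.pi - ε / 2) * T + 1 := Nat.ceil_lt_add_one hn1.le
  have hnC : (n:ℝ) ≤ C * T := by
    have : 0 < ε / 2 * T := by positivity
    rw [hC]
    linarith
  let z : Fin n → ℝ := fun k => s + k * (Real.pi / B)
  have hBs : B * s ≤ 1 := by
    calc B * s ≤ 2 * A * s := by gcongr
      _ = s * (2 * A) := by ring
      _ ≤ 1 := hs2
  have hBs' : A * s / 2 ≤ B * s := by
    have h1 : A / 2 ≤ B := by linarith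
    calc A * s / 2 = A / 2 * s := by ring
      _ ≤ B * s := by gcongr
  have hBdiv : B * (Real.pi / B) = Real.pi := mul_div_cancel₀ _ hBpos.ne'
  have h0 : ∀ k, 0 ≤ z k - s := fun k => by
    simp only [z, add_sub_cancel_left]
    positivity
  have hzT : ∀ k, z k + s ≤ T := fun k => by
    have hk : (k:ℝ) + 1 ≤ n := by exact_mod_cast k.2
    have hk' : (k:ℝ) ≤ (A / Real.pi - ε / 2) * T := by linarith
    have h1 : (k:ℝ) * Real.pi ≤ (A - 2 * δ) * T := by
      calc (k:ℝ) * Real.pi ≤ (A / Real.pi - ε / 2) * T * Real.pi := by gcongr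
        _ = (A - 2 * δ) * T := by rw [hδ]; field_simp; ring
    have h2 : B * (z k + s) ≤ B * T := by
      calc B * (z k + s) = 2 * (B * s) + k * (B * (Real.pi / B)) := by simp only [z]; ring
        _ ≤ δ + (A - 2 * δ) * T := by
          rw [hBdiv]
          have : B * s ≤ 2 * A * s := by gcongr
          linarith
        _ ≤ (A - δ) * T := by
          have : δ * 1 ≤ δ * T := by gcongr
          linarith
        _ ≤ B * T := by gcongr
    exact le_of_mul_le_mul_left h2 hBpos
  have hzz : ∀ k l, k < l → z k + s < z l - s := fun k l hkl => by
    have hkl' : (k:ℝ) + 1 ≤ l := by exact_mod_cast hkl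
    have h1 : 2 * s < Real.pi / B := by
      rw [lt_div_iff₀ hBpos]
      linarith
    have h2 : ((k:ℝ) + 1) * (Real.pi / B) ≤ l * (Real.pi / B) := by gcongr
    simp only [z]
    linarith
  have hsin : 2 * κ ≤ Real.sin (B * s) := by
    rw [hκ, mul_div_cancel₀ _ two_ne_zero]
    exact Real.sin_le_sin_of_le_of_le_pi_div_two (by linarith) (by linarith) hBs'
  have hlI : ∀ l ∈ I, |l - B| ≤ κ / T := fun l hl => by
    rw [abs_of_nonneg (by linarith [hl.1])]
    linarith [hl.2]
  have hmain := hF.le_measure_zeroCount hnpos hs0.le h0 hzT hzz measurableSet_Ico hv0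
    (φ := B * s) hκ0
    (fun k l hl => by
      have := (le_neg_one_pow_mul_sin (s := s) (k : ℕ) hκ0.le hT0
        ⟨by linarith [h0 k], hzT k⟩ (hlI l hl) (B * s)
        (by simp only [z]; linear_combination (k:ℝ) * hBdiv)).1
      linarith)
    (fun k l hl => by
      have := (le_neg_one_pow_mul_sin (s := s) (k : ℕ) hκ0.le hT0
        ⟨h0 k, by linarith [hzT k]⟩ (hlI l hl) (-(B * s))
        (by simp only [z]; linear_combination (k:ℝ) * hBdiv)).2
      rw [Real.sin_neg] at this
      linarith) hM0
  have hz0 : (M / (κ * √(μ.real I))) ^ 2 ≤ D * T := by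
    rw [div_pow, mul_pow, Real.sq_sqrt hv0.le]
    calc M ^ 2 / (κ ^ 2 * μ.real I) ≤ M ^ 2 / (κ ^ 2 * (m / K)) := by gcongr
      _ = M ^ 2 * K / (κ ^ 2 * m) := by field_simp
      _ ≤ M ^ 2 * ((2 * A / κ + 1) * T) / (κ ^ 2 * m) := by gcongr
      _ = D * T := by rw [hD]; ring
  have hhalf : Real.exp (-1) ≤ 1 / 2 := by
    rw [Real.exp_neg, one_div]
    exact inv_anti₀ two_pos (by linarith [Real.exp_one_gt_d9])
  calc ENNReal.ofReal (Real.exp (-(D + 3) * T))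
      ≤ ENNReal.ofReal (1 / 2 * Real.exp (-((M / (κ * √(μ.real I))) ^ 2 + 2))) := by
        apply ENNReal.ofReal_le_ofReal
        calc Real.exp (-(D + 3) * T)
            ≤ Real.exp (-1 + -((M / (κ * √(μ.real I))) ^ 2 + 2)) := by
              apply Real.exp_le_exp.mpr
              linarith
          _ = Real.exp (-1) * Real.exp (-((M / (κ * √(μ.real I))) ^ 2 + 2)) := Real.exp_add _ _
          _ ≤ _ := by gcongr
    _ = _ := ENNReal.ofReal_mul (by norm_num)
    _ ≤ _ := hmain
    _ ≤ _ := by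
        refine measure_mono fun ω hω => le_trans (ENNReal.ofReal_le_ofReal ?_) hω
        have h1 : 4 * n / M ^ 2 ≤ ε / 2 * T := by
          rw [hM2, div_le_iff₀ (by positivity)]
          calc 4 * (n:ℝ) ≤ 4 * (C * T) := by gcongr
            _ = ε / 2 * T * (8 * C / ε) := by field_simp; ring
        linarith
end
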